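/- Let (Ω,σ) be a bounded one-sided NTA pair of mixed dimension in ℝ^n with n ≥ 3. There exist constants M₀ > 1, C ≥ 1 and β > 0, depending only on the geometric constants, such that the following holds. Let Q ∈ ∂Ω, 0 < R ≤ diam(Ω), a > 0; let u_R be a nonnegative weak solution of the homogeneous Robin problem in B(Q,R) (with parameter a); let u_D be a nonnegative function, continuous on cl(Ω) ∩ B(Q,R), harmonic on Ω ∩ B(Q,R), and vanishing on ∂Ω ∩ B(Q,R). Suppose 0 < δ₀ ≤ 1/M₀ is such that a(δ₀R)^{2−n}σ(B(z, δ₀R)) > M₀ for every z ∈ ∂Ω ∩ B(Q, 9R/10); suppose u_R ≥ u_D on Ω ∩ B(Q,R); and suppose that for some λ ≥ 1 one has u_R(X) ≤ λ·u_D(X) for all X ∈ Ω ∩ B(Q,R) with δ(X) ≥ δ₀R. Then u_R(ξ) ≤ (1+η)·λ·u_D(ξ) for every ξ ∈ Ω ∩ B(Q, 4R/5) with δ(ξ) ≥ δ₀R/2, where η = C·min( M₀^{−β}, e^{−β/δ₀} + sup_{z ∈ ∂Ω ∩ B(Q,9R/10)} (a(δ₀R)^{2−n}σ(B(z, δ₀R)))^{−β}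 ). -/

import Mathlib

open MeasureTheory Metric Set
open scoped RealInnerProductSpace ENNReal NNReal Topology

noncomputable section

/-- The (second-order) Laplacian-based notion of harmonicity: `u` is `C²` near each point of `S`
and its Laplacian (the sum of pure second derivatives) vanishes on `S`. -/
def IsHarmonicOn {n : ℕ} (u : EuclideanSpace ℝ (Fin n) → ℝ)
    (S : Set (EuclideanSpace ℝ (Fin n))) : Prop :=
  ∀ x ∈ S, ContDiffAt ℝ 2 u x ∧
    ∑ i : Fin n, iteratedFDeriv ℝ 2 u x ![EuclideanSpace.single i (1 : ℝ),
      EuclideanSpace.single i (1 : ℝ)] = 0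

/-- One-sided NTA conditions (C1) interior corkscrew and (C2) Harnack chains, with constant `M`. -/
structure IsOneSidedNTA {n : ℕ} (M : ℝ) (Ω : Set (EuclideanSpace ℝ (Fin n))) : Prop where
  isOpen : IsOpen Ω
  M_gt_one : 1 < M
  corkscrew : ∀ Q ∈ frontier Ω, ∀ r : ℝ, 0 < r → r < Metric.diam Ω / 10 →
    ∃ A ∈ Ω ∩ ball Q r, r / M ≤ infDist A (frontier Ω)
  harnack : ∀ r ε : ℝ, ∀ k : ℕ, 0 < r → r < Metric.diam Ω / 10 → 0 < ε → 1 ≤ k →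
    ∀ x ∈ Ω, ∀ y ∈ Ω, dist x y = r → ε ≤ infDist x (frontier Ω) →
      ε ≤ infDist y (frontier Ω) → r ≤ 2 ^ k * ε →
      ∃ (c : ℕ → EuclideanSpace ℝ (Fin n)) (ρ : ℕ → ℝ),
        c 1 = x ∧ c ⌈M * (k : ℝ)⌉₊ = y ∧
        ∀ i : ℕ, 1 ≤ i → i ≤ ⌈M * (k : ℝ)⌉₊ →
          0 < ρ i ∧ ρ i ≤ infDist (c i) (frontier Ω) / 10 ∧ ball (c i) (ρ i) ⊆ Ω ∧
          (i < ⌈M * (k : ℝ)⌉₊ → c (i + 1) ∈ ball (c i) (ρ i))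

/-- A bounded one-sided NTA pair of mixed dimension, with geometric constants `M, Cσ, d, cd`. -/
structure IsMixedPair {n : ℕ} (M Cσ d cd : ℝ) (Ω : Set (EuclideanSpace ℝ (Fin n)))
    (σ : Measure (EuclideanSpace ℝ (Fin n))) : Prop where
  nta : IsOneSidedNTA M Ω
  bounded : Bornology.IsBounded Ω
  nonempty : Ω.Nonempty
  supp_pos : ∀ Q ∈ frontier Ω, ∀ r : ℝ, 0 < r → 0 < σ (ball Q r)
  null_outside : σ (frontier Ω)ᶜ = 0
  finite : σ (frontier Ω) ≠ ⊤
  Cσ_pos : 0 < Cσ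
  doubling : ∀ Q ∈ frontier Ω, ∀ r : ℝ, 0 < r → r < Metric.diam Ω →
    (σ (ball Q (2 * r))).toReal ≤ Cσ * (σ (ball Q r)).toReal
  d_gt : (n : ℝ) - 2 < d
  cd_pos : 0 < cd
  lower_dim : ∀ Q ∈ frontier Ω, ∀ r s : ℝ, 0 < s → s < r → r < Metric.diam Ω →
    cd * (r / s) ^ d * (σ (ball Q s)).toReal ≤ (σ (ball Q r)).toReal

/-- A Robin Green function for the Laplacian on `(Ω, σ)` with parameter `a`. -/
structure IsRobinGreen {n : ℕ} (Ω : Set (EuclideanSpace ℝ (Fin n)))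
    (σ : Measure (EuclideanSpace ℝ (Fin n))) (a : ℝ)
    (G : EuclideanSpace ℝ (Fin n) → EuclideanSpace ℝ (Fin n) → ℝ) : Prop where
  symm : ∀ X ∈ Ω, ∀ Y ∈ Ω, X ≠ Y → G X Y = G Y X
  nonneg : ∀ Y ∈ Ω, ∀ X ∈ closure Ω \ {Y}, 0 ≤ G X Y
  contOn : ∀ Y ∈ Ω, ContinuousOn (fun X => G X Y) (closure Ω \ {Y})
  harmonic : ∀ Y ∈ Ω, IsHarmonicOn (fun X => G X Y) (Ω \ {Y})
  grad_L2 : ∀ Y ∈ Ω, ∀ r : ℝ, 0 < r →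
    IntegrableOn (fun X => ‖gradient (fun Z => G Z Y) X‖ ^ 2) (Ω \ ball Y r) volume
  grad_L1 : ∀ Y ∈ Ω, IntegrableOn (fun X => ‖gradient (fun Z => G Z Y) X‖) Ω volume
  weak : ∀ Y ∈ Ω, ∀ φ : EuclideanSpace ℝ (Fin n) → ℝ,
    ContDiff ℝ (⊤ : ℕ∞) φ → HasCompactSupport φ →
    (∫ X in Ω, ⟪gradient (fun Z => G Z Y) X, gradient φ X⟫) +
      a * ∫ P in frontier Ω, G P Y * φ P ∂σ = φ Y

/-- A Dirichlet Green function for the Laplacian on `Ω`. -/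
structure IsDirichletGreen {n : ℕ} (Ω : Set (EuclideanSpace ℝ (Fin n)))
    (G : EuclideanSpace ℝ (Fin n) → EuclideanSpace ℝ (Fin n) → ℝ) : Prop where
  nonneg : ∀ Y ∈ Ω, ∀ X ∈ closure Ω \ {Y}, 0 ≤ G X Y
  contOn : ∀ Y ∈ Ω, ContinuousOn (fun X => G X Y) (closure Ω \ {Y})
  boundary_zero : ∀ Y ∈ Ω, ∀ Q ∈ frontier Ω, G Q Y = 0
  harmonic : ∀ Y ∈ Ω, IsHarmonicOn (fun X => G X Y) (Ω \ {Y})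
  grad_L2 : ∀ Y ∈ Ω, ∀ r : ℝ, 0 < r →
    IntegrableOn (fun X => ‖gradient (fun Z => G Z Y) X‖ ^ 2) (Ω \ ball Y r) volume
  grad_L1 : ∀ Y ∈ Ω, IntegrableOn (fun X => ‖gradient (fun Z => G Z Y) X‖) Ω volume
  weak : ∀ Y ∈ Ω, ∀ φ : EuclideanSpace ℝ (Fin n) → ℝ,
    ContDiff ℝ (⊤ : ℕ∞) φ → HasCompactSupport φ → tsupport φ ⊆ Ω →
    (∫ X in Ω, ⟪gradient (fun Z => G Z Y) X, gradient φ X⟫) = φ Y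

/-- A solution with pole at `Y` and vanishing Robin condition (parameter `a`). -/
structure IsRobinPoleSolution {n : ℕ} (Ω : Set (EuclideanSpace ℝ (Fin n)))
    (σ : Measure (EuclideanSpace ℝ (Fin n))) (a : ℝ) (Y : EuclideanSpace ℝ (Fin n))
    (u : EuclideanSpace ℝ (Fin n) → ℝ) : Prop where
  contOn : ContinuousOn u (closure Ω \ {Y})
  harmonic : IsHarmonicOn u (Ω \ {Y})
  grad_L2 : ∀ r : ℝ, 0 < r → IntegrableOn (fun X => ‖gradient u X‖ ^ 2) (Ω \ ball Y r) volume
  weak : ∀ φ : EuclideanSpace ℝ (Fin n) → ℝ,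
    ContDiff ℝ (⊤ : ℕ∞) φ → HasCompactSupport φ → Y ∉ tsupport φ →
    (∫ X in Ω, ⟪gradient u X, gradient φ X⟫) + a * ∫ P in frontier Ω, u P * φ P ∂σ = 0

/-- A nonnegative weak solution of the homogeneous Robin problem in `B(Q, ρ)` (parameter `a`). -/
structure IsRobinLocalSolution {n : ℕ} (Ω : Set (EuclideanSpace ℝ (Fin n)))
    (σ : Measure (EuclideanSpace ℝ (Fin n))) (a : ℝ) (Q : EuclideanSpace ℝ (Fin n)) (ρ : ℝ)
    (u : EuclideanSpace ℝ (Fin n) → ℝ) : Prop where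
  nonneg : ∀ X ∈ closure Ω ∩ ball Q ρ, 0 ≤ u X
  contOn : ContinuousOn u (closure Ω ∩ ball Q ρ)
  harmonic : IsHarmonicOn u (Ω ∩ ball Q ρ)
  grad_L2 : ∀ ρ' : ℝ, ρ' < ρ →
    IntegrableOn (fun X => ‖gradient u X‖ ^ 2) (Ω ∩ ball Q ρ') volume
  weak : ∀ φ : EuclideanSpace ℝ (Fin n) → ℝ,
    ContDiff ℝ (⊤ : ℕ∞) φ → HasCompactSupport φ → tsupport φ ⊆ ball Q ρ →
    (∫ X in Ω, ⟪gradient u X, gradient φ X⟫) + a * ∫ P in frontier Ω, u P * φ P ∂σ = 0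

/-- A flux solution: `u = 1` on `cl B(0,1)`, harmonic outside, homogeneous Robin condition. -/
structure IsFluxSolution {n : ℕ} (Ω : Set (EuclideanSpace ℝ (Fin n)))
    (σ : Measure (EuclideanSpace ℝ (Fin n))) (a : ℝ)
    (u : EuclideanSpace ℝ (Fin n) → ℝ) : Prop where
  contOn : ContinuousOn u (closure Ω)
  one_on_ball : ∀ X ∈ closedBall (0 : EuclideanSpace ℝ (Fin n)) 1, u X = 1
  harmonic : IsHarmonicOn u (Ω \ closedBall (0 : EuclideanSpace ℝ (Fin n)) 1)
  grad_L2 : IntegrableOn (fun X => ‖gradient u X‖ ^ 2)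
    (Ω \ closedBall (0 : EuclideanSpace ℝ (Fin n)) 1) volume
  weak : ∀ φ : EuclideanSpace ℝ (Fin n) → ℝ,
    ContDiff ℝ (⊤ : ℕ∞) φ → HasCompactSupport φ →
    tsupport φ ⊆ (closedBall (0 : EuclideanSpace ℝ (Fin n)) 1)ᶜ →
    (∫ X in Ω, ⟪gradient u X, gradient φ X⟫) + a * ∫ P in frontier Ω, u P * φ P ∂σ = 0

/-- A Dirichlet harmonic measure for `Ω`: a family of probability measures on `∂Ω` solving the
Dirichlet problem for continuous boundary data. -/
structure IsDirichletHM {n : ℕ} (Ω : Set (EuclideanSpace ℝ (Fin n)))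
    (ω : EuclideanSpace ℝ (Fin n) → Measure (EuclideanSpace ℝ (Fin n))) : Prop where
  prob : ∀ X ∈ Ω, IsProbabilityMeasure (ω X)
  supported : ∀ X ∈ Ω, (ω X) (frontier Ω)ᶜ = 0
  solves : ∀ f : EuclideanSpace ℝ (Fin n) → ℝ, ContinuousOn f (frontier Ω) →
    ∃ h : EuclideanSpace ℝ (Fin n) → ℝ,
      ContinuousOn h (closure Ω) ∧ IsHarmonicOn h Ω ∧
      (∀ X ∈ Ω, h X = ∫ y, f y ∂(ω X)) ∧ (∀ Q ∈ frontier Ω, h Q = f Q)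

end


open MeasureTheory Metric Set
open scoped RealInnerProductSpace ENNReal NNReal Topology

abbrev Eu (n : ℕ) := EuclideanSpace ℝ (Fin n)

noncomputable section

/-- unnormalised kernel -/
def kern0 (n : ℕ) (y : Eu n) : ℝ := expNegInvGlue (1 - ‖y‖ ^ 2)

lemma kern0_contDiff (n : ℕ) : ContDiff ℝ (⊤ : ℕ∞) (kern0 n) := by
  unfold kern0
  exact expNegInvGlue.contDiff.comp (contDiff_const.sub (contDiff_norm_sq ℝ))

lemma kern0_continuous (n : ℕ) : Continuous (kern0 n) := (kern0_contDiff n).continuous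

lemma kern0_nonneg (n : ℕ) (y : Eu n) : 0 ≤ kern0 n y := expNegInvGlue.nonneg _

lemma kern0_pos (n : ℕ) (y : Eu n) (h : ‖y‖ < 1) : 0 < kern0 n y := by
  apply expNegInvGlue.pos_of_pos
  have := norm_nonneg y
  nlinarith

lemma kern0_zero (n : ℕ) (y : Eu n) (h : 1 ≤ ‖y‖) : kern0 n y = 0 := by
  apply expNegInvGlue.zero_of_nonpos
  nlinarith

lemma kern0_compact (n : ℕ) : HasCompactSupport (kern0 n) := by
  apply HasCompactSupport.intro (isCompact_closedBall (0 : Eu n) 1)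
  intro x hx
  apply kern0_zero
  simp at hx
  exact hx.le

lemma kern0_integrable (n : ℕ) : Integrable (kern0 n) volume :=
  (kern0_continuous n).integrable_of_hasCompactSupport (kern0_compact n)

lemma kern0_int_pos (n : ℕ) : 0 < ∫ y, kern0 n y := by
  rw [integral_pos_iff_support_of_nonneg (kern0_nonneg n) (kern0_integrable n)]
  have : ball (0 : Eu n) 1 ⊆ Function.support (kern0 n) := by
    intro y hy
    exact (kern0_pos n y (by simpa using hy)).ne'
  exact lt_of_lt_of_le (measure_ball_pos volume _ one_pos) (measure_mono this)

def kern (n : ℕ) (y : Eu n) : ℝ := kern0 n y / ∫ z, kern0 n z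

lemma kern_contDiff (n : ℕ) : ContDiff ℝ (⊤ : ℕ∞) (kern n) := (kern0_contDiff n).div_const _
lemma kern_continuous (n : ℕ) : Continuous (kern n) := (kern_contDiff n).continuous
lemma kern_nonneg (n : ℕ) (y : Eu n) : 0 ≤ kern n y :=
  div_nonneg (kern0_nonneg n y) (kern0_int_pos n).le
lemma kern_pos (n : ℕ) (y : Eu n) (h : ‖y‖ < 1) : 0 < kern n y :=
  div_pos (kern0_pos n y h) (kern0_int_pos n)
lemma kern_zero (n : ℕ) (y : Eu n) (h : 1 ≤ ‖y‖) : kern n y = 0 := by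
  simp [kern, kern0_zero n y h]
lemma kern_compact (n : ℕ) : HasCompactSupport (kern n) := by
  apply HasCompactSupport.intro (isCompact_closedBall (0 : Eu n) 1)
  intro x hx
  apply kern_zero
  simp at hx
  exact hx.le
lemma kern_integrable (n : ℕ) : Integrable (kern n) volume :=
  (kern_continuous n).integrable_of_hasCompactSupport (kern_compact n)
lemma kern_int (n : ℕ) : ∫ y, kern n y = 1 := by
  unfold kern
  rw [integral_div]
  exact div_self (kern0_int_pos n).ne'

lemma kern_bdd (n : ℕ) : ∃ C : ℝ, 0 < C ∧ ∀ y, kern n y ≤ C := by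
  obtain ⟨C, hC⟩ := (kern_compact n).exists_bound_of_continuous (kern_continuous n)
  refine ⟨max C 1, by positivity, fun y => ?_⟩
  exact (le_abs_self _).trans ((hC y).trans (le_max_left _ _))

lemma kern_lower (n : ℕ) (q : ℝ) (hq : q < 1) : ∃ c : ℝ, 0 < c ∧ ∀ y, ‖y‖ ≤ q → c ≤ kern n y := by
  refine ⟨expNegInvGlue (1 - (max q 0)^2) / ∫ z, kern0 n z, ?_, ?_⟩
  · apply div_pos _ (kern0_int_pos n)
    apply expNegInvGlue.pos_of_pos
    have h1 : max q 0 < 1 := max_lt hq one_pos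
    have h0 : 0 ≤ max q 0 := le_max_right _ _
    nlinarith
  · intro y hy
    unfold kern kern0
    apply div_le_div_of_nonneg_right _ (kern0_int_pos n).le
    apply expNegInvGlue.monotone
    have : ‖y‖ ≤ max q 0 := hy.trans (le_max_left _ _)
    have := norm_nonneg y
    nlinarith

/-- potential of the kernel -/
def kpot (q : ℝ) : ℝ := ∫ t in (0 : ℝ)..q, expNegInvGlue t

lemma kpot_hasDeriv (q : ℝ) : HasDerivAt kpot (expNegInvGlue q) q := by
  have hc : Continuous expNegInvGlue := (expNegInvGlue.contDiff (n := 0)).continuous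
  exact intervalIntegral.integral_hasDerivAt_right (hc.intervalIntegrable _ _)
    (hc.stronglyMeasurableAtFilter _ _) hc.continuousAt

lemma kpot_zero (q : ℝ) (h : q ≤ 0) : kpot q = 0 := by
  unfold kpot
  rw [intervalIntegral.integral_congr (g := fun _ => (0 : ℝ))]
  · simp
  · intro t ht
    rw [uIcc_of_ge h] at ht
    exact expNegInvGlue.zero_of_nonpos ht.2

lemma kpot_nonneg (q : ℝ) : 0 ≤ kpot q := by
  rcases le_total q 0 with h | h
  · rw [kpot_zero q h]
  · exact intervalIntegral.integral_nonneg h (fun t _ => expNegInvGlue.nonneg t)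

/-- the averaging operator -/
def avg {n : ℕ} (f : Eu n → ℝ) (A : Eu n) (t : ℝ) : ℝ := ∫ y, kern n y * f (A + t • y)

/-- globalisation -/
lemma exists_global {n : ℕ} {W : Eu n → ℝ} {x : Eu n} {ρ s : ℝ} (hs : 0 < s) (hsρ : s < ρ)
    {m : ℕ∞} (hW : ∀ y ∈ ball x ρ, ContDiffAt ℝ m W y) :
    ∃ W' : Eu n → ℝ, ContDiff ℝ m W' ∧ ∀ y ∈ ball x s, W' y = W y := by
  let χ : ContDiffBump x := ⟨s, (s + ρ) / 2, hs, by linarith⟩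
  refine ⟨fun y => χ y * W y, ?_, ?_⟩
  · rw [contDiff_iff_contDiffAt]
    intro y
    by_cases hy : y ∈ ball x ρ
    · exact (χ.contDiff.contDiffAt).mul (hW y hy)
    · have : (fun y => χ y * W y) =ᶠ[𝓝 y] fun _ => 0 := by
        have ho : IsOpen (closedBall x ((s + ρ)/2))ᶜ := isClosed_closedBall.isOpen_compl
        have hm : y ∈ (closedBall x ((s + ρ)/2))ᶜ := by
          simp at hy ⊢; linarith
        filter_upwards [ho.mem_nhds hm] with z hz
        have : χ z = 0 := χ.zero_of_le_dist (by simp at hz; exact hz.le)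
        simp [this]
      exact contDiffAt_const.congr_of_eventuallyEq this
  · intro y hy
    have : χ y = 1 := χ.one_of_mem_closedBall (ball_subset_closedBall hy)
    simp [this]

/-- Laplacian -/
def lap {n : ℕ} (u : Eu n → ℝ) (x : Eu n) : ℝ :=
  ∑ i : Fin n, iteratedFDeriv ℝ 2 u x ![EuclideanSpace.single i (1 : ℝ),
      EuclideanSpace.single i (1 : ℝ)]

lemma lap_eq {n : ℕ} (u : Eu n → ℝ) (x : Eu n) : lap u x =
    ∑ i : Fin n, fderiv ℝ (fderiv ℝ u) x (EuclideanSpace.single i (1 : ℝ))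
      (EuclideanSpace.single i (1 : ℝ)) := by
  unfold lap
  simp [iteratedFDeriv_two_apply]

lemma lap_congr {n : ℕ} {u v : Eu n → ℝ} {x : Eu n} (h : u =ᶠ[𝓝 x] v) : lap u x = lap v x := by
  unfold lap
  rw [h.iteratedFDeriv ℝ 2 |>.eq_of_nhds]

lemma avg_congr {n : ℕ} {f g : Eu n → ℝ} {A : Eu n} {t : ℝ}
    (h : ∀ y ∈ ball (0 : Eu n) 1, f (A + t • y) = g (A + t • y)) : avg f A t = avg g A t := by
  unfold avg
  congr 1
  ext y
  by_cases hy : ‖y‖ < 1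
  · rw [h y (by simpa using hy)]
  · simp [kern_zero n y (not_lt.1 hy)]

lemma mem_ball_smul {n : ℕ} {A y : Eu n} {t ρ : ℝ} (ht : 0 ≤ t) (htρ : t < ρ) (hy : ‖y‖ ≤ 1) :
    A + t • y ∈ ball A ρ := by
  simp only [mem_ball, dist_eq_norm, add_sub_cancel_left, norm_smul, Real.norm_eq_abs,
    abs_of_nonneg ht]
  nlinarith [norm_nonneg y]

lemma kpot_fderiv {n : ℕ} (y v : Eu n) :
    HasFDerivAt (fun y : Eu n => kpot (1 - ‖y‖ ^ 2))
      ((-2 * kern0 n y) • (innerSL ℝ y)) y := by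
  have h1 : HasFDerivAt (fun y : Eu n => 1 - ‖y‖ ^ 2) (-(2 • (innerSL ℝ y))) y :=
    ((hasStrictFDerivAt_norm_sq y).hasFDerivAt).const_sub 1
  have h2 := (kpot_hasDeriv (1 - ‖y‖ ^ 2)).comp_hasFDerivAt y h1
  refine h2.congr_fderiv ?_
  ext v
  simp [kern0]
  ring

lemma avg_deriv {n : ℕ} {W : Eu n → ℝ} (hW : ContDiff ℝ 2 W) (x : Eu n) (s : ℝ) :
    HasDerivAt (fun s => ∫ y, kern0 n y * W (x + s • y))
      (s / 2 * ∫ y, kpot (1 - ‖y‖^2) * lap W (x + s • y)) s := by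
  have hdW : Continuous (fderiv ℝ W) := hW.continuous_fderiv (by norm_num)
  have hd2 : ContDiff ℝ 1 (fderiv ℝ W) := hW.fderiv_right (by norm_num)
  have hddW : Continuous (fderiv ℝ (fderiv ℝ W)) := hd2.continuous_fderiv (by norm_num)
  have hkc : Continuous (fun y : Eu n => kpot (1 - ‖y‖^2)) := by
    have : Continuous kpot := continuous_iff_continuousAt.2 fun q => (kpot_hasDeriv q).continuousAt
    exact this.comp (by fun_prop)
  have hksupp : HasCompactSupport (fun y : Eu n => kpot (1 - ‖y‖^2)) := by
    apply HasCompactSupport.intro (isCompact_closedBall (0 : Eu n) 1)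
    intro x hx
    apply kpot_zero
    simp at hx
    nlinarith
  -- bound on derivative
  have hcomp : IsCompact ((fun p : ℝ × Eu n => x + p.1 • p.2) '' (Icc (s-1) (s+1) ×ˢ closedBall 0 1)) :=
    (isCompact_Icc.prod (isCompact_closedBall _ _)).image (by fun_prop)
  obtain ⟨Cb, hCb⟩ := hcomp.exists_bound_of_continuousOn hdW.continuousOn
  have key := (hasDerivAt_integral_of_dominated_loc_of_deriv_le (μ := volume)
    (F := fun s (y : Eu n) => kern0 n y * W (x + s • y))
    (F' := fun s (y : Eu n) => kern0 n y * fderiv ℝ W (x + s • y) y)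
    (x₀ := s) (s := Icc (s-1) (s+1)) (bound := fun y => kern0 n y * Cb)
    (Icc_mem_nhds (by linarith) (by linarith))
    (Filter.Eventually.of_forall fun t => (by
      have := hW.continuous; have := kern0_continuous n
      exact Continuous.aestronglyMeasurable (by fun_prop)))
    (Continuous.integrable_of_hasCompactSupport (by
      have := hW.continuous; have := kern0_continuous n
      fun_prop) (kern0_compact n).mul_right)
    (by
      have := kern0_continuous n
      exact Continuous.aestronglyMeasurable (by fun_prop))
    (Filter.Eventually.of_forall fun y t ht => by
      rw [norm_mul, Real.norm_of_nonneg (kern0_nonneg n y)]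
      by_cases hy : ‖y‖ ≤ 1
      · apply mul_le_mul_of_nonneg_left _ (kern0_nonneg n y)
        calc _ ≤ ‖fderiv ℝ W (x + t • y)‖ * ‖y‖ := ContinuousLinearMap.le_opNorm _ _
          _ ≤ ‖fderiv ℝ W (x + t • y)‖ * 1 := by gcongr
          _ ≤ Cb := by
            rw [mul_one]
            exact hCb _ ⟨(t, y), ⟨ht, by simpa using hy⟩, rfl⟩
      · rw [kern0_zero n y (not_le.1 hy).le]; simp)
    ((kern0_integrable n).mul_const _)
    (Filter.Eventually.of_forall fun y t ht => by
      apply HasDerivAt.const_mul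
      have h1 : HasDerivAt (fun t : ℝ => x + t • y) y t := by
        simpa using ((hasDerivAt_id t).smul_const y).const_add x
      exact ((hW.differentiable (by norm_num)) _).hasFDerivAt.comp_hasDerivAt t h1)).2
  refine key.congr_deriv ?_
  symm
  -- integration by parts
  have hparts : ∀ i : Fin n,
      ∫ y, fderiv ℝ W (x + s • y) (EuclideanSpace.single i 1) *
        fderiv ℝ (fun y : Eu n => kpot (1 - ‖y‖^2)) y (EuclideanSpace.single i 1)
      = - ∫ y, (s * fderiv ℝ (fderiv ℝ W) (x + s • y) (EuclideanSpace.single i 1)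
          (EuclideanSpace.single i 1)) * kpot (1 - ‖y‖^2) := by
    intro i
    have hfd : ∀ y : Eu n, HasFDerivAt (fun y => fderiv ℝ W (x + s • y) (EuclideanSpace.single i (1:ℝ)))
        (((fderiv ℝ (fderiv ℝ W) (x + s • y)).comp (s • ContinuousLinearMap.id ℝ (Eu n))).flip
          (EuclideanSpace.single i 1)) y := by
      intro y
      have h1 : HasFDerivAt (fun y : Eu n => x + s • y) (s • ContinuousLinearMap.id ℝ (Eu n)) y :=
        ((hasFDerivAt_id y).const_smul s).const_add x
      have h2 := ((hd2.differentiable (by norm_num)) (x + s • y)).hasFDerivAt.comp y h1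
      have h3 := h2.clm_apply (hasFDerivAt_const (EuclideanSpace.single i (1:ℝ)) y)
      refine h3.congr_fderiv ?_
      ext v; simp
    have hfe : ∀ y : Eu n, fderiv ℝ (fun y => fderiv ℝ W (x + s • y) (EuclideanSpace.single i (1:ℝ))) y
        (EuclideanSpace.single i 1) = s * fderiv ℝ (fderiv ℝ W) (x + s • y) (EuclideanSpace.single i 1)
          (EuclideanSpace.single i 1) := by
      intro y; rw [(hfd y).fderiv]; simp
    have := integral_mul_fderiv_eq_neg_fderiv_mul_of_integrable (μ := (volume : Measure (Eu n)))
      (f := fun y => fderiv ℝ W (x + s • y) (EuclideanSpace.single i 1))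
      (g := fun y : Eu n => kpot (1 - ‖y‖^2)) (v := EuclideanSpace.single i 1)
      ?_ ?_ ?_ (fun y _ => (hfd y).differentiableAt) (fun y _ => (kpot_fderiv y 0).differentiableAt)
    · rw [this]; simp_rw [hfe]
    · simp_rw [hfe]
      exact Continuous.integrable_of_hasCompactSupport (by fun_prop) hksupp.mul_left
    · simp_rw [(kpot_fderiv _ 0).fderiv]
      refine Continuous.integrable_of_hasCompactSupport (by have := kern0_continuous n; fun_prop) ?_
      apply HasCompactSupport.intro (isCompact_closedBall (0 : Eu n) 1)
      intro y hy
      rw [kern0_zero n y (by simp at hy; exact hy.le)]; simp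
    · exact Continuous.integrable_of_hasCompactSupport (by fun_prop) hksupp.mul_left
  have hsum : ∀ y : Eu n, kern0 n y * fderiv ℝ W (x + s • y) y =
      ∑ i : Fin n, (-1/2) * (fderiv ℝ W (x + s • y) (EuclideanSpace.single i 1) *
        fderiv ℝ (fun y : Eu n => kpot (1 - ‖y‖^2)) y (EuclideanSpace.single i 1)) := by
    intro y
    have hy : y = ∑ i : Fin n, y i • EuclideanSpace.single i (1:ℝ) := by
      ext j
      simp [Finset.sum_apply, Pi.single_apply]
    have : fderiv ℝ W (x + s • y) y = ∑ i : Fin n, y i * fderiv ℝ W (x + s • y) (EuclideanSpace.single i 1) := by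
      conv_lhs => rw [hy]
      simp only [map_sum, map_smul, smul_eq_mul]
      rw [← hy]
    rw [this, Finset.mul_sum]
    apply Finset.sum_congr rfl
    intro i _
    rw [(kpot_fderiv y 0).fderiv]
    simp [EuclideanSpace.inner_single_right]
    ring
  have hint : ∀ i : Fin n, Integrable (fun y : Eu n => (-1/2) * (fderiv ℝ W (x + s • y) (EuclideanSpace.single i 1) *
        fderiv ℝ (fun y : Eu n => kpot (1 - ‖y‖^2)) y (EuclideanSpace.single i 1))) := by
    intro i
    apply Integrable.const_mul
    simp_rw [(kpot_fderiv _ 0).fderiv]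
    refine Continuous.integrable_of_hasCompactSupport (by have := kern0_continuous n; fun_prop) ?_
    apply HasCompactSupport.intro (isCompact_closedBall (0 : Eu n) 1)
    intro y hy
    rw [kern0_zero n y (by simp at hy; exact hy.le)]; simp
  rw [show (∫ y, kern0 n y * fderiv ℝ W (x + s • y) y) = _ from integral_congr_ae (Filter.Eventually.of_forall hsum)]
  rw [integral_finset_sum _ (fun i _ => hint i)]
  simp_rw [integral_const_mul, hparts, lap_eq, Finset.mul_sum]
  rw [integral_finset_sum]
  · rw [Finset.mul_sum]
    apply Finset.sum_congr rfl
    intro i _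
    rw [← integral_neg, ← integral_const_mul, ← integral_const_mul]
    congr 1; ext y; ring
  · intro i _
    exact Continuous.integrable_of_hasCompactSupport (by fun_prop) hksupp.mul_right

lemma submvp {n : ℕ} {W : Eu n → ℝ} {x : Eu n} {ρ t : ℝ} (ht : 0 ≤ t) (htρ : t < ρ)
    (hW : ∀ y ∈ ball x ρ, ContDiffAt ℝ 2 W y) (hl : ∀ y ∈ ball x ρ, 0 ≤ lap W y) :
    W x ≤ avg W x t := by
  obtain ⟨W', hW', he⟩ := exists_global (x := x) (ρ := ρ) (s := (t + ρ) / 2) (m := 2)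
    (by linarith) (by linarith) hW
  have hmono : MonotoneOn (fun s => ∫ y, kern0 n y * W' (x + s • y)) (Icc 0 t) := by
    apply monotoneOn_of_deriv_nonneg (convex_Icc _ _)
    · exact fun s _ => (avg_deriv hW' x s).continuousAt.continuousWithinAt
    · exact fun s _ => (avg_deriv hW' x s).differentiableAt.differentiableWithinAt
    · intro s hs
      rw [interior_Icc] at hs
      rw [(avg_deriv hW' x s).deriv]
      apply mul_nonneg (by linarith [hs.1])
      apply integral_nonneg
      intro y
      by_cases hy : ‖y‖ ≤ 1
      · apply mul_nonneg (kpot_nonneg _)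
        have hm : x + s • y ∈ ball x ((t+ρ)/2) := mem_ball_smul hs.1.le (by linarith [hs.2]) hy
        rw [lap_congr (v := W)]
        · exact hl _ (ball_subset_ball (by linarith) hm)
        · filter_upwards [isOpen_ball.mem_nhds hm] with z hz using he z hz
      · simp only [Pi.zero_apply]
        rw [kpot_zero]
        · simp
        · nlinarith
  have h := hmono (left_mem_Icc.2 ht) (right_mem_Icc.2 ht) ht
  simp only [zero_smul, add_zero] at h
  rw [integral_mul_const] at h
  have h2 : avg W x t = avg W' x t := by
    apply avg_congr
    intro y hy
    rw [he]
    exact mem_ball_smul ht (by linarith) (by simp at hy; exact hy.le)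
  rw [h2, ← he x (mem_ball_self (by linarith))]
  unfold avg kern
  have h3 : ∀ y, kern0 n y / (∫ z, kern0 n z) * W' (x + t • y) =
    (kern0 n y * W' (x + t • y)) / (∫ z, kern0 n z) := fun y => by ring
  simp_rw [h3]
  rw [integral_div, le_div_iff₀ (kern0_int_pos n)]
  linarith

lemma lap_neg {n : ℕ} (W : Eu n → ℝ) (x : Eu n) : lap (fun y => - W y) x = - lap W x := by
  unfold lap
  have : (fun y => - W y) = -W := rfl
  rw [this]
  simp [iteratedFDeriv_neg_apply]

lemma mvp {n : ℕ} {u : Eu n → ℝ} {x : Eu n} {ρ t : ℝ} (ht : 0 ≤ t) (htρ : t < ρ)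
    (hu : IsHarmonicOn u (ball x ρ)) : avg u x t = u x := by
  have h1 := submvp ht htρ (fun y hy => (hu y hy).1) (fun y hy => (hu y hy).2.ge)
  have h2 := submvp (W := fun y => - u y) ht htρ (fun y hy => (hu y hy).1.neg)
    (fun y hy => by rw [lap_neg]; have := (hu y hy).2; unfold lap; rw [this]; simp)
  have : avg (fun y => - u y) x t = - avg u x t := by
    unfold avg
    rw [← integral_neg]
    simp
  rw [this] at h2
  linarith

end

open MeasureTheory Metric Set
open scoped RealInnerProductSpace ENNReal NNReal Topology

noncomputable section

lemma avg_eq {n : ℕ} (f : Eu n → ℝ) (A : Eu n) {t : ℝ} (ht : 0 < t) :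
    avg f A t = (t ^ n)⁻¹ * ∫ Y, kern n (t⁻¹ • (Y - A)) * f Y := by
  unfold avg
  have h1 : ∀ y : Eu n, kern n y * f (A + t • y) =
      (fun Z => kern n (t⁻¹ • Z) * f (A + Z)) (t • y) := by
    intro y; simp only; rw [smul_smul, inv_mul_cancel₀ ht.ne', one_smul]
  rw [integral_congr_ae (Filter.Eventually.of_forall h1)]
  rw [Measure.integral_comp_smul_of_nonneg volume (fun Z : Eu n => kern n (t⁻¹ • Z) * f (A + Z)) t (hR := ht.le)]
  simp only [finrank_euclideanSpace, Fintype.card_fin, smul_eq_mul]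
  congr 1
  rw [← integral_sub_right_eq_self _ A]
  simp

lemma lint_scale {n : ℕ} (h : Eu n → ℝ≥0∞) (A : Eu n) {t : ℝ} (ht : 0 < t) :
    ∫⁻ y, h (A + t • y) = ENNReal.ofReal ((t ^ n)⁻¹) * ∫⁻ y, h y := by
  have e1 : MeasurableEmbedding (fun y : Eu n => t • y) :=
    (Homeomorph.smul (Units.mk0 t ht.ne')).measurableEmbedding
  have h2 := e1.lintegral_map (μ := volume) (fun z => h (A + z))
  rw [Measure.map_addHaar_smul volume ht.ne'] at h2
  simp only [finrank_euclideanSpace, Fintype.card_fin, lintegral_smul_measure, smul_eq_mul] at h2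
  rw [← h2, abs_of_pos (by positivity)]
  rw [lintegral_add_left_eq_self]

lemma avg_integrable {n : ℕ} {f : Eu n → ℝ} {A : Eu n} {t ρ : ℝ} (ht : 0 ≤ t) (htρ : t < ρ)
    (hf : ContinuousOn f (ball A ρ)) : Integrable (fun y => kern n y * f (A + t • y)) := by
  have hsupp : Function.support (fun y => kern n y * f (A + t • y)) ⊆ closedBall 0 1 := by
    intro y hy
    by_contra hc
    apply hy
    simp only [mem_closedBall, dist_zero_right, not_le] at hc
    simp [kern_zero n y hc.le]
  rw [← integrableOn_iff_integrable_of_support_subset hsupp]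
  apply ContinuousOn.integrableOn_compact (isCompact_closedBall _ _)
  apply (kern_continuous n).continuousOn.mul
  apply hf.comp (by fun_prop)
  intro y hy
  exact mem_ball_smul ht htρ (by simpa using hy)

lemma avg_integrable' {n : ℕ} {f : Eu n → ℝ} {A : Eu n} {t ρ : ℝ} (ht : 0 < t) (htρ : t < ρ)
    (hf : ContinuousOn f (ball A ρ)) : Integrable (fun Y => kern n (t⁻¹ • (Y - A)) * f Y) := by
  have h := avg_integrable ht.le htρ hf
  have h2 := h.comp_smul (R := t⁻¹) (by positivity)
  have h3 := h2.comp_sub_right A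
  refine h3.congr (Filter.Eventually.of_forall fun Y => ?_)
  simp [smul_smul, mul_inv_cancel₀ ht.ne']

lemma IsHarmonicOn.continuousOn {n : ℕ} {u : Eu n → ℝ} {S : Set (Eu n)} (hu : IsHarmonicOn u S) :
    ContinuousOn u S := fun x hx => (hu x hx).1.continuousAt.continuousWithinAt

lemma IsHarmonicOn.mono {n : ℕ} {u : Eu n → ℝ} {S T : Set (Eu n)} (hu : IsHarmonicOn u S)
    (h : T ⊆ S) : IsHarmonicOn u T := fun x hx => hu x (h hx)

lemma harnack1 (n : ℕ) : ∃ C : ℝ, 1 ≤ C ∧ ∀ (u : Eu n → ℝ) (x x' : Eu n) (ρ : ℝ), 0 < ρ →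
    IsHarmonicOn u (ball x ρ) → (∀ y ∈ ball x ρ, 0 ≤ u y) → dist x' x ≤ ρ / 10 → u x' ≤ C * u x := by
  obtain ⟨K, hK, hKb⟩ := kern_bdd n
  obtain ⟨c, hc, hcb⟩ := kern_lower n (7/10) (by norm_num)
  refine ⟨max 1 (2 ^ n * (K / c)), le_max_left _ _, fun u x x' ρ hρ hu hpos hd => ?_⟩
  have hsub : ball x' (ρ/2) ⊆ ball x ρ := by
    intro y hy
    simp only [mem_ball] at *
    linarith [dist_triangle y x' x]
  have h1 : avg u x' (ρ/4) = u x' := mvp (ρ := ρ/2) (by positivity) (by linarith) (hu.mono hsub)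
  have h2 : avg u x (ρ/2) = u x := mvp (ρ := ρ) (by positivity) (by linarith) hu
  have hux : 0 ≤ u x := hpos x (mem_ball_self hρ)
  rw [avg_eq _ _ (by positivity)] at h1 h2
  have key : ∫ Y, kern n ((ρ/4)⁻¹ • (Y - x')) * u Y ≤
      ∫ Y, (K / c) * (kern n ((ρ/2)⁻¹ • (Y - x)) * u Y) := by
    apply integral_mono (avg_integrable' (ρ := ρ/2) (by positivity) (by linarith)
      (hu.mono hsub).continuousOn)
      ((avg_integrable' (ρ := ρ) (by positivity) (by linarith) hu.continuousOn).const_mul _)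
    intro Y
    simp only
    by_cases hY : dist Y x' < ρ / 4
    · have hYx : dist Y x ≤ 35/100 * ρ := by linarith [dist_triangle Y x' x]
      have huY : 0 ≤ u Y := hpos Y (by simp only [mem_ball]; linarith)
      have hk : c ≤ kern n ((ρ/2)⁻¹ • (Y - x)) := by
        apply hcb
        rw [norm_smul, ← dist_eq_norm, norm_inv, Real.norm_of_nonneg (by positivity),
          inv_mul_le_iff₀ (by positivity)]
        linarith
      calc _ ≤ K * u Y := by gcongr; exact hKb _
        _ = (K / c) * (c * u Y) := by field_simp
        _ ≤ _ := by gcongr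
    · have h0 : kern n ((ρ/4)⁻¹ • (Y - x')) = 0 := by
        apply kern_zero
        rw [norm_smul, ← dist_eq_norm, norm_inv, Real.norm_of_nonneg (by positivity),
          le_inv_mul_iff₀ (by positivity)]
        linarith
      rw [h0, zero_mul]
      by_cases hY2 : Y ∈ ball x ρ
      · have := hpos Y hY2
        have := kern_nonneg n ((ρ/2)⁻¹ • (Y - x))
        positivity
      · have h0 : kern n ((ρ/2)⁻¹ • (Y - x)) = 0 := by
          apply kern_zero
          rw [norm_smul, ← dist_eq_norm, norm_inv, Real.norm_of_nonneg (by positivity),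
            le_inv_mul_iff₀ (by positivity)]
          simp only [mem_ball, not_lt] at hY2
          linarith
        rw [h0]; simp
  rw [integral_const_mul] at key
  have h3 : ∫ Y, kern n ((ρ/2)⁻¹ • (Y - x)) * u Y = (ρ/2)^n * u x := by
    rw [← h2, ← mul_assoc, mul_inv_cancel₀ (by positivity), one_mul]
  rw [h3] at key
  calc u x' ≤ ((ρ/4)^n)⁻¹ * (K / c * ((ρ/2)^n * u x)) := by
        rw [← h1]; gcongr
    _ = 2 ^ n * (K / c) * u x := by
        have : (ρ/2)^n = 2^n * (ρ/4)^n := by rw [← mul_pow]; congr 1; ring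
        rw [this]; field_simp
    _ ≤ _ := by gcongr; exact le_max_right _ _

/-- segment estimate for averages -/
lemma seg (n : ℕ) : ∃ C : ℝ, 0 < C ∧ ∀ (f : Eu n → ℝ) (A A' c : Eu n) (t t' ρ m : ℝ),
    0 < m → m ≤ t → m ≤ t' → closedBall A t ⊆ ball c ρ → closedBall A' t' ⊆ ball c ρ →
    (∀ y ∈ ball c ρ, ContDiffAt ℝ 1 f y) →
    ENNReal.ofReal |avg f A' t' - avg f A t| ≤
      ENNReal.ofReal (C * (dist A' A + |t' - t|) / m ^ n) * ∫⁻ y in ball c ρ, ‖fderiv ℝ f y‖ₑ := by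
  obtain ⟨K, hK, hKb⟩ := kern_bdd n
  refine ⟨K, hK, fun f A A' c t t' ρ m hm hmt hmt' hA hA' hf => ?_⟩
  -- path
  let p : ℝ → Eu n → Eu n := fun θ y => (A + θ • (A' - A)) + (t + θ * (t' - t)) • y
  let v : Eu n → Eu n := fun y => (A' - A) + (t' - t) • y
  have hpmem : ∀ θ ∈ Icc (0:ℝ) 1, ∀ y, ‖y‖ ≤ 1 → p θ y ∈ ball c ρ := by
    intro θ hθ y hy
    have e : p θ y = (1 - θ) • (A + t • y) + θ • (A' + t' • y) := by
      simp only [p]; module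
    rw [e]
    apply (convex_ball c ρ) (hA _) (hA' _) (by linarith [hθ.2]) hθ.1 (by ring)
    · simp only [mem_closedBall, dist_eq_norm, add_sub_cancel_left, norm_smul, Real.norm_eq_abs]
      rw [abs_of_pos (by linarith)]; nlinarith
    · simp only [mem_closedBall, dist_eq_norm, add_sub_cancel_left, norm_smul, Real.norm_eq_abs]
      rw [abs_of_pos (by linarith)]; nlinarith
  have hpder : ∀ y θ, HasDerivAt (fun θ => p θ y) (v y) θ := by
    intro y θ
    have h1 : HasDerivAt (fun θ : ℝ => A + θ • (A' - A)) (A' - A) θ := by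
      simpa using ((hasDerivAt_id θ).smul_const (A' - A)).const_add A
    have h2 : HasDerivAt (fun θ : ℝ => (t + θ * (t' - t)) • y) ((t' - t) • y) θ := by
      simpa using (((hasDerivAt_id θ).mul_const (t' - t)).const_add t).smul_const y
    exact h1.add h2
  have hfc : ContinuousOn (fderiv ℝ f) (ball c ρ) := by
    intro y hy
    have : ContDiffAt ℝ 0 (fderiv ℝ f) y := (hf y hy).fderiv_right (by norm_num)
    exact this.continuousAt.continuousWithinAt
  have hfcont : ContinuousOn f (ball c ρ) := fun y hy => (hf y hy).continuousAt.continuousWithinAt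
  -- bound on f difference
  have hmain : ∀ y, ‖y‖ ≤ 1 → ‖f (A' + t' • y) - f (A + t • y)‖ₑ ≤
      ENNReal.ofReal (dist A' A + |t' - t|) * ∫⁻ θ in Icc (0:ℝ) 1, ‖fderiv ℝ f (p θ y)‖ₑ := by
    intro y hy
    have hcont : ContinuousOn (fun θ => fderiv ℝ f (p θ y) (v y)) (uIcc (0:ℝ) 1) := by
      rw [uIcc_of_le zero_le_one]
      apply ContinuousOn.clm_apply _ continuousOn_const
      apply hfc.comp
      · exact fun θ _ => (hpder y θ).continuousAt.continuousWithinAt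
      · exact fun θ hθ => hpmem θ hθ y hy
    have hft := intervalIntegral.integral_eq_sub_of_hasDerivAt (a := 0) (b := 1)
      (f := fun θ => f (p θ y)) (f' := fun θ => fderiv ℝ f (p θ y) (v y)) (by
        intro θ hθ
        rw [uIcc_of_le zero_le_one] at hθ
        exact ((hf _ (hpmem θ hθ y hy)).differentiableAt (by norm_num)).hasFDerivAt.comp_hasDerivAt θ
          (hpder y θ)) hcont.intervalIntegrable
    have e1 : p 1 y = A' + t' • y := by simp only [p]; module
    have e0 : p 0 y = A + t • y := by simp only [p]; module
    rw [e1, e0] at hft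
    rw [← hft, intervalIntegral.integral_of_le zero_le_one, ← integral_Icc_eq_integral_Ioc]
    refine (enorm_integral_le_lintegral_enorm _).trans ?_
    rw [← lintegral_const_mul' _ _ ENNReal.ofReal_ne_top]
    apply lintegral_mono
    intro θ
    simp only
    have hv : ‖v y‖ ≤ dist A' A + |t' - t| := by
      simp only [v]
      refine (norm_add_le _ _).trans ?_
      rw [norm_smul, dist_eq_norm, Real.norm_eq_abs]
      gcongr
      nlinarith [abs_nonneg (t' - t)]
    rw [← ofReal_norm, ← ofReal_norm, ← ENNReal.ofReal_mul (by positivity)]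
    apply ENNReal.ofReal_le_ofReal
    refine (ContinuousLinearMap.le_opNorm _ _).trans ?_
    rw [mul_comm]; gcongr
  have hmt0 : 0 < t := by linarith
  have hmt0' : 0 < t' := by linarith
  have hint : ∀ (B : Eu n) (τ : ℝ), 0 < τ → closedBall B τ ⊆ ball c ρ →
      Integrable (fun y => kern n y * f (B + τ • y)) := by
    intro B τ hτ hB
    have hsupp : Function.support (fun y => kern n y * f (B + τ • y)) ⊆ closedBall 0 1 := by
      intro y hy
      by_contra hc
      apply hy
      simp only [mem_closedBall, dist_zero_right, not_le] at hc
      simp [kern_zero n y hc.le]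
    rw [← integrableOn_iff_integrable_of_support_subset hsupp]
    apply ContinuousOn.integrableOn_compact (isCompact_closedBall _ _)
    apply (kern_continuous n).continuousOn.mul
    apply hfcont.comp (by fun_prop)
    intro y hy
    apply hB
    simp only [mem_closedBall, dist_eq_norm, add_sub_cancel_left, norm_smul, Real.norm_eq_abs,
      sub_zero] at hy ⊢
    rw [abs_of_pos hτ]; nlinarith
  have hdiff : avg f A' t' - avg f A t = ∫ y, kern n y * (f (A' + t' • y) - f (A + t • y)) := by
    unfold avg
    rw [← integral_sub (hint A' t' hmt0' hA') (hint A t hmt0 hA)]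
    congr 1; ext y; ring
  set D : ℝ := dist A' A + |t' - t| with hD
  have hD0 : 0 ≤ D := by positivity
  set G : Eu n → ℝ≥0∞ := (ball c ρ).indicator (fun y => ‖fderiv ℝ f y‖ₑ) with hG
  have hGm : Measurable G := by
    have : Measurable fun y => ‖fderiv ℝ f y‖ₑ := (measurable_fderiv ℝ f).enorm
    exact this.indicator measurableSet_ball
  rw [← Real.norm_eq_abs, ofReal_norm, hdiff]
  calc ‖∫ y, kern n y * (f (A' + t' • y) - f (A + t • y))‖ₑ
      ≤ ∫⁻ y, ‖kern n y * (f (A' + t' • y) - f (A + t • y))‖ₑ := enorm_integral_le_lintegral_enorm _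
    _ ≤ ∫⁻ y, ENNReal.ofReal (K * D) * ∫⁻ θ in Icc (0:ℝ) 1, G (p θ y) := by
        apply lintegral_mono
        intro y
        simp only
        by_cases hy : ‖y‖ ≤ 1
        · rw [enorm_mul, ENNReal.ofReal_mul hK.le, mul_assoc]
          gcongr
          · rw [← ofReal_norm, Real.norm_of_nonneg (kern_nonneg n y)]
            exact ENNReal.ofReal_le_ofReal (hKb y)
          · refine (hmain y hy).trans ?_
            refine mul_le_mul_right ?_ _
            apply lintegral_mono_ae
            filter_upwards [ae_restrict_mem measurableSet_Icc] with θ hθ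
            rw [hG, indicator_of_mem (hpmem θ hθ y hy)]
        · rw [kern_zero n y (not_le.1 hy).le]; simp
    _ = ENNReal.ofReal (K * D) * ∫⁻ θ in Icc (0:ℝ) 1, ∫⁻ y, G (p θ y) := by
        rw [lintegral_const_mul' _ _ ENNReal.ofReal_ne_top, lintegral_lintegral_swap]
        apply Measurable.aemeasurable
        apply hGm.comp
        simp only [p, Function.uncurry]
        fun_prop
    _ ≤ ENNReal.ofReal (K * D) * ∫⁻ θ in Icc (0:ℝ) 1, ENNReal.ofReal ((m^n)⁻¹) * ∫⁻ y, G y := by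
        gcongr 1
        apply lintegral_mono_ae
        filter_upwards [ae_restrict_mem measurableSet_Icc] with θ hθ
        have hmθ : m ≤ t + θ * (t' - t) := by nlinarith [hθ.1, hθ.2]
        simp only [p]
        rw [lint_scale G _ (by linarith)]
        gcongr
    _ = _ := by
        rw [lintegral_const, hG, lintegral_indicator measurableSet_ball]
        simp only [MeasurableSet.univ, Measure.restrict_apply, univ_inter, Real.volume_Icc, sub_zero,
          ENNReal.ofReal_one, mul_one]
        rw [← mul_assoc, ← ENNReal.ofReal_mul (by positivity)]
        rfl

end

open MeasureTheory Metric Set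
open scoped RealInnerProductSpace ENNReal NNReal Topology

noncomputable section

/-- distance to the boundary -/
abbrev dl {n : ℕ} (Ω : Set (Eu n)) (X : Eu n) : ℝ := infDist X (frontier Ω)

lemma dl_lip {n : ℕ} (Ω : Set (Eu n)) (X Y : Eu n) : dl Ω X ≤ dl Ω Y + dist X Y :=
  infDist_le_infDist_add_dist

lemma ballSub {n : ℕ} {Ω : Set (Eu n)} (ho : IsOpen Ω) {X : Eu n} (hX : X ∈ Ω) :
    ball X (dl Ω X) ⊆ Ω := by
  rcases le_or_gt (dl Ω X) 0 with h0 | h0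
  · rw [ball_eq_empty.2 h0]; exact empty_subset _
  apply (convex_ball X (dl Ω X)).isPreconnected.subset_left_of_subset_union (v := (closure Ω)ᶜ)
    ho isClosed_closure.isOpen_compl
  · exact disjoint_left.2 fun x hx hx' => hx' (subset_closure hx)
  · intro y hy
    by_contra hc
    simp only [mem_union, mem_compl_iff, not_or, not_not] at hc
    have : y ∈ frontier Ω := ⟨hc.2, by rw [ho.interior_eq]; exact hc.1⟩
    have h1 := infDist_le_dist_of_mem (x := X) this
    rw [mem_ball, dist_comm] at hy
    linarith
  · exact ⟨X, mem_ball_self h0, hX⟩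

lemma ball_dl {n : ℕ} {Ω : Set (Eu n)} {X Y : Eu n} {t : ℝ} (h : Y ∈ ball X t) :
    dl Ω X - t ≤ dl Ω Y := by
  have := dl_lip Ω X Y
  rw [mem_ball, dist_comm] at h
  linarith

lemma mem_of_dl_pos {n : ℕ} {Ω : Set (Eu n)} (ho : IsOpen Ω) {X : Eu n} (hX : X ∈ closure Ω)
    (h : 0 < dl Ω X) : X ∈ Ω := by
  by_contra hc
  have : X ∈ frontier Ω := ⟨hX, by rw [ho.interior_eq]; exact hc⟩
  have := infDist_zero_of_mem this
  simp only [dl] at h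
  linarith

lemma dl_pos {n : ℕ} {Ω : Set (Eu n)} (ho : IsOpen Ω) (hF : (frontier Ω).Nonempty) {X : Eu n}
    (hX : X ∈ Ω) : 0 < dl Ω X := by
  apply (isClosed_frontier.notMem_iff_infDist_pos hF).1
  intro h
  exact h.2 (by rwa [ho.interior_eq])

lemma cork {n : ℕ} {Ω : Set (Eu n)} {M : ℝ} (hΩ : IsOneSidedNTA M Ω) (hF : (frontier Ω).Nonempty)
    {X : Eu n} (hX : X ∈ closure Ω) {τ : ℝ} (hτ : 0 < τ) (hd : M * τ < Metric.diam Ω / 10) :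
    ∃ A ∈ Ω, τ ≤ dl Ω A ∧ dist A X ≤ 2 * M * τ := by
  have hM := hΩ.M_gt_one
  rcases le_or_gt τ (dl Ω X) with h | h
  · exact ⟨X, mem_of_dl_pos hΩ.isOpen hX (by linarith), h, by rw [dist_self]; positivity⟩
  · obtain ⟨P, hP, hPd⟩ := isClosed_frontier.exists_infDist_eq_dist hF X
    obtain ⟨A, hA, hA'⟩ := hΩ.corkscrew P hP (M * τ) (by positivity) hd
    refine ⟨A, hA.1, ?_, ?_⟩
    · rw [mul_div_cancel_left₀ _ (by positivity)] at hA'; exact hA'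
    · have := hA.2
      rw [mem_ball] at this
      have h2 := dist_triangle A P X
      rw [dist_comm P X] at h2
      simp only [dl] at h
      nlinarith

lemma chain (n : ℕ) (M K1 : ℝ) (hM : 1 < M) (hK1 : 1 ≤ K1) :
    ∃ (N : ℕ) (K κ : ℝ), 1 ≤ K ∧ 0 < κ ∧ κ ≤ 1 ∧ ∀ (Ω : Set (Eu n)), IsOneSidedNTA M Ω →
    ∀ A ∈ Ω, ∀ A' ∈ Ω, ∀ τ : ℝ, 0 < τ → τ ≤ dl Ω A → τ ≤ dl Ω A' → dist A A' ≤ K1 * τ →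
    K1 * τ < Metric.diam Ω / 10 → ∃ (c : ℕ → Eu n) (ρ : ℕ → ℝ), c 0 = A ∧ c N = A' ∧
      (∀ i ≤ N, κ * τ ≤ ρ i ∧ ρ i ≤ K * τ ∧ ball (c i) (ρ i) ⊆ Ω ∩ ball A (K * τ)) ∧
      ∀ i < N, dist (c (i+1)) (c i) ≤ ρ i / 10 := by
  obtain ⟨k, hk⟩ := pow_unbounded_of_one_lt K1 (one_lt_two (α := ℝ))
  have hk1 : 1 ≤ k := by
    rcases Nat.eq_zero_or_pos k with h | h
    · subst h; simp at hk; linarith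
    · exact h
  set N : ℕ := ⌈M * (k : ℝ)⌉₊ with hN
  have hN1 : 1 ≤ N := by
    apply Nat.ceil_pos.2
    have : (1:ℝ) ≤ k := by exact_mod_cast hk1
    positivity
  have h2N : (1:ℝ) ≤ 2 ^ N := one_le_pow₀ (by norm_num)
  refine ⟨N, 40 * 2 ^ N * K1, (9/10)^N, by nlinarith, by positivity,
    pow_le_one₀ (by norm_num) (by norm_num), ?_⟩
  intro Ω hΩ A hA A' hA' τ hτ hδ hδ' hd hdiam
  have h9 : ((9:ℝ)/10)^N ≤ 1 := pow_le_one₀ (by norm_num) (by norm_num)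
  have hKτ : K1 * τ ≤ 2 ^ N * K1 * τ := by
    nlinarith [mul_pos (by linarith : (0:ℝ) < K1) hτ]
  have hKτ1 : τ ≤ K1 * τ := by nlinarith
  by_cases hcase : 20 * K1 * τ < dl Ω A
  · refine ⟨fun i => if i = 0 then A else A', fun i => if i = 0 then 10 * K1 * τ else τ, by simp,
      by simp; omega, ?_, ?_⟩
    · intro i _
      by_cases hi : i = 0
      · simp only [hi, if_true]
        refine ⟨by nlinarith, by nlinarith, subset_inter ?_ (ball_subset_ball (by nlinarith))⟩
        exact (ball_subset_ball (by linarith)).trans (ballSub hΩ.isOpen hA)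
      · simp only [hi, if_false]
        refine ⟨by nlinarith, by nlinarith, subset_inter ?_ ?_⟩
        · exact (ball_subset_ball hδ').trans (ballSub hΩ.isOpen hA')
        · apply ball_subset_ball'
          rw [dist_comm]; linarith
    · intro i _
      by_cases hi : i = 0
      · simp only [hi, if_true]
        simp only [Nat.zero_add, one_ne_zero, if_false]
        rw [dist_comm]; linarith
      · simp [hi]; positivity
  push Not at hcase
  by_cases hAA : A = A'
  · refine ⟨fun _ => A, fun _ => τ, rfl, hAA, ?_, ?_⟩
    · intro i _
      refine ⟨by nlinarith, by nlinarith, subset_inter ?_ (ball_subset_ball (by nlinarith))⟩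
      exact (ball_subset_ball hδ).trans (ballSub hΩ.isOpen hA)
    · intro i _; simp; positivity
  obtain ⟨c, ρ, hc1, hcN, hc⟩ := hΩ.harnack (dist A A') τ k (dist_pos.2 hAA) (by linarith) hτ hk1
    A hA A' hA' rfl hδ hδ' (hd.trans (by gcongr))
  rw [← hN] at hcN hc
  -- induction facts
  have hmem : ∀ i, 1 ≤ i → i ≤ N → c i ∈ Ω := fun i h1 h2 =>
    (hc i h1 h2).2.2.1 (mem_ball_self (hc i h1 h2).1)
  have hind : ∀ i, i + 1 ≤ N → (9/10)^i * τ ≤ dl Ω (c (i+1)) ∧ dl Ω (c (i+1)) ≤ 2^i * (20 * K1 * τ) ∧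
      dist (c (i+1)) A ≤ 2 ^ i * (20 * K1 * τ) := by
    intro i
    induction i with
    | zero => intro _; simp only [Nat.zero_add, hc1]; refine ⟨by simpa using hδ, by simpa using hcase, by simp; positivity⟩
    | succ i ih =>
      intro hi
      obtain ⟨h1, h2, h3⟩ := ih (by omega)
      obtain ⟨g1, g2, g3, g4⟩ := hc (i+1) (by omega) (by omega)
      have g5 := g4 (by omega)
      rw [mem_ball] at g5
      have l1 := dl_lip Ω (c (i+1)) (c (i+1+1))
      have l2 := dl_lip Ω (c (i+1+1)) (c (i+1))
      rw [dist_comm] at l1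
      have l3 := dist_triangle (c (i+1+1)) (c (i+1)) A
      rw [pow_succ, pow_succ]
      simp only [dl] at *
      refine ⟨by linarith, by linarith, by linarith⟩
  refine ⟨fun i => c (min (i+1) N), fun i => dl Ω (c (min (i+1) N)), ?_, ?_, ?_, ?_⟩
  · simp only [Nat.zero_add, min_eq_left hN1, hc1]
  · simp only [min_eq_right (Nat.le_succ N), hcN]
  · intro i _
    obtain ⟨j, hj, hjN⟩ : ∃ j, min (i+1) N = j + 1 ∧ j + 1 ≤ N := ⟨min (i+1) N - 1, by omega, by omega⟩
    simp only [hj]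
    obtain ⟨h1, h2, h3⟩ := hind j hjN
    have hp : (2:ℝ)^j ≤ 2^N := pow_le_pow_right₀ (by norm_num) (by omega)
    have hp9 : ((9:ℝ)/10)^N ≤ (9/10)^j := pow_le_pow_of_le_one (by norm_num) (by norm_num) (by omega)
    have hq : (2:ℝ)^j * (20 * K1 * τ) ≤ 2^N * (20 * K1 * τ) := by gcongr
    refine ⟨?_, by linarith, subset_inter (ballSub hΩ.isOpen (hmem _ (by omega) hjN)) ?_⟩
    · exact le_trans (by gcongr) h1
    · apply ball_subset_ball'; linarith
  · intro i hi
    by_cases h : i + 1 + 1 ≤ N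
    · simp only [min_eq_left h, min_eq_left (show i + 1 ≤ N by omega)]
      obtain ⟨g1, g2, g3, g4⟩ := hc (i+1) (by omega) (by omega)
      have g5 := g4 (by omega)
      rw [mem_ball] at g5
      simp only [dl]; linarith
    · have e : i + 1 = N := by omega
      simp only [e, min_self, min_eq_right (Nat.le_succ N), dist_self]
      have : 0 ≤ dl Ω (c N) := infDist_nonneg
      positivity

lemma link_harnack (n : ℕ) (M K1 : ℝ) (hM : 1 < M) (hK1 : 1 ≤ K1) :
    ∃ (N K : ℝ), 1 ≤ N ∧ 1 ≤ K ∧ ∀ (Ω : Set (Eu n)), IsOneSidedNTA M Ω →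
    ∀ A ∈ Ω, ∀ A' ∈ Ω, ∀ τ : ℝ, 0 < τ → τ ≤ dl Ω A → τ ≤ dl Ω A' → dist A A' ≤ K1 * τ →
    K1 * τ < Metric.diam Ω / 10 → ∀ u : Eu n → ℝ, IsHarmonicOn u (Ω ∩ ball A (K * τ)) →
    (∀ y ∈ Ω ∩ ball A (K * τ), 0 ≤ u y) → u A' ≤ N * u A := by
  obtain ⟨N, K, κ, hK, hκ, hκ1, H⟩ := chain n M K1 hM hK1
  obtain ⟨C, hC, HC⟩ := harnack1 n
  refine ⟨C ^ N, K, one_le_pow₀ hC, hK, ?_⟩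
  intro Ω hΩ A hA A' hA' τ hτ hδ hδ' hd hdiam u hu hpos
  obtain ⟨c, ρ, h0, hN, h1, h2⟩ := H Ω hΩ A hA A' hA' τ hτ hδ hδ' hd hdiam
  have : ∀ i ≤ N, u (c i) ≤ C ^ i * u A := by
    intro i
    induction i with
    | zero => intro _; simp [h0]
    | succ i ih =>
      intro hi
      obtain ⟨a1, a2, a3⟩ := h1 i (by omega)
      have hρ : 0 < ρ i := lt_of_lt_of_le (by positivity) a1
      have := HC u (c i) (c (i+1)) (ρ i) hρ (hu.mono a3) (fun y hy => hpos y (a3 hy)) (h2 i (by omega))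
      calc _ ≤ C * u (c i) := this
        _ ≤ C * (C ^ i * u A) := by
          apply mul_le_mul_of_nonneg_left (ih (by omega)) (by linarith)
        _ = _ := by ring
  have := this N le_rfl
  rwa [hN] at this

lemma climb (n : ℕ) (M : ℝ) (hM : 1 < M) :
    ∃ (N K : ℝ), 1 ≤ N ∧ 1 ≤ K ∧ ∀ (Ω : Set (Eu n)), IsOneSidedNTA M Ω → (frontier Ω).Nonempty →
    ∀ (j : ℕ) (X : Eu n), X ∈ Ω → ∀ τ : ℝ, 0 < τ → (1/2)^j * τ ≤ dl Ω X → 3 * M * τ < Metric.diam Ω / 10 →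
    ∃ A ∈ Ω, τ ≤ dl Ω A ∧ dist A X ≤ 2 * M * τ ∧ ∀ u : Eu n → ℝ, IsHarmonicOn u (Ω ∩ ball X (K * τ)) →
      (∀ y ∈ Ω ∩ ball X (K * τ), 0 ≤ u y) → u A ≤ N ^ j * u X ∧ u X ≤ N ^ j * u A := by
  obtain ⟨N, K, hN, hK, H⟩ := link_harnack n M (6 * M) hM (by linarith)
  refine ⟨N, K + 2 * M, hN, by linarith, ?_⟩
  intro Ω hΩ hF j
  induction j with
  | zero =>
    intro X hX τ hτ hδ hd
    exact ⟨X, hX, by simpa using hδ, by rw [dist_self]; positivity, fun u _ _ => by simp⟩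
  | succ j ih =>
    intro X hX τ hτ hδ hd
    have hMτ : 0 < M * τ := by positivity
    have hKτ : 0 < K * τ := by positivity
    obtain ⟨A1, hA1, a1, a2, a3⟩ := ih X hX (τ/2) (by positivity) (by rw [pow_succ] at hδ; linarith)
      (by linarith)
    obtain ⟨A, hA, b1, b2⟩ := cork hΩ hF (subset_closure hX) hτ (by linarith)
    have hdA : dist A1 A ≤ 6 * M * (τ/2) := by
      have := dist_triangle A1 X A
      rw [dist_comm X A] at this
      linarith
    refine ⟨A, hA, b1, b2, fun u hu hpos => ?_⟩
    have s1 : Ω ∩ ball A1 (K * (τ/2)) ⊆ Ω ∩ ball X ((K + 2 * M) * τ) := by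
      apply inter_subset_inter_right
      apply ball_subset_ball'; linarith
    have s2 : Ω ∩ ball A (K * (τ/2)) ⊆ Ω ∩ ball X ((K + 2 * M) * τ) := by
      apply inter_subset_inter_right
      apply ball_subset_ball'; linarith
    have s3 : Ω ∩ ball X ((K + 2 * M) * (τ/2)) ⊆ Ω ∩ ball X ((K + 2 * M) * τ) := by
      apply inter_subset_inter_right
      apply ball_subset_ball; linarith
    have c1 := H Ω hΩ A1 hA1 A hA (τ/2) (by positivity) a1 (by linarith) hdA (by linarith) u
      (hu.mono s1) (fun y hy => hpos y (s1 hy))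
    have c2 := H Ω hΩ A hA A1 hA1 (τ/2) (by positivity) (by linarith) a1 (by rwa [dist_comm])
      (by linarith) u (hu.mono s2) (fun y hy => hpos y (s2 hy))
    obtain ⟨c3, c4⟩ := a3 u (hu.mono s3) (fun y hy => hpos y (s3 hy))
    have hN0 : 0 ≤ N := by linarith
    constructor
    · calc _ ≤ N * u A1 := c1
        _ ≤ N * (N ^ j * u X) := by gcongr
        _ = _ := by ring
    · calc _ ≤ N ^ j * u A1 := c4
        _ ≤ N ^ j * (N * u A) := by gcongr
        _ = _ := by ring

lemma ladder (n : ℕ) (M : ℝ) (hM : 1 < M) :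
    ∃ (C K : ℝ) (γ : ℕ), 1 ≤ C ∧ 1 ≤ K ∧ 1 ≤ γ ∧ ∀ (Ω : Set (Eu n)), IsOneSidedNTA M Ω →
    (frontier Ω).Nonempty → ∀ X ∈ Ω, ∀ ξ ∈ Ω, ∀ L s : ℝ, 0 < s → s ≤ L → s ≤ dl Ω X → s ≤ dl Ω ξ →
    dist X ξ ≤ L → K * L < Metric.diam Ω → ∀ u : Eu n → ℝ, IsHarmonicOn u (Ω ∩ ball ξ (K * L)) →
      (∀ y ∈ Ω ∩ ball ξ (K * L), 0 ≤ u y) → u X ≤ C * (L / s) ^ γ * u ξ := by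
  obtain ⟨N, K, hN, hK, H⟩ := climb n M hM
  obtain ⟨N', K', hN', hK', H'⟩ := link_harnack n M (6 * M) hM (by linarith)
  obtain ⟨p, hp⟩ := pow_unbounded_of_one_lt N (one_lt_two (α := ℝ))
  refine ⟨N' * 2 ^ (2 * p), 100 * M * (K + K'), 2 * p + 1, ?_, by nlinarith, by omega, ?_⟩
  · have : (1:ℝ) ≤ 2 ^ (2 * p) := one_le_pow₀ (by norm_num)
    nlinarith
  intro Ω hΩ hF X hX ξ hξ L s hs hsL hδX hδξ hd hdiam u hu hpos
  have hL : 0 < L := by linarith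
  have hdiam' : 6 * M * L < Metric.diam Ω / 10 := by nlinarith [mul_pos (by linarith : 0 < M) hL]
  obtain ⟨j, hj1, hj2⟩ := exists_nat_pow_near (x := L / s) (y := 2) (by rwa [one_le_div hs]) one_lt_two
  have hML : L ≤ M * L := le_mul_of_one_le_left hL.le hM.le
  have hKL : L ≤ K * L := le_mul_of_one_le_left hL.le hK
  have hKL' : L ≤ K' * L := le_mul_of_one_le_left hL.le hK'
  have hMK : K * L ≤ M * (K * L) := le_mul_of_one_le_left (by linarith) hM.le
  have hMK' : K' * L ≤ M * (K' * L) := le_mul_of_one_le_left (by linarith) hM.le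
  have hMK2 : M * L ≤ M * (K * L) := by gcongr
  have hsj : (1/2)^(j+1) * L ≤ s := by
    rw [div_lt_iff₀ hs] at hj2
    rw [one_div, inv_pow, inv_mul_le_iff₀ (by positivity)]
    linarith
  obtain ⟨A, hA, a1, a2, a3⟩ := H Ω hΩ hF (j+1) X hX L hL (hsj.trans hδX) (by linarith)
  obtain ⟨B, hB, b1, b2, b3⟩ := H Ω hΩ hF (j+1) ξ hξ L hL (hsj.trans hδξ) (by linarith)
  have s1 : Ω ∩ ball X (K * L) ⊆ Ω ∩ ball ξ (100 * M * (K + K') * L) := by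
    apply inter_subset_inter_right
    apply ball_subset_ball'; linarith
  have s2 : Ω ∩ ball ξ (K * L) ⊆ Ω ∩ ball ξ (100 * M * (K + K') * L) := by
    apply inter_subset_inter_right
    apply ball_subset_ball; linarith
  have s3 : Ω ∩ ball B (K' * L) ⊆ Ω ∩ ball ξ (100 * M * (K + K') * L) := by
    apply inter_subset_inter_right
    apply ball_subset_ball'; linarith
  have hBA : dist B A ≤ 6 * M * L := by
    have h1 := dist_triangle B ξ A
    have h2 := dist_triangle ξ X A
    rw [dist_comm X A, dist_comm ξ X] at h2
    linarith
  have c1 := H' Ω hΩ B hB A hA L hL b1 a1 hBA (by linarith) u (hu.mono s3) (fun y hy => hpos y (s3 hy))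
  have c2 := (a3 u (hu.mono s1) (fun y hy => hpos y (s1 hy))).2
  have c3 := (b3 u (hu.mono s2) (fun y hy => hpos y (s2 hy))).1
  have huξ : 0 ≤ u ξ := hpos ξ ⟨hξ, mem_ball_self (by positivity)⟩
  have hN0 : 0 ≤ N := by linarith
  have hN0' : 0 ≤ N' := by linarith
  calc u X ≤ N ^ (j+1) * (N' * (N ^ (j+1) * u ξ)) := by
        refine c2.trans ?_
        gcongr
        refine c1.trans ?_
        gcongr
    _ = N' * (N ^ (2 * (j+1))) * u ξ := by ring
    _ ≤ N' * ((2^p) ^ (2 * (j+1))) * u ξ := by gcongr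
    _ = N' * 2 ^ (2 * p) * (2 ^ j) ^ (2 * p) * u ξ := by
        congr 1
        rw [mul_assoc, ← pow_mul, ← pow_mul, ← pow_add]; congr 2; ring
    _ ≤ N' * 2 ^ (2 * p) * (L / s) ^ (2 * p) * u ξ := by gcongr
    _ ≤ _ := by
        gcongr
        · rwa [one_le_div hs]
        · omega

end

open MeasureTheory Metric Set
open scoped RealInnerProductSpace ENNReal NNReal Topology

noncomputable section

/-- gradient mass -/
def gm {n : ℕ} (f : Eu n → ℝ) (S : Set (Eu n)) : ℝ≥0∞ := ∫⁻ y in S, ‖fderiv ℝ f y‖ₑ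

lemma gm_mono {n : ℕ} (f : Eu n → ℝ) {S T : Set (Eu n)} (h : S ⊆ T) : gm f S ≤ gm f T :=
  lintegral_mono_set h

lemma ofReal_abs_tri (a b c : ℝ) : ENNReal.ofReal |a - c| ≤ ENNReal.ofReal |a - b| + ENNReal.ofReal |b - c| := by
  rw [← ENNReal.ofReal_add (abs_nonneg _) (abs_nonneg _)]
  exact ENNReal.ofReal_le_ofReal (abs_sub_le _ _ _)

lemma link_grad (n : ℕ) (M K1 : ℝ) (hM : 1 < M) (hK1 : 1 ≤ K1) :
    ∃ (C K κ : ℝ), 0 < C ∧ 1 ≤ K ∧ 0 < κ ∧ κ ≤ 1/2 ∧ ∀ (Ω : Set (Eu n)), IsOneSidedNTA M Ω →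
    ∀ A ∈ Ω, ∀ A' ∈ Ω, ∀ τ : ℝ, 0 < τ → τ ≤ dl Ω A → τ ≤ dl Ω A' → dist A A' ≤ K1 * τ →
    K1 * τ < Metric.diam Ω / 10 → ∀ f : Eu n → ℝ, (∀ y ∈ Ω ∩ ball A (K * τ), ContDiffAt ℝ 1 f y) →
    ENNReal.ofReal |avg f A' (κ * τ) - avg f A (κ * τ)| ≤
      ENNReal.ofReal (C * (τ / τ ^ n)) * gm f (Ω ∩ ball A (K * τ)) := by
  obtain ⟨N, K, κ, hK, hκ, hκ1, H⟩ := chain n M K1 hM hK1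
  obtain ⟨C, hC, HC⟩ := seg n
  refine ⟨(N + 1) * (C * K / (κ/2) ^ n), K, κ/2, by positivity, hK, by positivity, by linarith, ?_⟩
  intro Ω hΩ A hA A' hA' τ hτ hδ hδ' hd hdiam f hf
  obtain ⟨c, ρ, h0, hN, h1, h2⟩ := H Ω hΩ A hA A' hA' τ hτ hδ hδ' hd hdiam
  set B := ENNReal.ofReal (C * K / (κ/2) ^ n * (τ / τ ^ n)) * gm f (Ω ∩ ball A (K * τ)) with hB
  have : ∀ i ≤ N, ENNReal.ofReal |avg f (c i) (κ/2 * τ) - avg f A (κ/2 * τ)| ≤ i * B := by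
    intro i
    induction i with
    | zero => intro _; simp [h0]
    | succ i ih =>
      intro hi
      obtain ⟨a1, a2, a3⟩ := h1 i (by omega)
      have hκτ : 0 < κ * τ := by positivity
      have hd2 := h2 i (by omega)
      have := HC f (c i) (c (i+1)) (c i) (κ/2 * τ) (κ/2 * τ) (ρ i) (κ/2 * τ) (by positivity) le_rfl le_rfl
        (closedBall_subset_ball (by linarith))
        ((closedBall_subset_closedBall' (ε₂ := ρ i * 6 / 10) (by linarith)).trans
          (closedBall_subset_ball (by linarith))) (fun y hy => hf y (a3 hy))
      refine (ofReal_abs_tri _ (avg f (c i) (κ/2 * τ)) _).trans ?_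
      push_cast
      rw [add_mul, one_mul, add_comm]
      refine add_le_add (ih (by omega)) (this.trans ?_)
      rw [hB]
      refine mul_le_mul' (ENNReal.ofReal_le_ofReal ?_) (gm_mono f a3)
      rw [sub_self, abs_zero, add_zero, mul_pow]
      calc C * dist (c (i+1)) (c i) / ((κ/2)^n * τ^n) ≤ C * (K * τ) / ((κ/2)^n * τ^n) := by
            gcongr; linarith [dist_nonneg (x := c (i+1)) (y := c i)]
        _ = _ := by field_simp
  have := this N le_rfl
  rw [hN] at this
  refine this.trans ?_
  rw [hB, ← mul_assoc, ← ENNReal.ofReal_natCast, ← ENNReal.ofReal_mul (by positivity)]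
  refine mul_le_mul' (ENNReal.ofReal_le_ofReal ?_) le_rfl
  have : 0 ≤ C * K / (κ/2) ^ n * (τ / τ ^ n) := by positivity
  linarith

lemma avg_close {n : ℕ} {f : Eu n → ℝ} {A : Eu n} {t ρ v e : ℝ} (ht : 0 ≤ t) (htρ : t < ρ)
    (hf : ContinuousOn f (ball A ρ)) (h : ∀ y ∈ ball A ρ, |f y - v| ≤ e) : |avg f A t - v| ≤ e := by
  have h1 : avg f A t - v = ∫ y, kern n y * (f (A + t • y) - v) := by
    have : ∀ y, kern n y * (f (A + t • y) - v) = kern n y * f (A + t • y) - kern n y * v := fun y => by ring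
    simp_rw [this]
    rw [integral_sub (avg_integrable ht htρ hf) ((kern_integrable n).mul_const v), integral_mul_const,
      kern_int, one_mul]
    rfl
  rw [h1, ← Real.norm_eq_abs]
  calc _ ≤ ∫ y, kern n y * e := by
        apply norm_integral_le_of_norm_le ((kern_integrable n).mul_const e)
        refine Filter.Eventually.of_forall fun y => ?_
        rw [norm_mul, Real.norm_of_nonneg (kern_nonneg n y)]
        by_cases hy : ‖y‖ ≤ 1
        · exact mul_le_mul_of_nonneg_left (h _ (mem_ball_smul ht htρ hy)) (kern_nonneg n y)
        · rw [kern_zero n y (not_le.1 hy).le]; simp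
    _ = e := by rw [integral_mul_const, kern_int, one_mul]

lemma potential (n : ℕ) (M : ℝ) (hM : 1 < M) :
    ∃ (C K κ : ℝ), 0 < C ∧ 1 ≤ K ∧ 0 < κ ∧ κ ≤ 1/2 ∧ ∀ (Ω : Set (Eu n)), IsOneSidedNTA M Ω →
    (frontier Ω).Nonempty → ∀ X ∈ closure Ω, ∀ τ : ℝ, 0 < τ → K * τ < Metric.diam Ω →
    ∀ f : Eu n → ℝ, (∀ y ∈ Ω ∩ ball X (K * τ), ContDiffAt ℝ 1 f y) → ContinuousWithinAt f Ω X →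
    ∃ A ∈ Ω, τ ≤ dl Ω A ∧ dist A X ≤ 2 * M * τ ∧
    ENNReal.ofReal |f X - avg f A (κ * τ)| ≤ ENNReal.ofReal C * ∑' j : ℕ,
      ENNReal.ofReal (τ / 2 ^ j / (τ / 2 ^ j) ^ n) * gm f (Ω ∩ ball X (K * (τ / 2 ^ j))) := by
  obtain ⟨C1, K1, κ, hC1, hK1, hκ, hκ2, H⟩ := link_grad n M (6 * M) hM (by linarith)
  obtain ⟨C2, hC2, HC⟩ := seg n
  set K := K1 + 60 * M with hK
  refine ⟨C1 * 2 ^ n + C2 * 2 ^ n / κ ^ n, K, κ, by positivity, by linarith, hκ, hκ2, ?_⟩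
  intro Ω hΩ hF X hX τ hτ hdiam f hf hfc
  have hMτ : τ ≤ M * τ := by nlinarith
  have hK1τ : 0 < K1 * τ := by positivity
  have hdiam' : 6 * M * τ < diam Ω / 10 := by rw [hK] at hdiam; linarith
  -- scales
  have hτj : ∀ j : ℕ, 0 < τ / 2 ^ j ∧ τ / 2 ^ j ≤ τ := fun j =>
    ⟨by positivity, div_le_self hτ.le (one_le_pow₀ (by norm_num))⟩
  have hcork : ∀ j : ℕ, ∃ A ∈ Ω, τ / 2 ^ j ≤ dl Ω A ∧ dist A X ≤ 2 * M * (τ / 2 ^ j) := by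
    intro j
    apply cork hΩ hF hX (hτj j).1
    have : M * (τ / 2 ^ j) ≤ M * τ := by gcongr; exact (hτj j).2
    linarith
  choose A hA hδ hdist using hcork
  refine ⟨A 0, hA 0, by simpa using hδ 0, by simpa using hdist 0, ?_⟩
  set T : ℕ → ℝ≥0∞ := fun j => ENNReal.ofReal (τ / 2 ^ j / (τ / 2 ^ j) ^ n) *
    gm f (Ω ∩ ball X (K * (τ / 2 ^ j))) with hT
  set a : ℕ → ℝ := fun j => avg f (A j) (κ * (τ / 2 ^ j)) with ha
  have hstep : ∀ j, ENNReal.ofReal |a (j+1) - a j| ≤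
      ENNReal.ofReal (C1 * 2 ^ n + C2 * 2 ^ n / κ ^ n) * T j := by
    intro j
    set s := τ / 2 ^ (j+1) with hs
    have hs2 : τ / 2 ^ j = 2 * s := by rw [hs, pow_succ]; field_simp
    have hs0 : 0 < s := (hτj (j+1)).1
    have hsτ : s ≤ τ := (hτj (j+1)).2
    have hMs : s ≤ M * s := by nlinarith
    have hMsτ : M * s ≤ M * τ := by gcongr
    have hδj := hδ j
    have hδj1 := hδ (j+1)
    have hdj := hdist j
    have hdj1 := hdist (j+1)
    rw [hs2] at hδj hdj
    rw [← hs] at hδj1 hdj1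
    have hsub : Ω ∩ ball (A j) (K1 * s) ⊆ Ω ∩ ball X (K * (τ / 2 ^ j)) := by
      apply inter_subset_inter_right
      apply ball_subset_ball'
      rw [hs2, hK]; nlinarith
    have hsub2 : ball (A j) (2 * s) ⊆ Ω ∩ ball X (K * (τ / 2 ^ j)) := by
      apply subset_inter ((ball_subset_ball hδj).trans (ballSub hΩ.isOpen (hA j)))
      apply ball_subset_ball'
      rw [hs2, hK]; nlinarith
    have hsub3 : Ω ∩ ball X (K * (τ / 2 ^ j)) ⊆ Ω ∩ ball X (K * τ) := by
      apply inter_subset_inter_right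
      apply ball_subset_ball
      have := (hτj j).2
      have : 0 ≤ K := by rw [hK]; linarith
      gcongr
    have l1 := H Ω hΩ (A j) (hA j) (A (j+1)) (hA (j+1)) s hs0 (by linarith) hδj1 (by
      have := dist_triangle (A j) X (A (j+1))
      rw [dist_comm X] at this
      linarith) (by linarith) f (fun y hy => hf y (hsub3 (hsub hy)))
    have l2 := HC f (A j) (A j) (A j) (κ * (2 * s)) (κ * s) (2 * s) (κ * s) (by positivity) (by nlinarith) le_rfl
      (closedBall_subset_ball (by nlinarith)) (closedBall_subset_ball (by nlinarith))
      (fun y hy => hf y (hsub3 (hsub2 hy)))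
    simp only [ha, hT]
    rw [← hs]
    refine (ofReal_abs_tri _ (avg f (A j) (κ * s)) _).trans ?_
    rw [hs2] at *
    refine (add_le_add (l1.trans (mul_le_mul' le_rfl (gm_mono f hsub)))
      (l2.trans (mul_le_mul' le_rfl (gm_mono f hsub2)))).trans ?_
    rw [← add_mul, ← mul_assoc (ENNReal.ofReal _), ← ENNReal.ofReal_add (by positivity) (by positivity),
      ← ENNReal.ofReal_mul (by positivity)]
    refine mul_le_mul' (ENNReal.ofReal_le_ofReal ?_) le_rfl
    have e1 : |κ * s - κ * (2 * s)| = κ * s := by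
      rw [show κ * s - κ * (2 * s) = - (κ * s) by ring, abs_neg, abs_of_pos (by positivity)]
    rw [dist_self, zero_add, e1, add_mul]
    have hsn : 0 < s ^ n := by positivity
    have hκn : 0 < κ ^ n := by positivity
    apply add_le_add
    · rw [mul_pow]
      have : C1 * 2 ^ n * (2 * s / (2 ^ n * s ^ n)) = 2 * (C1 * (s / s ^ n)) := by field_simp
      rw [this]
      have : 0 ≤ C1 * (s / s ^ n) := by positivity
      linarith
    · rw [mul_pow, mul_pow]
      have : C2 * 2 ^ n / κ ^ n * (2 * s / (2 ^ n * s ^ n)) = 2 * (C2 * s / (κ ^ n * s ^ n)) := by field_simp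
      rw [this]
      have e2 : C2 * (κ * s) / (κ ^ n * s ^ n) = κ * (C2 * s / (κ ^ n * s ^ n)) := by ring
      rw [e2]
      have : 0 ≤ C2 * s / (κ ^ n * s ^ n) := by positivity
      nlinarith
  have hsum : ∀ k, ENNReal.ofReal |a k - a 0| ≤
      ENNReal.ofReal (C1 * 2 ^ n + C2 * 2 ^ n / κ ^ n) * ∑ j ∈ Finset.range k, T j := by
    intro k
    induction k with
    | zero => simp
    | succ k ih =>
      rw [Finset.sum_range_succ, mul_add]
      refine (ofReal_abs_tri _ (a k) _).trans ?_
      rw [add_comm (ENNReal.ofReal _)]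
      exact add_le_add ih (hstep k)
  have hlim : Filter.Tendsto a Filter.atTop (𝓝 (f X)) := by
    rw [Metric.tendsto_atTop]
    intro e he
    rw [Metric.continuousWithinAt_iff] at hfc
    obtain ⟨η, hη, hfη⟩ := hfc (e/2) (by positivity)
    have hlim2 : Filter.Tendsto (fun j : ℕ => (3 * M) * (τ / 2 ^ j)) Filter.atTop (𝓝 ((3 * M) * 0)) := by
      apply Filter.Tendsto.const_mul
      apply Filter.Tendsto.div_atTop tendsto_const_nhds
      exact tendsto_pow_atTop_atTop_of_one_lt one_lt_two
    rw [mul_zero] at hlim2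
    obtain ⟨k, hk⟩ := Filter.eventually_atTop.1 ((hlim2.eventually (gt_mem_nhds hη)))
    refine ⟨k, fun j hj => ?_⟩
    have hkj := hk j hj
    set s := τ / 2 ^ j with hs
    have hs0 : 0 < s := (hτj j).1
    have hMs : s ≤ M * s := by nlinarith
    have hMsτ : M * s ≤ M * τ := by gcongr; exact (hτj j).2
    have hsubj : ball (A j) s ⊆ Ω := (ball_subset_ball (hδ j)).trans (ballSub hΩ.isOpen (hA j))
    have hd : dist (A j) X ≤ 2 * M * s := hdist j
    rw [Real.dist_eq]
    refine lt_of_le_of_lt (b := e / 2) ?_ (by linarith)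
    apply avg_close (ρ := s) (by positivity) (by nlinarith)
    · intro y hy
      refine (hf y ⟨hsubj hy, ?_⟩).continuousAt.continuousWithinAt
      rw [mem_ball] at hy ⊢
      have := dist_triangle y (A j) X
      have : 0 ≤ M * τ := by positivity
      rw [hK]; linarith
    · intro y hy
      have hy2 : dist y X < η := by
        rw [mem_ball] at hy
        have := dist_triangle y (A j) X
        linarith
      have := hfη (hsubj hy) hy2
      rw [Real.dist_eq] at this
      exact this.le
  have e0 : avg f (A 0) (κ * τ) = a 0 := by simp [ha]
  rw [e0]
  have hlim3 : Filter.Tendsto (fun k => ENNReal.ofReal |a k - a 0|) Filter.atTop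
      (𝓝 (ENNReal.ofReal |f X - a 0|)) :=
    ENNReal.tendsto_ofReal ((hlim.sub_const _).abs)
  apply le_of_tendsto hlim3
  refine Filter.Eventually.of_forall fun k => (hsum k).trans ?_
  gcongr
  exact ENNReal.sum_le_tsum _

/-- Tonelli for ball averages -/
lemma tonelli_ball {n : ℕ} (μ : Measure (Eu n)) [SFinite μ] (S T Ω : Set (Eu n)) (hS : MeasurableSet S)
    (hΩ : MeasurableSet Ω) (hT : MeasurableSet T)
    (ρ : ℝ) (h : Eu n → ℝ≥0∞) (hh : Measurable h) (V : ℝ≥0∞)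
    (hsub : ∀ y ∈ S, Ω ∩ ball y ρ ⊆ T) (hV : ∀ X ∈ T, μ (ball X ρ ∩ S) ≤ V) :
    ∫⁻ y in S, (∫⁻ X in Ω ∩ ball y ρ, h X) ∂μ ≤ V * ∫⁻ X in T, h X := by
  have h1 : ∀ y ∈ S, (∫⁻ X in Ω ∩ ball y ρ, h X) ≤ ∫⁻ X in T, (ball X ρ).indicator (fun _ => h X) y := by
    intro y hy
    rw [← lintegral_indicator (hΩ.inter measurableSet_ball), ← lintegral_indicator hT]
    apply lintegral_mono
    intro X
    by_cases hX : X ∈ Ω ∩ ball y ρ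
    · rw [indicator_of_mem hX, indicator_of_mem (hsub y hy hX), indicator_of_mem]
      rw [mem_ball, dist_comm]; exact hX.2
    · rw [indicator_of_notMem hX]; exact zero_le
  have hm : Measurable (Function.uncurry fun (y X : Eu n) => (ball X ρ).indicator (fun _ => h X) y) := by
    have : (Function.uncurry fun (y X : Eu n) => (ball X ρ).indicator (fun _ => h X) y) =
        {p : Eu n × Eu n | dist p.1 p.2 < ρ}.indicator (fun p => h p.2) := by
      ext ⟨y, X⟩
      simp [indicator, Function.uncurry]
    rw [this]
    apply (hh.comp measurable_snd).indicator
    exact (isOpen_lt (by fun_prop) continuous_const).measurableSet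
  calc _ ≤ ∫⁻ y in S, ∫⁻ X in T, (ball X ρ).indicator (fun _ => h X) y ∂volume ∂μ :=
        setLIntegral_mono' hS h1
    _ = ∫⁻ X in T, ∫⁻ y in S, (ball X ρ).indicator (fun _ => h X) y ∂μ := by
        rw [lintegral_lintegral_swap]
        exact hm.aemeasurable
    _ ≤ ∫⁻ X in T, V * h X := by
        apply setLIntegral_mono' hT
        intro X hX
        rw [lintegral_indicator measurableSet_ball, lintegral_const, mul_comm,
          Measure.restrict_restrict measurableSet_ball]
        simp only [Measure.restrict_apply_univ]
        gcongr
        exact hV X hX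
    _ = _ := lintegral_const_mul _ hh

end

open MeasureTheory Metric Set
open scoped RealInnerProductSpace ENNReal NNReal Topology

noncomputable section

/-- smooth truncated inverse -/
def io (c q : ℝ) : ℝ := Real.smoothTransition (2 * q / c - 1) / q

lemma io_eq {c q : ℝ} (hc : 0 < c) (hq : c ≤ q) : io c q = 1 / q := by
  unfold io
  rw [Real.smoothTransition.one_of_one_le]
  have : 2 * q / c ≥ 2 := by rw [ge_iff_le, le_div_iff₀ hc]; linarith
  linarith

lemma io_contDiff {c : ℝ} (hc : 0 < c) : ContDiff ℝ (⊤ : ℕ∞) (io c) := by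
  rw [contDiff_iff_contDiffAt]
  intro q
  by_cases hq : q = 0
  · subst hq
    have : io c =ᶠ[𝓝 0] fun _ => 0 := by
      filter_upwards [gt_mem_nhds (show (0:ℝ) < c / 2 by positivity)] with q hq
      unfold io
      rw [Real.smoothTransition.zero_of_nonpos, zero_div]
      have : 2 * q / c ≤ 1 := by rw [div_le_iff₀ hc]; linarith
      linarith
    exact contDiffAt_const.congr_of_eventuallyEq this
  · unfold io
    apply ContDiffAt.div _ contDiffAt_id hq
    exact (Real.smoothTransition.contDiff.comp (by fun_prop)).contDiffAt

lemma avg_int_bdd {n : ℕ} {f : Eu n → ℝ} (hf : Measurable f) {B : ℝ} (hB : ∀ y, |f y| ≤ B) (A : Eu n) (t : ℝ) :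
    Integrable (fun y => kern n y * f (A + t • y)) := by
  apply (kern_integrable n).mul_bdd (c := B)
  · exact (hf.comp (by fun_prop)).aestronglyMeasurable
  · exact Filter.Eventually.of_forall fun y => hB _

lemma avg_int_bdd' {n : ℕ} {f : Eu n → ℝ} (hf : Measurable f) {B : ℝ} (hB : ∀ y, |f y| ≤ B) (A : Eu n) {t : ℝ}
    (ht : 0 < t) :
    Integrable (fun Y => kern n (t⁻¹ • (Y - A)) * f Y) := by
  have h1 : Integrable (fun Y => kern n (t⁻¹ • (Y - A))) := by
    have : Integrable (fun Y => kern n (t⁻¹ • Y)) :=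
      (kern_integrable n).comp_smul (inv_ne_zero ht.ne')
    exact this.comp_sub_right A
  apply h1.mul_bdd (c := B) hf.aestronglyMeasurable
  exact Filter.Eventually.of_forall fun y => hB _

lemma avg_smooth {n : ℕ} {f : Eu n → ℝ} (hf : Measurable f) {B : ℝ} (hB : ∀ y, |f y| ≤ B) {t : ℝ} (ht : 0 < t) :
    ContDiff ℝ (⊤ : ℕ∞) (fun X => avg f X t) := by
  have hk : ContDiff ℝ (⊤ : ℕ∞) (fun z : Eu n => kern n (-(t⁻¹ • z))) :=
    (kern_contDiff n).comp (by fun_prop)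
  have hkc : HasCompactSupport (fun z : Eu n => kern n (-(t⁻¹ • z))) := by
    apply HasCompactSupport.intro (isCompact_closedBall (0 : Eu n) t)
    intro x hx
    apply kern_zero
    rw [mem_closedBall, dist_zero_right, not_le] at hx
    rw [norm_neg, norm_smul, norm_inv, Real.norm_of_nonneg ht.le, inv_mul_eq_div, le_div_iff₀ ht]
    linarith
  have hloc : LocallyIntegrable f volume := by
    refine (locallyIntegrable_const (B : ℝ)).mono hf.aestronglyMeasurable ?_
    exact Filter.Eventually.of_forall fun y => (hB y).trans (le_abs_self _)
  have := hkc.contDiff_convolution_right (ContinuousLinearMap.mul ℝ ℝ) hloc hk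
  have e : (fun X => avg f X t) = fun X => (t ^ n)⁻¹ *
      (convolution f (fun z : Eu n => kern n (-(t⁻¹ • z))) (ContinuousLinearMap.mul ℝ ℝ) volume) X := by
    ext X
    rw [avg_eq f X ht]
    congr 1
    unfold convolution
    congr 1
    ext Y
    simp only [ContinuousLinearMap.mul_apply']
    rw [← smul_neg, neg_sub, mul_comm]
  rw [e]
  exact contDiff_const.mul this

lemma vol_ball {n : ℕ} (X : Eu n) {r : ℝ} (hr : 0 < r) :
    volume (ball X r) = ENNReal.ofReal (r ^ n) * volume (ball (0 : Eu n) 1) := by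
  rw [Measure.addHaar_ball_of_pos volume X hr, finrank_euclideanSpace_fin]

lemma avg_lip (n : ℕ) : ∃ C : ℝ, 0 < C ∧ ∀ (f : Eu n → ℝ), Measurable f → ∀ B : ℝ, (∀ y, |f y| ≤ B) →
    ∀ (X X' : Eu n) (t w : ℝ), 0 < t → dist X' X ≤ t → (∀ y ∈ ball X (2 * t), |f y| ≤ w) →
    |avg f X' t - avg f X t| ≤ C * w / t * dist X' X := by
  obtain ⟨L, hL⟩ := (kern_contDiff n).lipschitzWith_of_hasCompactSupport (kern_compact n) (by simp)
  refine ⟨(L + 1) * 2 ^ n * (volume (ball (0 : Eu n) 1)).toReal, ?_, ?_⟩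
  · have := ENNReal.toReal_pos (measure_ball_pos volume (0 : Eu n) one_pos).ne' measure_ball_lt_top.ne
    positivity
  intro f hf B hB X X' t w ht hd hw
  have hw0 : 0 ≤ w := (abs_nonneg _).trans (hw X (mem_ball_self (by positivity)))
  rw [avg_eq f X ht, avg_eq f X' ht, ← mul_sub, ← integral_sub (avg_int_bdd' hf hB _ ht) (avg_int_bdd' hf hB _ ht),
    abs_mul, abs_of_pos (by positivity)]
  have hb : |∫ Y, (kern n (t⁻¹ • (Y - X')) * f Y - kern n (t⁻¹ • (Y - X)) * f Y)| ≤
      ∫ Y, (ball X (2 * t)).indicator (fun _ => (L + 1) * (dist X' X / t) * w) Y := by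
    rw [← Real.norm_eq_abs]
    apply norm_integral_le_of_norm_le
    · exact (integrable_indicator_iff measurableSet_ball).2 (integrableOn_const measure_ball_lt_top.ne)
    · refine Filter.Eventually.of_forall fun Y => ?_
      by_cases hY : Y ∈ ball X (2 * t)
      · rw [indicator_of_mem hY, ← sub_mul, norm_mul]
        apply mul_le_mul _ (hw Y hY) (abs_nonneg _) (by positivity)
        rw [← dist_eq_norm]
        refine (hL.dist_le_mul _ _).trans ?_
        apply mul_le_mul (by linarith) _ dist_nonneg (by positivity)
        rw [dist_eq_norm, ← smul_sub, norm_smul, norm_inv, Real.norm_of_nonneg ht.le, sub_sub_sub_cancel_left,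
          ← dist_eq_norm, dist_comm, inv_mul_eq_div]
      · rw [indicator_of_notMem hY]
        have h1 : 2 * t ≤ dist Y X := by simpa using hY
        have z : ∀ Z : Eu n, dist Z X ≤ t → kern n (t⁻¹ • (Y - Z)) = 0 := by
          intro Z hZ
          apply kern_zero
          rw [norm_smul, norm_inv, Real.norm_of_nonneg ht.le, inv_mul_eq_div, le_div_iff₀ ht, ← dist_eq_norm]
          have := dist_triangle Y Z X
          linarith
        rw [z X' hd, z X (by simp [ht.le])]
        simp
  refine (mul_le_mul_of_nonneg_left hb (by positivity)).trans ?_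
  rw [integral_indicator measurableSet_ball, setIntegral_const, smul_eq_mul, Measure.real,
    vol_ball X (by positivity : (0:ℝ) < 2 * t), ENNReal.toReal_mul, ENNReal.toReal_ofReal (by positivity)]
  apply le_of_eq
  rw [mul_pow]
  field_simp

lemma avg_one_lower (n : ℕ) (q : ℝ) (hq : 0 < q) (hq1 : q ≤ 1/2): ∃ c : ℝ, 0 < c ∧ ∀ (D : Set (Eu n)), MeasurableSet D →
    ∀ (X A : Eu n) (t : ℝ), 0 < t → dist A X ≤ t / 4 → ball A (q * t) ⊆ D →
    c ≤ avg (D.indicator fun _ => (1:ℝ)) X t := by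
  obtain ⟨c, hc, hk⟩ := kern_lower n (3/4) (by norm_num)
  have hv := ENNReal.toReal_pos (measure_ball_pos volume (0 : Eu n) hq).ne' measure_ball_lt_top.ne
  refine ⟨c * (volume (ball (0 : Eu n) q)).toReal, by positivity, ?_⟩
  intro D hD X A t ht hd hsub
  unfold avg
  have : ∫ y, (ball (t⁻¹ • (A - X)) q).indicator (fun _ => c) y = c * (volume (ball (0 : Eu n) q)).toReal := by
    rw [integral_indicator measurableSet_ball, setIntegral_const, smul_eq_mul, Measure.real, Measure.addHaar_ball_center,
      mul_comm]
  rw [← this]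
  apply integral_mono
  · exact (integrable_indicator_iff measurableSet_ball).2 (integrableOn_const measure_ball_lt_top.ne)
  · apply avg_int_bdd (B := 1) ((measurable_const).indicator hD)
    intro y
    by_cases hy : y ∈ D <;> simp [hy]
  · intro y
    by_cases hy : y ∈ ball (t⁻¹ • (A - X)) q
    · have h1 : X + t • y ∈ D := by
        apply hsub
        rw [mem_ball, dist_eq_norm] at hy ⊢
        have : X + t • y - A = t • (y - t⁻¹ • (A - X)) := by
          rw [smul_sub, smul_smul, mul_inv_cancel₀ ht.ne', one_smul]; abel
        rw [this, norm_smul, Real.norm_of_nonneg ht.le, mul_comm]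
        gcongr
      simp only [indicator_of_mem hy, indicator_of_mem h1, mul_one]
      apply hk
      rw [mem_ball, dist_eq_norm] at hy
      have h2 : ‖t⁻¹ • (A - X)‖ ≤ 1/4 := by
        rw [norm_smul, norm_inv, Real.norm_of_nonneg ht.le, inv_mul_eq_div, div_le_iff₀ ht, ← dist_eq_norm]
        linarith
      have := norm_le_norm_sub_add y (t⁻¹ • (A - X))
      linarith
    · simp only [indicator_of_notMem hy]
      apply mul_nonneg (kern_nonneg n y)
      exact indicator_nonneg (fun _ _ => zero_le_one) _

end

open MeasureTheory Metric Set
open scoped RealInnerProductSpace ENNReal NNReal Topology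

noncomputable section

lemma gm_sq {n : ℕ} (f : Eu n → ℝ) (S : Set (Eu n)) :
    (gm f S) ^ 2 ≤ volume S * ∫⁻ y in S, ‖fderiv ℝ f y‖ₑ ^ 2 := by
  have hm : AEMeasurable (fun y => ‖fderiv ℝ f y‖ₑ) (volume.restrict S) :=
    (measurable_fderiv ℝ f).enorm.aemeasurable
  have := ENNReal.lintegral_mul_le_Lp_mul_Lq (volume.restrict S) (p := 2) (q := 2)
    (Real.HolderConjugate.two_two) (aemeasurable_const (b := (1:ℝ≥0∞))) hm
  have h2 := pow_le_pow_left₀ (zero_le) this 2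
  simp only [Pi.mul_apply, one_mul, ENNReal.one_rpow, lintegral_const, Measure.restrict_apply_univ] at h2
  refine le_trans h2 (le_of_eq ?_)
  rw [mul_pow, ← ENNReal.rpow_mul_natCast, ← ENNReal.rpow_mul_natCast]
  norm_num

lemma avg_abs_le {n : ℕ} {D : Set (Eu n)} (hD : MeasurableSet D) {f : Eu n → ℝ} {X : Eu n}
    {t w : ℝ} (ht : 0 < t) (hw : ∀ y ∈ ball X t, |f y| ≤ w * D.indicator (fun _ => (1:ℝ)) y) :
    |avg f X t| ≤ w * avg (D.indicator (fun _ => (1:ℝ))) X t := by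
  unfold avg
  rw [← integral_const_mul, ← Real.norm_eq_abs]
  apply norm_integral_le_of_norm_le
  · apply Integrable.const_mul
    apply avg_int_bdd (B := 1) ((measurable_const).indicator hD)
    intro y
    by_cases hy : y ∈ D <;> simp [hy]
  · refine Filter.Eventually.of_forall fun y => ?_
    rw [norm_mul, Real.norm_of_nonneg (kern_nonneg n y), mul_left_comm]
    by_cases hy : ‖y‖ < 1
    · apply mul_le_mul_of_nonneg_left _ (kern_nonneg n y)
      apply hw
      rw [mem_ball, dist_eq_norm, add_sub_cancel_left, norm_smul, Real.norm_of_nonneg ht.le]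
      nlinarith
    · rw [kern_zero n y (not_lt.1 hy)]; simp

lemma approx (n : ℕ) (M : ℝ) (hM : 1 < M) : ∃ C K : ℝ, 0 < C ∧ 1 ≤ K ∧ ∀ (Ω : Set (Eu n)), IsOneSidedNTA M Ω →
    (frontier Ω).Nonempty → ∀ (Q : Eu n) (ρ1 ρ2 ε : ℝ) (u : Eu n → ℝ), 0 < ε → ρ1 + K * ε ≤ ρ2 →
    K * ε < Metric.diam Ω → ContinuousOn u (closure Ω ∩ closedBall Q ρ2) → IsHarmonicOn u (Ω ∩ ball Q ρ2) →
    ∃ v : Eu n → ℝ, ContDiff ℝ (⊤ : ℕ∞) v ∧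
      (∀ X ∈ Ω ∩ ball Q ρ1, K * ε < dl Ω X → v X = u X) ∧
      (∀ X ∈ closure Ω ∩ ball Q ρ1, ∀ c w : ℝ, (∀ Y ∈ closure Ω ∩ ball Q ρ2 ∩ ball X (K * ε), |u Y - c| ≤ w) →
        |v X - c| ≤ w) ∧
      ∫⁻ X in Ω ∩ ball Q ρ1, ‖fderiv ℝ v X‖ₑ ^ 2 ≤ ENNReal.ofReal C * ∫⁻ X in Ω ∩ ball Q ρ2, ‖fderiv ℝ u X‖ₑ ^ 2 := by
  set k := 16 * M + 8 with hk
  set K1 := 4 * M + 2 * k with hK1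
  obtain ⟨C1, K', κ, hC1, hK', hκ, hκ2, HL⟩ := link_grad n M K1 hM (by rw [hK1]; linarith)
  obtain ⟨CL, hCL, HLip⟩ := avg_lip n
  have hk0 : 0 < k := by linarith
  obtain ⟨c0, hc0, Hc0⟩ := avg_one_lower n (1 / k) (by positivity) (by
    rw [div_le_iff₀ hk0]; linarith)
  set V := (volume (ball (0 : Eu n) 1)).toReal with hV
  have hV0 : 0 < V := ENNReal.toReal_pos (measure_ball_pos volume (0 : Eu n) one_pos).ne' measure_ball_lt_top.ne
  have hVe : volume (ball (0 : Eu n) 1) = ENNReal.ofReal V := (ENNReal.ofReal_toReal measure_ball_lt_top.ne).symm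
  set K2 := K' + 4 * M with hK2
  set C3 := 2 * CL * C1 / (c0 * k) with hC3
  have hC30 : 0 < C3 := by positivity
  refine ⟨(C3 * K2 ^ n * V) ^ 2, 10 * K1 + K2 + k + 2, by positivity, by linarith, ?_⟩
  intro Ω hΩ hF Q ρ1 ρ2 ε u hε hρ hdiam hu hharm
  set K := 10 * K1 + K2 + k + 2 with hK
  have hMε : ε ≤ M * ε := le_mul_of_one_le_left (by linarith) (by linarith)
  have eK : K * ε = 10 * (4 * (M * ε) + 2 * (16 * (M * ε) + 8 * ε)) + (K' * ε + 4 * (M * ε)) +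
    (16 * (M * ε) + 8 * ε) + 2 * ε := by rw [hK, hK1, hK2, hk]; ring
  have hK'ε : 0 < K' * ε := by positivity
  set t := k * ε with ht
  have ht0 : 0 < t := by positivity
  have ekt : t = 16 * (M * ε) + 8 * ε := by rw [ht, hk]; ring
  set D : Set (Eu n) := (closure Ω ∩ {X | ε ≤ dl Ω X}) ∩ closedBall Q (ρ1 + t) with hDdef
  have hDc : IsClosed D := by
    refine (isClosed_closure.inter (isClosed_le continuous_const ?_)).inter isClosed_closedBall
    exact continuous_infDist_pt _
  have hDm : MeasurableSet D := hDc.measurableSet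
  have hDcomp : IsCompact D := (isCompact_closedBall Q (ρ1 + t)).of_isClosed_subset hDc inter_subset_right
  have hDΩ : D ⊆ Ω := fun X hX => mem_of_dl_pos hΩ.isOpen hX.1.1 (lt_of_lt_of_le hε hX.1.2)
  have hDu : ContinuousOn u D := hu.mono fun X hX => ⟨hX.1.1, closedBall_subset_closedBall (by linarith) hX.2⟩
  obtain ⟨B, hB⟩ := hDcomp.exists_bound_of_continuousOn hDu
  set f0 := D.indicator u with hf0
  set f1 := D.indicator (fun _ => (1:ℝ)) with hf1
  have hf1m : Measurable f1 := measurable_const.indicator hDm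
  have hf0m : Measurable f0 := by
    classical
    rw [hf0, ← piecewise_eq_indicator]
    exact hDu.measurable_piecewise continuousOn_const hDm
  have hf1b : ∀ y, |f1 y| ≤ 1 := by
    intro y; by_cases hy : y ∈ D <;> simp [hf1, hy]
  have hf0b : ∀ y, |f0 y| ≤ max B 0 := by
    intro y
    by_cases hy : y ∈ D
    · rw [hf0, indicator_of_mem hy]; exact (hB y hy).trans (le_max_left _ _)
    · simp [hf0, hy]
  set v : Eu n → ℝ := fun X => avg f0 X t * io c0 (avg f1 X t) with hv
  -- lower bound
  have hcork : ∀ X ∈ closure Ω ∩ ball Q ρ1, ∃ A ∈ Ω, 2 * ε ≤ dl Ω A ∧ dist A X ≤ 4 * (M * ε) ∧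
      c0 ≤ avg f1 X t := by
    intro X hX
    obtain ⟨A, hA, h1, h2⟩ := cork hΩ hF hX.1 (τ := 2 * ε) (by positivity) (by linarith)
    refine ⟨A, hA, h1, by linarith, ?_⟩
    apply Hc0 D hDm X A t ht0 (by linarith)
    have : 1 / k * t = ε := by rw [ht]; field_simp
    rw [this]
    intro Y hY
    have hdY : ε ≤ dl Ω Y := by have := ball_dl (Ω := Ω) hY; linarith
    have hYΩ : Y ∈ Ω := by
      apply ballSub hΩ.isOpen hA
      rw [mem_ball] at hY ⊢; linarith
    refine ⟨⟨subset_closure hYΩ, hdY⟩, ?_⟩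
    rw [mem_closedBall]
    rw [mem_ball] at hY
    have hXb := hX.2
    rw [mem_ball] at hXb
    have := dist_triangle4 Y A X Q
    linarith
  set fc : ℝ → Eu n → ℝ := fun c => D.indicator (fun y => u y - c) with hfc
  have hfcm : ∀ c, Measurable (fc c) := by
    intro c
    classical
    simp only [hfc]
    rw [← piecewise_eq_indicator]
    exact (hDu.sub continuousOn_const).measurable_piecewise continuousOn_const hDm
  have hfcb : ∀ c y, |fc c y| ≤ max B 0 + |c| := by
    intro c y
    by_cases hy : y ∈ D
    · simp only [hfc, indicator_of_mem hy]
      exact (abs_sub _ _).trans (add_le_add ((hB y hy).trans (le_max_left _ _)) le_rfl)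
    · simp only [hfc, indicator_of_notMem hy, abs_zero]; positivity
  have hvc : ∀ X ∈ closure Ω ∩ ball Q ρ1, ∀ c, v X - c = avg (fc c) X t / avg f1 X t := by
    intro X hX c
    obtain ⟨A, -, -, -, h⟩ := hcork X hX
    have h0 : 0 < avg f1 X t := lt_of_lt_of_le hc0 h
    have : avg (fc c) X t = avg f0 X t - c * avg f1 X t := by
      unfold avg
      rw [← integral_const_mul, ← integral_sub (avg_int_bdd hf0m hf0b X t)
        ((avg_int_bdd hf1m hf1b X t).const_mul c)]
      congr 1
      ext y
      by_cases hy : X + t • y ∈ D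
      · simp only [hfc, hf0, hf1, indicator_of_mem hy]; ring
      · simp [hfc, hf0, hf1, indicator_of_notMem hy]
    rw [this, hv]
    simp only
    rw [io_eq hc0 h]
    field_simp
  refine ⟨v, (avg_smooth hf0m hf0b ht0).mul ((io_contDiff hc0).comp (avg_smooth hf1m hf1b ht0)), ?_, ?_, ?_⟩
  · rintro X ⟨hXΩ, hXb⟩ hd
    have hsub : ball X (t + ε) ⊆ Ω := (ball_subset_ball (by linarith)).trans (ballSub hΩ.isOpen hXΩ)
    have hmem : ∀ y ∈ ball (0 : Eu n) 1, X + t • y ∈ D := by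
      intro y hy
      have hy1 : X + t • y ∈ ball X (t + ε) := mem_ball_smul ht0.le (by linarith) (by simpa using (mem_ball.1 hy).le)
      have hy2 : X + t • y ∈ closedBall X t := by
        rw [mem_closedBall, dist_eq_norm, add_sub_cancel_left, norm_smul, Real.norm_of_nonneg ht0.le]
        have : ‖y‖ < 1 := by simpa using hy
        exact mul_le_of_le_one_right ht0.le this.le
      refine ⟨⟨subset_closure (hsub hy1), ?_⟩, ?_⟩
      · have := ball_dl (Ω := Ω) hy1
        show ε ≤ dl Ω _
        linarith
      · rw [mem_closedBall] at *
        rw [mem_ball] at hXb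
        have := dist_triangle (X + t • y) X Q
        linarith
    have e1 : avg f0 X t = u X := by
      rw [avg_congr (g := u) (fun y hy => by rw [hf0, indicator_of_mem (hmem y hy)])]
      apply mvp ht0.le (ρ := t + ε) (by linarith)
      apply hharm.mono
      refine subset_inter hsub (ball_subset_ball' ?_)
      rw [mem_ball] at hXb
      linarith
    have e2 : avg f1 X t = 1 := by
      rw [avg_congr (g := fun _ => 1) (fun y hy => by rw [hf1, indicator_of_mem (hmem y hy)])]
      unfold avg
      simp [kern_int]
    obtain ⟨A, -, -, -, h⟩ := hcork X ⟨subset_closure hXΩ, hXb⟩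
    rw [hv]
    simp only
    rw [io_eq hc0 h, e1, e2]; simp
  · intro X hX c w hw
    rw [hvc X hX c, abs_div]
    obtain ⟨A, -, -, -, h⟩ := hcork X hX
    have h0 : 0 < avg f1 X t := lt_of_lt_of_le hc0 h
    rw [abs_of_pos h0, div_le_iff₀ h0]
    apply avg_abs_le hDm ht0
    intro y hy
    by_cases hyD : y ∈ D
    · simp only [hfc, indicator_of_mem hyD, mul_one]
      apply hw
      refine ⟨⟨hyD.1.1, ?_⟩, ball_subset_ball (by linarith) hy⟩
      exact closedBall_subset_ball (by linarith) hyD.2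
    · simp [hfc, indicator_of_notMem hyD]
  · have hpt : ∀ X ∈ Ω ∩ ball Q ρ1, ‖fderiv ℝ v X‖ₑ ≤ ENNReal.ofReal (C3 / ε ^ n) * gm u (Ω ∩ ball X (K2 * ε)) := by
      intro X hX
      by_cases htop : gm u (Ω ∩ ball X (K2 * ε)) = ⊤
      · rw [htop, ENNReal.mul_top]
        · exact le_top
        · simp only [ne_eq, ENNReal.ofReal_eq_zero, not_le]; positivity
      obtain ⟨A, hA, hA1, hA2, hA3⟩ := hcork X ⟨subset_closure hX.1, hX.2⟩
      set m := (gm u (Ω ∩ ball X (K2 * ε))).toReal with hm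
      set w := C1 * (ε / ε ^ n) * m with hw
      have hw0 : 0 ≤ w := by positivity
      have hXb := mem_ball.1 hX.2
      have hmv : ∀ Y ∈ Ω, ε ≤ dl Ω Y → ball Y ε ⊆ ball Q ρ2 → avg u Y (κ * ε) = u Y := by
        intro Y hY hd hs
        apply mvp (ρ := ε) (by positivity) (by nlinarith)
        exact hharm.mono (subset_inter ((ball_subset_ball hd).trans (ballSub hΩ.isOpen hY)) hs)
      have hosc : ∀ Y ∈ D ∩ ball X (2 * t), |u Y - u A| ≤ w := by
        rintro Y ⟨hYD, hYX⟩
        rw [mem_ball] at hYX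
        have hYQ := mem_closedBall.1 hYD.2
        have h1 := HL Ω hΩ A hA Y (hDΩ hYD) ε hε (by linarith) hYD.1.2 (by
          have := dist_triangle_right A Y X
          have e : K1 * ε = 4 * (M * ε) + 2 * t := by rw [hK1, ht]; ring
          linarith) (by
          have e : K1 * ε = 4 * (M * ε) + 2 * (16 * (M * ε) + 8 * ε) := by rw [hK1, hk]; ring
          linarith) u (by
            rintro y ⟨hy1, hy2⟩
            refine ((hharm y ⟨hy1, ?_⟩).1).of_le (by norm_num)
            rw [mem_ball] at hy2 ⊢
            have := dist_triangle4 y A X Q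
            linarith)
        rw [hmv A hA (by linarith) (ball_subset_ball' (by have := dist_triangle A X Q; linarith)),
          hmv Y (hDΩ hYD) hYD.1.2 (ball_subset_ball' (by linarith))] at h1
        have h2 : Ω ∩ ball A (K' * ε) ⊆ Ω ∩ ball X (K2 * ε) := by
          apply inter_subset_inter_right
          apply ball_subset_ball'
          rw [hK2]; linarith
        have h3 := h1.trans (mul_le_mul' le_rfl (gm_mono u h2))
        rw [← ENNReal.ofReal_toReal htop, ← ENNReal.ofReal_mul (by positivity)] at h3
        exact (ENNReal.ofReal_le_ofReal_iff hw0).1 h3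
      set c := u A with hc
      have hfcw : ∀ y ∈ ball X (2 * t), |fc c y| ≤ w * f1 y := by
        intro y hy
        by_cases hyD : y ∈ D
        · simp only [hfc, hf1, indicator_of_mem hyD, mul_one]
          exact hosc y ⟨hyD, hy⟩
        · simp [hfc, hf1, indicator_of_notMem hyD]
      have hN := avg_abs_le hDm ht0 (X := X) (f := fc c) (w := w)
        (fun y hy => hfcw y (ball_subset_ball (by linarith) hy))
      have hder : ‖fderiv ℝ v X‖ ≤ 2 * CL * w / (c0 * t) := by
        apply norm_fderiv_le_of_lip' ℝ (by positivity)
        have hev : ∀ᶠ X' in 𝓝 X, X' ∈ (Ω ∩ ball Q ρ1) ∩ ball X t :=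
          ((hΩ.isOpen.inter isOpen_ball).inter isOpen_ball).mem_nhds ⟨hX, mem_ball_self ht0⟩
        filter_upwards [hev] with X' hX'
        have hd : dist X' X ≤ t := (mem_ball.1 hX'.2).le
        obtain ⟨A', -, -, -, h'⟩ := hcork X' ⟨subset_closure hX'.1.1, hX'.1.2⟩
        have l1 := HLip (fc c) (hfcm c) _ (hfcb c) X X' t w ht0 hd (fun y hy =>
          (hfcw y hy).trans (mul_le_of_le_one_right hw0 ((le_abs_self _).trans (hf1b y))))
        have l2 := HLip f1 hf1m _ hf1b X X' t 1 ht0 hd (fun y hy => hf1b y)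
        have e : v X' - v X = (v X' - c) - (v X - c) := by ring
        rw [e, hvc X' ⟨subset_closure hX'.1.1, hX'.1.2⟩ c, hvc X ⟨subset_closure hX.1, hX.2⟩ c]
        set N' := avg (fc c) X' t
        set N := avg (fc c) X t
        set d' := avg f1 X' t
        set dd := avg f1 X t
        have hd'0 : 0 < d' := lt_of_lt_of_le hc0 h'
        have hd0 : 0 < dd := lt_of_lt_of_le hc0 hA3
        have e2 : N' / d' - N / dd = ((N' - N) - N / dd * (d' - dd)) / d' := by field_simp; ring
        rw [e2, norm_div, Real.norm_of_nonneg hd'0.le, ← dist_eq_norm]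
        have b1 : ‖(N' - N) - N / dd * (d' - dd)‖ ≤ 2 * (CL * w / t * dist X' X) := by
          refine (norm_sub_le _ _).trans ?_
          rw [two_mul]
          refine add_le_add l1 ?_
          rw [norm_mul]
          calc ‖N / dd‖ * ‖d' - dd‖ ≤ w * (CL * 1 / t * dist X' X) := by
                apply mul_le_mul _ l2 (abs_nonneg _) hw0
                rw [norm_div, Real.norm_of_nonneg hd0.le, div_le_iff₀ hd0]
                exact hN
            _ = _ := by ring
        calc _ ≤ 2 * (CL * w / t * dist X' X) / c0 := div_le_div₀ (by positivity) b1 hc0 h'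
          _ = _ := by rw [dist_eq_norm X']; field_simp
      have e3 : 2 * CL * w / (c0 * t) = C3 / ε ^ n * m := by
        rw [hw, hC3, ht]; field_simp
      rw [e3] at hder
      rw [← ENNReal.ofReal_toReal htop, ← ENNReal.ofReal_mul (by positivity), ← hm, ← ofReal_norm]
      exact ENNReal.ofReal_le_ofReal hder
    have hpt2 : ∀ X ∈ Ω ∩ ball Q ρ1, ‖fderiv ℝ v X‖ₑ ^ 2 ≤ ENNReal.ofReal ((C3 / ε ^ n) ^ 2 * ((K2 * ε) ^ n * V)) *
        ∫⁻ y in Ω ∩ ball X (K2 * ε), ‖fderiv ℝ u y‖ₑ ^ 2 := by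
      intro X hX
      refine (pow_le_pow_left₀ zero_le (hpt X hX) 2).trans ?_
      rw [mul_pow, ENNReal.ofReal_mul (by positivity), ← ENNReal.ofReal_pow (by positivity), mul_assoc]
      refine mul_le_mul' le_rfl ((gm_sq u _).trans (mul_le_mul' ?_ le_rfl))
      refine (measure_mono inter_subset_right).trans ?_
      rw [vol_ball X (by positivity), hVe, ENNReal.ofReal_mul (by positivity)]
    refine (setLIntegral_mono' (hΩ.isOpen.measurableSet.inter measurableSet_ball) hpt2).trans ?_
    rw [lintegral_const_mul' _ _ ENNReal.ofReal_ne_top]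
    have tb := tonelli_ball volume (Ω ∩ ball Q ρ1) (Ω ∩ ball Q ρ2) Ω (hΩ.isOpen.measurableSet.inter measurableSet_ball)
      hΩ.isOpen.measurableSet (hΩ.isOpen.measurableSet.inter measurableSet_ball) (K2 * ε)
      (fun y => ‖fderiv ℝ u y‖ₑ ^ 2) ((measurable_fderiv ℝ u).enorm.pow_const 2)
      (ENNReal.ofReal ((K2 * ε) ^ n * V)) (by
        intro y hy
        apply inter_subset_inter_right
        apply ball_subset_ball'
        have := mem_ball.1 hy.2
        rw [hK2]; linarith) (by
        intro X _
        refine (measure_mono inter_subset_left).trans ?_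
        rw [vol_ball X (by positivity), hVe, ENNReal.ofReal_mul (by positivity)])
    refine (mul_le_mul' le_rfl tb).trans ?_
    rw [← mul_assoc, ← ENNReal.ofReal_mul (by positivity)]
    apply le_of_eq
    congr 2
    rw [mul_pow]
    field_simp

end

open MeasureTheory Metric Set
open scoped RealInnerProductSpace ENNReal NNReal Topology

noncomputable section

lemma cont_mul_cut {n : ℕ} {f η : Eu n → ℝ} {T U : Set (Eu n)} (hU : IsOpen U)
    (hf : ContinuousOn f (T ∩ U)) (hη : Continuous η) (hs : tsupport η ⊆ U) :
    ContinuousOn (fun x => f x * η x) T := by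
  intro x hx
  by_cases hxU : x ∈ U
  · have h1 : ContinuousWithinAt f T x := by
      have := hf x ⟨hx, hxU⟩
      rwa [continuousWithinAt_inter (hU.mem_nhds hxU)] at this
    exact h1.mul hη.continuousWithinAt
  · have h2 : (fun x => f x * η x) =ᶠ[𝓝 x] fun _ => 0 := by
      have : η =ᶠ[𝓝 x] 0 := notMem_tsupport_iff_eventuallyEq.1 (fun h => hxU (hs h))
      filter_upwards [this] with y hy
      simp [hy]
    exact (continuousAt_const.congr h2.symm).continuousWithinAt

lemma norm_grad {n : ℕ} (f : Eu n → ℝ) (X : Eu n) : ‖gradient f X‖ = ‖fderiv ℝ f X‖ := by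
  unfold gradient
  exact LinearIsometryEquiv.norm_map _ _

lemma meas_grad {n : ℕ} (f : Eu n → ℝ) : Measurable (gradient f) := by
  unfold gradient
  exact (LinearIsometryEquiv.continuous _).measurable.comp (measurable_fderiv ℝ f)

lemma grad_mul_comp {n : ℕ} {η v : Eu n → ℝ} {g : ℝ → ℝ} {X : Eu n} (hη : DifferentiableAt ℝ η X)
    (hv : DifferentiableAt ℝ v X) (hg : DifferentiableAt ℝ g (v X)) :
    gradient (fun Y => η Y * g (v Y)) X = g (v X) • gradient η X + (η X * deriv g (v X)) • gradient v X := by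
  unfold gradient
  have h1 : fderiv ℝ (fun Y => g (v Y)) X = deriv g (v X) • fderiv ℝ v X :=
    (hg.hasDerivAt.comp_hasFDerivAt X hv.hasFDerivAt).fderiv
  have h2 : fderiv ℝ (fun Y => η Y * g (v Y)) X = η X • fderiv ℝ (fun Y => g (v Y)) X + g (v X) • fderiv ℝ η X :=
    fderiv_fun_mul hη (hg.comp X hv)
  rw [h2, h1, map_add, map_smul, map_smul, map_smul, smul_smul, add_comm]

lemma L1_aux {α : Type*} [MeasurableSpace α] {μ : Measure α} (Ik : ℕ → α → ℝ) (I : α → ℝ) (L : ℕ → Set α)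
    (hL : ∀ k, MeasurableSet (L k)) (hLe : ∀ x, ∀ᶠ k in Filter.atTop, x ∉ L k) (p : α → ℝ≥0∞) (hp : Measurable p)
    (hpf : ∫⁻ x, (1 + p x) ∂μ ≠ ⊤)
    (q : ℕ → α → ℝ≥0∞) (B c : ℝ≥0∞) (hB : B ≠ ⊤) (hc : c ≠ ⊤) (hq : ∀ k, ∫⁻ x, q k x ∂μ ≤ B) (hqm : ∀ k, Measurable (q k))
    (hoff : ∀ k, ∀ᵐ x ∂μ, x ∉ L k → Ik k x = I x)
    (hon : ∀ k, ∀ m : ℕ, ∀ᵐ x ∂μ, x ∈ L k → ‖Ik k x - I x‖ₑ ≤ c * ((3 + m) * (1 + p x) + (m + 1 : ℝ≥0∞)⁻¹ * q k x)) :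
    Filter.Tendsto (fun k => ∫⁻ x, ‖Ik k x - I x‖ₑ ∂μ) Filter.atTop (𝓝 0) := by
  have hlay : Filter.Tendsto (fun k => ∫⁻ x, (L k).indicator (fun x => 1 + p x) x ∂μ) Filter.atTop (𝓝 0) := by
    have := tendsto_lintegral_of_dominated_convergence (μ := μ) (F := fun k x => (L k).indicator (fun x => 1 + p x) x)
      (f := fun _ => 0) (fun x => 1 + p x) (fun k => (measurable_const.add hp).indicator (hL k))
      (fun k => Filter.Eventually.of_forall fun x => indicator_le_self _ _ _) hpf
      (Filter.Eventually.of_forall fun x => by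
        apply tendsto_const_nhds.congr'
        filter_upwards [hLe x] with k hk
        rw [indicator_of_notMem hk])
    simpa using this
  have hbd : ∀ m k : ℕ, ∫⁻ x, ‖Ik k x - I x‖ₑ ∂μ ≤ c * (3 + m) * (∫⁻ x, (L k).indicator (fun x => 1 + p x) x ∂μ) +
      c * B * (m + 1 : ℝ≥0∞)⁻¹ := by
    intro m k
    calc ∫⁻ x, ‖Ik k x - I x‖ₑ ∂μ ≤ ∫⁻ x, (c * (3 + m) * (L k).indicator (fun x => 1 + p x) x +
          c * (m + 1 : ℝ≥0∞)⁻¹ * q k x) ∂μ := by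
          apply lintegral_mono_ae
          filter_upwards [hoff k, hon k m] with x h1 h2
          by_cases hx : x ∈ L k
          · rw [indicator_of_mem hx]
            refine (h2 hx).trans (le_of_eq ?_)
            ring
          · rw [h1 hx]; simp
      _ = c * (3 + m) * (∫⁻ x, (L k).indicator (fun x => 1 + p x) x ∂μ) + c * (m + 1 : ℝ≥0∞)⁻¹ * ∫⁻ x, q k x ∂μ := by
          rw [lintegral_add_right _ ((hqm k).const_mul _), lintegral_const_mul _ (hqm k), lintegral_const_mul]
          exact (measurable_const.add hp).indicator (hL k)
      _ ≤ _ := by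
          refine add_le_add le_rfl ?_
          calc c * (m + 1 : ℝ≥0∞)⁻¹ * ∫⁻ x, q k x ∂μ ≤ c * (m + 1 : ℝ≥0∞)⁻¹ * B := by gcongr; exact hq k
            _ = _ := by ring
  rw [ENNReal.tendsto_nhds_zero]
  intro e he
  have hm : Filter.Tendsto (fun m : ℕ => c * B * (m + 1 : ℝ≥0∞)⁻¹) Filter.atTop (𝓝 (c * B * 0)) := by
    apply ENNReal.Tendsto.const_mul _ (Or.inr (ENNReal.mul_ne_top hc hB))
    have := (Filter.tendsto_add_atTop_iff_nat 1).2 ENNReal.tendsto_inv_nat_nhds_zero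
    simpa using this
  rw [mul_zero] at hm
  have he2 : 0 < e / 2 := ENNReal.div_pos he.ne' (by simp)
  obtain ⟨m, hm⟩ := ((ENNReal.tendsto_nhds_zero.1 hm) _ he2).exists
  have hk : Filter.Tendsto (fun k => c * (3 + m) * (∫⁻ x, (L k).indicator (fun x => 1 + p x) x ∂μ)) Filter.atTop
      (𝓝 (c * (3 + m) * 0)) := by
    apply ENNReal.Tendsto.const_mul hlay
    right
    apply ENNReal.mul_ne_top hc
    simp
  rw [mul_zero] at hk
  filter_upwards [(ENNReal.tendsto_nhds_zero.1 hk) _ he2] with k hk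
  refine (hbd m k).trans ((add_le_add hk hm).trans ?_)
  rw [ENNReal.add_halves]


lemma robin_grad_fin {n : ℕ} {Ω : Set (Eu n)} {σ : Measure (Eu n)} {a : ℝ} {Q : Eu n} {R : ℝ} {u : Eu n → ℝ}
    (hs : IsRobinLocalSolution Ω σ a Q R u) {ρ : ℝ} (hρ : ρ < R) :
    ∫⁻ X in Ω ∩ ball Q ρ, ‖fderiv ℝ u X‖ₑ ^ 2 ≠ ⊤ := by
  have h := (hs.grad_L2 ρ hρ).lintegral_lt_top
  refine ne_of_lt (lt_of_le_of_lt (lintegral_mono fun X => ?_) h)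
  rw [norm_grad, ← ofReal_norm, ENNReal.ofReal_pow (norm_nonneg _)]

lemma diam_pos' {n : ℕ} {Ω : Set (Eu n)} (ho : IsOpen Ω) (hb : Bornology.IsBounded Ω) (hn : 1 ≤ n) (hne : Ω.Nonempty) :
    0 < Metric.diam Ω := by
  obtain ⟨x, hx⟩ := hne
  obtain ⟨r, hr, hsub⟩ := Metric.isOpen_iff.1 ho x hx
  set y : Eu n := x + EuclideanSpace.single (⟨0, hn⟩ : Fin n) (r/2) with hy
  have hd : dist y x = r / 2 := by
    rw [hy, dist_eq_norm, add_sub_cancel_left, EuclideanSpace.norm_single, Real.norm_of_nonneg (by positivity)]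
  have : y ∈ Ω := hsub (by rw [mem_ball, hd]; linarith)
  have := Metric.dist_le_diam_of_mem hb this hx
  linarith

/-- Integrand in the weak formulation -/
def wInt {n : ℕ} (u v ζ : Eu n → ℝ) (g : ℝ → ℝ) (X : Eu n) : ℝ :=
  g (v X) * ⟪gradient u X, gradient ζ X⟫ + ζ X * deriv g (v X) * ⟪gradient u X, gradient v X⟫

lemma wInt_bound {n : ℕ} {u v ζ : Eu n → ℝ} {g : ℝ → ℝ} {X : Eu n} {cg ce : ℝ} 
    (h1 : |g (v X)| ≤ cg) (h2 : |deriv g (v X)| ≤ cg) (h3 : |ζ X| ≤ ce) (h4 : ‖fderiv ℝ ζ X‖ ≤ ce) :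
    |wInt u v ζ g X| ≤ cg * ce * (‖fderiv ℝ u X‖ + ‖fderiv ℝ u X‖ * ‖fderiv ℝ v X‖) := by
  unfold wInt
  have hcg : 0 ≤ cg := (abs_nonneg _).trans h1
  have hce : 0 ≤ ce := (abs_nonneg _).trans h3
  have i1 := abs_real_inner_le_norm (gradient u X) (gradient ζ X)
  have i2 := abs_real_inner_le_norm (gradient u X) (gradient v X)
  rw [norm_grad, norm_grad] at i1 i2
  refine (abs_add_le _ _).trans ?_
  rw [abs_mul, abs_mul, abs_mul]
  calc _ ≤ cg * (‖fderiv ℝ u X‖ * ce) + ce * cg * (‖fderiv ℝ u X‖ * ‖fderiv ℝ v X‖) := by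
        gcongr
        exact i1.trans (by gcongr)
    _ = _ := by ring

lemma robin_weak {n : ℕ} (hn : 1 ≤ n) {M Cσ d cd : ℝ} {Ω : Set (Eu n)} {σ : Measure (Eu n)}
    (hΩ : IsMixedPair M Cσ d cd Ω σ) (hF : (frontier Ω).Nonempty) {a : ℝ} {Q : Eu n} {R : ℝ} {u : Eu n → ℝ}
    (hs : IsRobinLocalSolution Ω σ a Q R u) {ζ : Eu n → ℝ} (hζ : ContDiff ℝ (⊤ : ℕ∞) ζ) (hζc : HasCompactSupport ζ)
    (hζs : tsupport ζ ⊆ ball Q R) {g : ℝ → ℝ} (hg : ContDiff ℝ (⊤ : ℕ∞) g) :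
    IntegrableOn (wInt u u ζ g) Ω ∧ 
    (∫ X in Ω, wInt u u ζ g X) + a * ∫ P in frontier Ω, u P * (ζ P * g (u P)) ∂σ = 0 := by
  obtain ⟨C, K, hC, hK, HA⟩ := approx n M hΩ.nta.M_gt_one
  obtain ⟨ρ1, hρ1, hsub⟩ := exists_lt_subset_ball (isClosed_tsupport ζ) hζs
  set ρ2 := (ρ1 + R) / 2 with hρ2
  have hdiam := diam_pos' hΩ.nta.isOpen hΩ.bounded hn hΩ.nonempty
  obtain ⟨ε0, hε0, hε1⟩ : ∃ ε0 : ℝ, 0 < ε0 ∧ K * ε0 < min (Metric.diam Ω) (ρ2 - ρ1) := by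
    have hm : 0 < min (Metric.diam Ω) (ρ2 - ρ1) := lt_min hdiam (by linarith)
    refine ⟨min (Metric.diam Ω) (ρ2 - ρ1) / (2 * K), by positivity, ?_⟩
    have : K * (min (Metric.diam Ω) (ρ2 - ρ1) / (2 * K)) = min (Metric.diam Ω) (ρ2 - ρ1) / 2 := by
      field_simp
    rw [this]; linarith
  set ε : ℕ → ℝ := fun k => ε0 / (k + 1) with hε
  have hεp : ∀ k, 0 < ε k := fun k => by positivity
  have hεle : ∀ k, ε k ≤ ε0 := fun k => div_le_self hε0.le (by linarith [(Nat.cast_nonneg k : (0:ℝ) ≤ k)])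
  have hεlim : Filter.Tendsto (fun k => K * ε k) Filter.atTop (𝓝 0) := by
    have : Filter.Tendsto (fun k : ℕ => K * ε0 * (1 / ((k:ℝ) + 1))) Filter.atTop (𝓝 (K * ε0 * 0)) :=
      tendsto_one_div_add_atTop_nhds_zero_nat.const_mul _
    rw [mul_zero] at this
    refine this.congr fun k => ?_
    simp only [hε]; ring
  have hρ2R : ρ2 < R := by linarith
  have hKε : ∀ k, K * ε k < min (Metric.diam Ω) (ρ2 - ρ1) := fun k =>
    lt_of_le_of_lt (mul_le_mul_of_nonneg_left (hεle k) (by linarith)) hε1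
  have hcontc : ContinuousOn u (closure Ω ∩ closedBall Q ρ2) :=
    hs.contOn.mono (inter_subset_inter_right _ (closedBall_subset_ball hρ2R))
  have hv := fun k => HA Ω hΩ.nta hF Q ρ1 ρ2 (ε k) u (hεp k) (by
      have := lt_of_lt_of_le (hKε k) (min_le_right _ _); linarith)
    (lt_of_lt_of_le (hKε k) (min_le_left _ _)) hcontc
    (hs.harmonic.mono (inter_subset_inter_right _ (ball_subset_ball hρ2R.le)))
  choose v hv1 hv2 hv3 hv4 using hv
  -- bounds
  have hcomp : IsCompact (closure Ω ∩ closedBall Q ρ2) := (isCompact_closedBall Q ρ2).inter_left isClosed_closure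
  obtain ⟨U, hU0, hU⟩ : ∃ U : ℝ, 0 ≤ U ∧ ∀ X ∈ closure Ω ∩ closedBall Q ρ2, ‖u X‖ ≤ U := by
    obtain ⟨U, hU⟩ := hcomp.exists_bound_of_continuousOn hcontc
    exact ⟨max U 0, le_max_right _ _, fun X hX => (hU X hX).trans (le_max_left _ _)⟩
  have hvU : ∀ k, ∀ X ∈ closure Ω ∩ ball Q ρ1, |v k X| ≤ U := by
    intro k X hX
    have := hv3 k X hX 0 U (fun Y hY => by
      rw [sub_zero]
      exact hU Y ⟨hY.1.1, ball_subset_closedBall hY.1.2⟩)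
    rwa [sub_zero] at this
  have hsubρ : ball Q ρ1 ⊆ ball Q ρ2 := ball_subset_ball (by linarith)
  have huU : ∀ X ∈ closure Ω ∩ ball Q ρ1, |u X| ≤ U := fun X hX => hU X ⟨hX.1, ball_subset_closedBall (hsubρ hX.2)⟩
  have hgd : Continuous (deriv g) := hg.continuous_deriv (by simp)
  obtain ⟨g1, hg1⟩ := (isCompact_Icc (a := -U) (b := U)).exists_bound_of_continuousOn hg.continuous.continuousOn
  obtain ⟨g2, hg2⟩ := (isCompact_Icc (a := -U) (b := U)).exists_bound_of_continuousOn hgd.continuousOn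
  obtain ⟨e1, he1⟩ := hζc.exists_bound_of_continuous hζ.continuous
  obtain ⟨e2, he2⟩ := (hζc.fderiv ℝ).exists_bound_of_continuous (hζ.continuous_fderiv (by simp))
  set cg := max (max g1 g2) 0 with hcg
  set ce := max (max e1 e2) 0 with hce
  have hg1' : ∀ s, |s| ≤ U → |g s| ≤ cg := fun s h => (hg1 s (abs_le.1 h)).trans ((le_max_left _ _).trans (le_max_left _ _))
  have hg2' : ∀ s, |s| ≤ U → |deriv g s| ≤ cg := fun s h => (hg2 s (abs_le.1 h)).trans ((le_max_right _ _).trans (le_max_left _ _))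
  have he1' : ∀ X, |ζ X| ≤ ce := fun X => (he1 X).trans ((le_max_left _ _).trans (le_max_left _ _))
  have he2' : ∀ X, ‖fderiv ℝ ζ X‖ ≤ ce := fun X => (he2 X).trans ((le_max_right _ _).trans (le_max_left _ _))
  have hcg0 : 0 ≤ cg := le_max_right _ _
  have hce0 : 0 ≤ ce := le_max_right _ _
  set S := Ω ∩ ball Q ρ1 with hS
  have hSo : IsOpen S := hΩ.nta.isOpen.inter isOpen_ball
  have hSm : MeasurableSet S := hSo.measurableSet
  have hSR : S ⊆ Ω ∩ ball Q R := inter_subset_inter_right _ (ball_subset_ball hρ1.le)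
  have hScl : ∀ X ∈ S, X ∈ closure Ω ∩ ball Q ρ1 := fun X hX => ⟨subset_closure hX.1, hX.2⟩
  have hud : ∀ X ∈ S, DifferentiableAt ℝ u X := fun X hX => (hs.harmonic X (hSR hX)).1.differentiableAt (by simp)
  have hζ0 : ∀ X, X ∉ ball Q ρ1 → ζ X = 0 ∧ gradient ζ X = 0 := by
    intro X hX
    have hX' : X ∉ tsupport ζ := fun h => hX (hsub h)
    refine ⟨image_eq_zero_of_notMem_tsupport hX', ?_⟩
    have h0 : fderiv ℝ ζ X = 0 := image_eq_zero_of_notMem_tsupport fun h => hX' (tsupport_fderiv_subset ℝ h)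
    unfold gradient; rw [h0]; simp
  have hw0 : ∀ w : Eu n → ℝ, ∀ X ∈ Ω \ S, wInt u w ζ g X = 0 := by
    intro w X hX
    have := hζ0 X (fun h => hX.2 ⟨hX.1, h⟩)
    unfold wInt; rw [this.1, this.2]; simp
  have hfinS : ∫⁻ X in S, ‖fderiv ℝ u X‖ₑ ^ 2 ≠ ⊤ := robin_grad_fin hs hρ1
  have hvolS : volume S ≠ ⊤ := ((measure_mono inter_subset_right).trans_lt measure_ball_lt_top).ne
  have hpf : ∫⁻ X in S, (1 + ‖fderiv ℝ u X‖ₑ ^ 2) ≠ ⊤ := by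
    rw [lintegral_add_left measurable_const]
    simp [hfinS, hvolS]
  -- measurability
  have hmeas : ∀ w : Eu n → ℝ, ContinuousOn w S → AEStronglyMeasurable (wInt u w ζ g) (volume.restrict S) := by
    intro w hw
    unfold wInt
    have m1 : AEStronglyMeasurable (fun X => g (w X)) (volume.restrict S) :=
      (hg.continuous.comp_continuousOn hw).aestronglyMeasurable hSm
    have m2 : AEStronglyMeasurable (fun X => deriv g (w X)) (volume.restrict S) :=
      (hgd.comp_continuousOn hw).aestronglyMeasurable hSm
    have m3 : ∀ f h : Eu n → ℝ, AEStronglyMeasurable (fun X => ⟪gradient f X, gradient h X⟫) (volume.restrict S) :=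
      fun f h => ((meas_grad f).inner (meas_grad h)).aestronglyMeasurable
    exact (m1.mul (m3 _ _)).add ((hζ.continuous.aestronglyMeasurable.mul m2).mul (m3 _ _))
  have hIint : IntegrableOn (wInt u u ζ g) S := by
    refine ⟨hmeas u (hs.contOn.mono fun X hX => ⟨subset_closure hX.1, ball_subset_ball hρ1.le hX.2⟩), ?_⟩
    have : ∀ X ∈ S, ‖wInt u u ζ g X‖ₑ ≤ ENNReal.ofReal (2 * (cg * ce)) * (1 + ‖fderiv ℝ u X‖ₑ ^ 2) := by
      intro X hX
      have b := wInt_bound (u := u) (v := u) (ζ := ζ) (g := g) (X := X) (hg1' _ (huU X (hScl X hX)))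
        (hg2' _ (huU X (hScl X hX))) (he1' X) (he2' X)
      rw [← ofReal_norm, ← ofReal_norm, ← ENNReal.ofReal_pow (norm_nonneg _), ← ENNReal.ofReal_one,
        ← ENNReal.ofReal_add (by positivity) (by positivity), ← ENNReal.ofReal_mul (by positivity)]
      apply ENNReal.ofReal_le_ofReal
      refine b.trans ?_
      rw [mul_comm 2, mul_assoc (cg * ce)]
      apply mul_le_mul_of_nonneg_left _ (by positivity)
      nlinarith [sq_nonneg (‖fderiv ℝ u X‖ - 1)]
    refine lt_of_le_of_lt (setLIntegral_mono' hSm this) ?_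
    rw [lintegral_const_mul' _ _ ENNReal.ofReal_ne_top]
    exact (ENNReal.mul_ne_top ENNReal.ofReal_ne_top hpf).lt_top
  -- layer convergence
  set L : ℕ → Set (Eu n) := fun k => Ω ∩ {X | dl Ω X ≤ K * ε k} with hL
  have hLm : ∀ k, MeasurableSet (L k) := fun k => hΩ.nta.isOpen.measurableSet.inter
    (isClosed_le (continuous_infDist_pt _) continuous_const).measurableSet
  have hvk : ∀ k, ∀ X ∈ S, X ∉ L k → v k =ᶠ[𝓝 X] u := by
    intro k X hX hXL
    have hd : K * ε k < dl Ω X := by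
      by_contra h
      exact hXL ⟨hX.1, not_lt.1 h⟩
    have ho : IsOpen (S ∩ {X | K * ε k < dl Ω X}) :=
      hSo.inter (isOpen_lt continuous_const (continuous_infDist_pt _))
    filter_upwards [ho.mem_nhds ⟨hX, hd⟩] with Y hY
    exact hv2 k Y hY.1 hY.2
  have hon : ∀ k, ∀ m : ℕ, ∀ X ∈ S, ‖wInt u (v k) ζ g X - wInt u u ζ g X‖ₑ ≤ ENNReal.ofReal (cg * ce) *
      ((3 + m) * (1 + ‖fderiv ℝ u X‖ₑ ^ 2) + (m + 1 : ℝ≥0∞)⁻¹ * ‖fderiv ℝ (v k) X‖ₑ ^ 2) := by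
    intro k m X hX
    have b := wInt_bound (u := u) (v := u) (ζ := ζ) (g := g) (X := X) (hg1' _ (huU X (hScl X hX)))
        (hg2' _ (huU X (hScl X hX))) (he1' X) (he2' X)
    have b2 := wInt_bound (u := u) (v := v k) (ζ := ζ) (g := g) (X := X) (hg1' _ (hvU k X (hScl X hX)))
        (hg2' _ (hvU k X (hScl X hX))) (he1' X) (he2' X)
    have em : ((m : ℝ≥0∞) + 1)⁻¹ = ENNReal.ofReal (((m:ℝ) + 1)⁻¹) := by
      rw [ENNReal.ofReal_inv_of_pos (by positivity), ENNReal.ofReal_add (by positivity) (by positivity)]; simp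
    have em3 : (3 + (m : ℝ≥0∞)) = ENNReal.ofReal (3 + (m:ℝ)) := by
      rw [ENNReal.ofReal_add (by positivity) (by positivity)]; simp
    rw [em, em3, ← ofReal_norm, ← ofReal_norm, ← ofReal_norm, ← ENNReal.ofReal_pow (norm_nonneg _),
        ← ENNReal.ofReal_pow (norm_nonneg _), ← ENNReal.ofReal_one,
        ← ENNReal.ofReal_add (by positivity) (by positivity), ← ENNReal.ofReal_mul (by positivity),
        ← ENNReal.ofReal_mul (by positivity), ← ENNReal.ofReal_add (by positivity) (by positivity),
        ← ENNReal.ofReal_mul (by positivity)]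
    apply ENNReal.ofReal_le_ofReal
    refine (norm_sub_le _ _).trans ((add_le_add b2 b).trans ?_)
    rw [← mul_add]
    apply mul_le_mul_of_nonneg_left _ (by positivity)
    set p := ‖fderiv ℝ u X‖
    set q := ‖fderiv ℝ (v k) X‖
    have hm1 : (0:ℝ) < m + 1 := by positivity
    have am : p * q ≤ (m + 1) * p ^ 2 + ((m:ℝ) + 1)⁻¹ * q ^ 2 := by
      have h0 : 0 ≤ ((m:ℝ) + 1)⁻¹ * (((m:ℝ) + 1) * p - q) ^ 2 := by positivity
      have e : ((m:ℝ) + 1)⁻¹ * (((m:ℝ) + 1) * p - q) ^ 2 = (m + 1) * p ^ 2 - 2 * (p * q) + ((m:ℝ) + 1)⁻¹ * q ^ 2 := by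
        field_simp; ring
      have : 0 ≤ p * q := mul_nonneg (norm_nonneg _) (norm_nonneg _)
      linarith
    have hm0 : (0:ℝ) ≤ m := by positivity
    nlinarith [sq_nonneg (p - 1)]
  have hconv : Filter.Tendsto (fun k => ∫⁻ X in S, ‖wInt u (v k) ζ g X - wInt u u ζ g X‖ₑ) Filter.atTop (𝓝 0) := by
    apply L1_aux (fun k => wInt u (v k) ζ g) (wInt u u ζ g) L hLm _ (fun X => ‖fderiv ℝ u X‖ₑ ^ 2)
      ((measurable_fderiv ℝ u).enorm.pow_const 2) hpf (fun k X => ‖fderiv ℝ (v k) X‖ₑ ^ 2)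
      (ENNReal.ofReal C * ∫⁻ X in Ω ∩ ball Q ρ2, ‖fderiv ℝ u X‖ₑ ^ 2) (ENNReal.ofReal (cg * ce))
      (ENNReal.mul_ne_top ENNReal.ofReal_ne_top (robin_grad_fin hs hρ2R)) ENNReal.ofReal_ne_top hv4
      (fun k => (measurable_fderiv ℝ (v k)).enorm.pow_const 2)
    · intro k
      filter_upwards [ae_restrict_mem hSm] with X hX hXL
      have h := hvk k X hX hXL
      have hgr : gradient (v k) X = gradient u X := by unfold gradient; rw [h.fderiv_eq]
      unfold wInt
      rw [hgr, h.eq_of_nhds]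
    · intro k m
      filter_upwards [ae_restrict_mem hSm] with X hX _
      exact hon k m X hX
    · intro X
      by_cases hX : X ∈ Ω
      · have := hεlim.eventually (gt_mem_nhds (dl_pos hΩ.nta.isOpen hF hX))
        filter_upwards [this] with k hk hXL
        exact absurd hXL.2 (not_le.2 hk)
      · exact Filter.Eventually.of_forall fun k h => hX h.1
  have hlim1 : Filter.Tendsto (fun k => ∫ X in S, wInt u (v k) ζ g X) Filter.atTop (𝓝 (∫ X in S, wInt u u ζ g X)) := by
    refine tendsto_integral_of_L1 _ hIint.1 ?_ hconv
    have hev : ∀ᶠ k in Filter.atTop, ∫⁻ X in S, ‖wInt u (v k) ζ g X - wInt u u ζ g X‖ₑ < 1 :=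
      hconv.eventually (gt_mem_nhds zero_lt_one)
    filter_upwards [hev] with k hk
    have hi : IntegrableOn (fun X => wInt u (v k) ζ g X - wInt u u ζ g X) S :=
      ⟨(hmeas _ (hv1 k).continuous.continuousOn).sub hIint.1, hk.trans ENNReal.one_lt_top⟩
    have := hi.add hIint
    refine this.congr (Filter.Eventually.of_forall fun X => ?_)
    simp
  -- test functions
  have htest : ∀ k, (∫ X in S, wInt u (v k) ζ g X) + a * ∫ P in frontier Ω, u P * (ζ P * g (v k P)) ∂σ = 0 := by
    intro k
    have hφ : ContDiff ℝ (⊤ : ℕ∞) (fun Y => ζ Y * g (v k Y)) := hζ.mul (hg.comp (hv1 k))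
    have h := hs.weak (fun Y => ζ Y * g (v k Y)) hφ hζc.mul_right
      ((tsupport_mul_subset_left).trans hζs)
    rw [← h]
    congr 1
    rw [← setIntegral_eq_of_subset_of_forall_diff_eq_zero hΩ.nta.isOpen.measurableSet inter_subset_left (hw0 (v k))]
    apply integral_congr_ae
    refine Filter.Eventually.of_forall fun X => ?_
    simp only [wInt]
    rw [grad_mul_comp (hζ.differentiable (by simp) X) ((hv1 k).differentiable (by simp) X)
      (hg.differentiable (by simp) _), inner_add_right, inner_smul_right, inner_smul_right]
  -- boundary
  have hFc : frontier Ω ⊆ closure Ω := frontier_subset_closure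
  haveI : IsFiniteMeasure (σ.restrict (frontier Ω)) := ⟨by
    rw [Measure.restrict_apply_univ]; exact lt_top_iff_ne_top.2 hΩ.finite⟩
  have huζ : ContinuousOn (fun P => u P * ζ P) (frontier Ω) :=
    cont_mul_cut isOpen_ball (hs.contOn.mono (inter_subset_inter_left _ hFc)) hζ.continuous hζs
  have hlim2 : Filter.Tendsto (fun k => ∫ P in frontier Ω, u P * (ζ P * g (v k P)) ∂σ) Filter.atTop
      (𝓝 (∫ P in frontier Ω, u P * (ζ P * g (u P)) ∂σ)) := by
    apply tendsto_integral_of_dominated_convergence (fun _ => U * (ce * cg))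
    · intro k
      have : (fun P => u P * (ζ P * g (v k P))) = fun P => (u P * ζ P) * g (v k P) := by ext P; ring
      rw [this]
      exact (huζ.aestronglyMeasurable isClosed_frontier.measurableSet).mul
        (hg.continuous.comp (hv1 k).continuous).aestronglyMeasurable
    · exact integrable_const _
    · intro k
      filter_upwards [ae_restrict_mem isClosed_frontier.measurableSet] with P hP
      by_cases hPb : P ∈ ball Q ρ1
      · rw [norm_mul, norm_mul]
        have h1 := huU P ⟨hFc hP, hPb⟩
        have h2 := hg1' _ (hvU k P ⟨hFc hP, hPb⟩)
        have h3 := he1' P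
        have hU0 : 0 ≤ U := (abs_nonneg _).trans h1
        rw [Real.norm_eq_abs, Real.norm_eq_abs, Real.norm_eq_abs]
        gcongr
      · rw [(hζ0 P hPb).1]
        simp only [zero_mul, mul_zero, norm_zero]
        positivity
    · filter_upwards [ae_restrict_mem isClosed_frontier.measurableSet] with P hP
      by_cases hPb : P ∈ ball Q ρ1
      · apply Filter.Tendsto.const_mul
        apply Filter.Tendsto.const_mul
        apply (hg.continuous.tendsto _).comp
        rw [Metric.tendsto_atTop]
        intro e he
        have hc : ContinuousWithinAt u (closure Ω ∩ ball Q R) P := hs.contOn P ⟨hFc hP, ball_subset_ball hρ1.le hPb⟩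
        rw [Metric.continuousWithinAt_iff] at hc
        obtain ⟨r, hr, hcr⟩ := hc (e/2) (by positivity)
        obtain ⟨N, hN⟩ := Filter.eventually_atTop.1 (hεlim.eventually (gt_mem_nhds hr))
        refine ⟨N, fun k hk => ?_⟩
        rw [Real.dist_eq]
        refine lt_of_le_of_lt (hv3 k P ⟨hFc hP, hPb⟩ (u P) (e/2) ?_) (by linarith)
        intro Y hY
        have := hcr (x := Y) ⟨hY.1.1, ball_subset_ball hρ2R.le hY.1.2⟩ ((mem_ball.1 hY.2).trans (hN k hk))
        rw [Real.dist_eq] at this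
        exact this.le
      · rw [(hζ0 P hPb).1]
        simp
  constructor
  · refine IntegrableOn.of_forall_diff_eq_zero hIint hΩ.nta.isOpen.measurableSet (hw0 u)
  · rw [setIntegral_eq_of_subset_of_forall_diff_eq_zero hΩ.nta.isOpen.measurableSet (inter_subset_left : S ⊆ Ω) (hw0 u)]
    have := hlim1.add (hlim2.const_mul a)
    simp_rw [htest] at this
    exact (tendsto_nhds_unique this tendsto_const_nhds)

end

open MeasureTheory Metric Set
open scoped RealInnerProductSpace ENNReal NNReal Topology

noncomputable section

lemma strans_deriv : ∃ L : ℝ, 0 < L ∧ ∀ t, t ≤ 1 → 0 ≤ t → |deriv Real.smoothTransition t| ≤ L := by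
  have hc : Continuous (deriv Real.smoothTransition) :=
    (Real.smoothTransition.contDiff (n := 1)).continuous_deriv le_rfl
  obtain ⟨L, hL⟩ := (isCompact_Icc (a := (0:ℝ)) (b := 1)).exists_bound_of_continuousOn hc.continuousOn
  exact ⟨max L 1, by positivity, fun t h1 h0 => (hL t ⟨h0, h1⟩).trans (le_max_left _ _)⟩

lemma cutoff (n : ℕ) : ∃ C : ℝ, 0 < C ∧ ∀ (X0 : Eu n) (ri ro : ℝ), 0 < ri → ri < ro →
    ∃ χ : Eu n → ℝ, ContDiff ℝ (⊤ : ℕ∞) χ ∧ HasCompactSupport χ ∧ tsupport χ ⊆ closedBall X0 ro ∧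
      (∀ X, 0 ≤ χ X) ∧ (∀ X, χ X ≤ 1) ∧ (∀ X ∈ ball X0 ri, χ X = 1) ∧ (∀ X, X ∉ ball X0 ro → χ X = 0) ∧
      ∀ X, ‖fderiv ℝ χ X‖ ≤ C / (ro - ri) := by
  obtain ⟨L, hL, hLb⟩ := strans_deriv
  refine ⟨2 * L, by positivity, fun X0 ri ro hri hro => ?_⟩
  have hden : 0 < ro ^ 2 - ri ^ 2 := by nlinarith
  set q : Eu n → ℝ := fun X => (ro ^ 2 - ‖X - X0‖ ^ 2) / (ro ^ 2 - ri ^ 2) with hq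
  have hqc : ContDiff ℝ (⊤ : ℕ∞) q := by
    apply ContDiff.div_const
    exact contDiff_const.sub ((contDiff_id.sub contDiff_const).norm_sq ℝ)
  set χ : Eu n → ℝ := fun X => Real.smoothTransition (q X) with hχ
  have hχc : ContDiff ℝ (⊤ : ℕ∞) χ := Real.smoothTransition.contDiff.comp hqc
  have hz : ∀ X, X ∉ ball X0 ro → χ X = 0 := by
    intro X hX
    rw [mem_ball, dist_eq_norm, not_lt] at hX
    apply Real.smoothTransition.zero_of_nonpos
    apply div_nonpos_of_nonpos_of_nonneg _ hden.le
    nlinarith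
  have hts : tsupport χ ⊆ closedBall X0 ro := by
    apply closure_minimal _ isClosed_closedBall
    intro X hX
    by_contra h
    exact hX (hz X fun h' => h (ball_subset_closedBall h'))
  have hone : ∀ X ∈ closedBall X0 ri, χ X = 1 := by
    intro X hX
    rw [mem_closedBall, dist_eq_norm] at hX
    apply Real.smoothTransition.one_of_one_le
    rw [le_div_iff₀ hden]
    nlinarith [norm_nonneg (X - X0)]
  refine ⟨χ, hχc, (isCompact_closedBall X0 ro).of_isClosed_subset (isClosed_tsupport _) hts, hts,
    fun X => Real.smoothTransition.nonneg _, fun X => Real.smoothTransition.le_one _,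
    fun X hX => hone X (ball_subset_closedBall hX), hz, fun X => ?_⟩
  have hpos : 0 ≤ 2 * L / (ro - ri) := div_nonneg (by positivity) (by linarith)
  by_cases hX : X ∈ closedBall X0 ro
  swap
  · have : χ =ᶠ[𝓝 X] 0 := notMem_tsupport_iff_eventuallyEq.1 (fun h => hX (hts h))
    rw [this.fderiv_eq]
    simpa using hpos
  by_cases hX' : X ∈ ball X0 ri
  · have : χ =ᶠ[𝓝 X] fun _ => 1 := by
      filter_upwards [isOpen_ball.mem_nhds hX'] with Y hY using hone Y (ball_subset_closedBall hY)
    rw [this.fderiv_eq]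
    simpa using hpos
  rw [mem_closedBall, dist_eq_norm] at hX
  rw [mem_ball, dist_eq_norm, not_lt] at hX'
  have hqd : HasFDerivAt q ((ro ^ 2 - ri ^ 2)⁻¹ • (-(2 • (innerSL ℝ (X - X0)) : Eu n →L[ℝ] ℝ))) X := by
    have h1 : HasFDerivAt (fun X : Eu n => ‖X - X0‖ ^ 2) (2 • (innerSL ℝ (X - X0)) : Eu n →L[ℝ] ℝ) X := by
      simpa using (hasFDerivAt_id X).sub_const X0 |>.norm_sq
    have h2 := (h1.const_sub (ro ^ 2)).const_mul ((ro ^ 2 - ri ^ 2)⁻¹)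
    have e : q = fun y => (ro ^ 2 - ri ^ 2)⁻¹ * (ro ^ 2 - ‖y - X0‖ ^ 2) := by
      ext y; simp only [hq]; rw [div_eq_inv_mul]
    rw [e]
    exact h2
  have hd : HasFDerivAt χ (deriv Real.smoothTransition (q X) • ((ro ^ 2 - ri ^ 2)⁻¹ • (-(2 • (innerSL ℝ (X - X0)) : Eu n →L[ℝ] ℝ)))) X :=
    HasDerivAt.comp_hasFDerivAt X
      ((Real.smoothTransition.contDiff (n := 1)).differentiable (by simp) (q X)).hasDerivAt hqd
  rw [hd.fderiv, norm_smul, norm_smul, norm_neg]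
  have e1 : ‖(2 • (innerSL ℝ (X - X0)) : Eu n →L[ℝ] ℝ)‖ ≤ 2 * ‖X - X0‖ := by
    rw [two_smul, two_mul]
    refine (norm_add_le _ _).trans ?_
    rw [innerSL_apply_norm]
  have e2 : ‖deriv Real.smoothTransition (q X)‖ ≤ L := by
    apply hLb
    · rw [div_le_one hden]; nlinarith
    · apply div_nonneg _ hden.le; nlinarith [norm_nonneg (X - X0)]
  rw [norm_inv, Real.norm_of_nonneg hden.le]
  calc _ ≤ L * ((ro ^ 2 - ri ^ 2)⁻¹ * (2 * ro)) := by
        gcongr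
        linarith
    _ ≤ 2 * L / (ro - ri) := by
        rw [inv_mul_eq_div, ← mul_div_assoc, div_le_div_iff₀ hden (by linarith)]
        have : 0 < L * ri * (ro - ri) := mul_pos (mul_pos hL hri) (by linarith)
        linarith

lemma grad_sq {n : ℕ} {χ : Eu n → ℝ} {X : Eu n} (h : DifferentiableAt ℝ χ X) :
    gradient (fun Y => χ Y ^ 2) X = (2 * χ X) • gradient χ X := by
  unfold gradient
  rw [fderiv_fun_pow 2 h, map_smul]
  simp

lemma cacc (n : ℕ) (hn : 1 ≤ n) : ∃ C : ℝ, 0 < C ∧ ∀ (M Cσ d cd : ℝ) (Ω : Set (Eu n)) (σ : Measure (Eu n)),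
    IsMixedPair M Cσ d cd Ω σ → (frontier Ω).Nonempty → ∀ (a : ℝ) (Q : Eu n) (R : ℝ) (u : Eu n → ℝ), 0 ≤ a →
    IsRobinLocalSolution Ω σ a Q R u → ∀ (X0 : Eu n) (ri ro : ℝ), 0 < ri → ri < ro → dist X0 Q + ro < R →
    ∀ (g F : ℝ → ℝ), ContDiff ℝ (⊤ : ℕ∞) g → Continuous F →
    (∀ X ∈ closure Ω ∩ ball X0 ro, 0 ≤ g (u X)) → (∀ X ∈ Ω ∩ ball X0 ro, 0 ≤ deriv g (u X) ∧ 0 ≤ F (u X) ∧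
      g (u X) ^ 2 ≤ deriv g (u X) * F (u X)) →
    (∫⁻ X in Ω ∩ ball X0 ri, ENNReal.ofReal (deriv g (u X) * ‖fderiv ℝ u X‖ ^ 2)) +
      ENNReal.ofReal a * (∫⁻ P in frontier Ω ∩ ball X0 ri, ENNReal.ofReal (u P * g (u P)) ∂σ)
      ≤ ENNReal.ofReal (C / (ro - ri) ^ 2) * ∫⁻ X in Ω ∩ ball X0 ro, ENNReal.ofReal (F (u X)) := by
  obtain ⟨C0, hC0, hcut⟩ := cutoff n
  refine ⟨4 * C0 ^ 2, by positivity, fun M Cσ d cd Ω σ hΩ hFr a Q R u ha hs X0 ri ro hri hro hR g F hg hF hg0 hgF => ?_⟩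
  obtain ⟨χ, hχ, hχc, hχs, hχ0, hχ1, hχi, hχo, hχd⟩ := hcut X0 ri ro hri hro
  have hw : 0 < ro - ri := by linarith
  have hsub : closedBall X0 ro ⊆ ball Q R := by
    intro Y hY
    rw [mem_closedBall] at hY
    rw [mem_ball]
    linarith [dist_triangle Y X0 Q]
  have hbsub : ball X0 ro ⊆ ball Q R := ball_subset_closedBall.trans hsub
  set ζ : Eu n → ℝ := fun Y => χ Y ^ 2 with hζ
  have hζt : tsupport ζ ⊆ tsupport χ := by
    apply closure_mono
    intro Y hY h
    apply hY
    simp only [hζ, h]; norm_num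
  have hζc : HasCompactSupport ζ := hχc.of_isClosed_subset (isClosed_tsupport _) hζt
  have hζs : tsupport ζ ⊆ ball Q R := hζt.trans (hχs.trans hsub)
  obtain ⟨hint, hweak⟩ := robin_weak hn hΩ hFr hs (hχ.pow 2) hζc hζs hg
  set S := Ω ∩ ball X0 ro with hS
  have hSm : MeasurableSet S := (hΩ.nta.isOpen.inter isOpen_ball).measurableSet
  set c := C0 / (ro - ri) with hc
  have hcp : 0 < c := by positivity
  have hcc : 4 * C0 ^ 2 / (ro - ri) ^ 2 = 2 * (2 * c ^ 2) := by rw [hc]; field_simp; ring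
  rw [hcc]
  by_cases htop : ∫⁻ X in S, ENNReal.ofReal (F (u X)) = ⊤
  · rw [htop, ENNReal.mul_top]
    · exact le_top
    · exact (ENNReal.ofReal_pos.2 (by positivity)).ne'
  have hFcont : ContinuousOn (fun X => F (u X)) S := hF.comp_continuousOn
    (hs.contOn.mono (fun X hX => ⟨subset_closure hX.1, hbsub hX.2⟩))
  have hFm : AEStronglyMeasurable (fun X => F (u X)) (volume.restrict S) :=
    hFcont.aestronglyMeasurable hSm
  have hFint : IntegrableOn (fun X => F (u X)) S := by
    refine ⟨hFm, ?_⟩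
    rw [hasFiniteIntegral_iff_ofReal]
    · exact lt_top_iff_ne_top.2 htop
    · filter_upwards [ae_restrict_mem hSm] with X hX using (hgF X hX).2.1
  have hFi : Integrable (S.indicator fun X => 2 * c ^ 2 * F (u X)) (volume.restrict Ω) := by
    rw [integrable_indicator_iff hSm]
    have : IntegrableOn (fun X => 2 * c ^ 2 * F (u X)) S := hFint.const_mul _
    rw [IntegrableOn, Measure.restrict_restrict hSm]
    rw [inter_eq_self_of_subset_left (inter_subset_left : S ⊆ Ω)]
    exact this
  -- pointwise
  have hpt : ∀ X ∈ Ω, (1 / 2) * ((ball X0 ri).indicator (fun X => deriv g (u X) * ‖fderiv ℝ u X‖ ^ 2) X) ≤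
      wInt u u ζ g X + S.indicator (fun X => 2 * c ^ 2 * F (u X)) X := by
    intro X hX
    have hgz : gradient ζ X = (2 * χ X) • gradient χ X := grad_sq (hχ.differentiable (by simp) X)
    have hww : wInt u u ζ g X = 2 * (χ X * (g (u X) * ⟪gradient u X, gradient χ X⟫)) +
        χ X ^ 2 * (deriv g (u X) * ‖fderiv ℝ u X‖ ^ 2) := by
      unfold wInt
      rw [hgz, inner_smul_right, real_inner_self_eq_norm_sq, norm_grad]
      simp only [hζ]; ring
    by_cases hXo : X ∈ ball X0 ro
    swap
    · have hXi : X ∉ ball X0 ri := fun h => hXo (ball_subset_ball hro.le h)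
      rw [indicator_of_notMem hXi, indicator_of_notMem (fun h => hXo h.2), hww, hχo X hXo]
      simp
    obtain ⟨h1, h2, h3⟩ := hgF X ⟨hX, hXo⟩
    rw [indicator_of_mem (show X ∈ S from ⟨hX, hXo⟩), hww]
    have i1 := abs_real_inner_le_norm (gradient u X) (gradient χ X)
    rw [norm_grad, norm_grad] at i1
    have i2 : |⟪gradient u X, gradient χ X⟫| ≤ ‖fderiv ℝ u X‖ * c := i1.trans (by gcongr; exact hχd X)
    have hg0' : 0 ≤ g (u X) := hg0 X ⟨subset_closure hX, hXo⟩
    set p := ‖fderiv ℝ u X‖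
    have hp : 0 ≤ p := norm_nonneg _
    have key : 0 ≤ 2 * (χ X * (g (u X) * ⟪gradient u X, gradient χ X⟫)) + (1/2) * (χ X ^ 2 * (deriv g (u X) * p ^ 2)) +
        2 * c ^ 2 * F (u X) := by
      have j1 : -(g (u X) * (p * c)) ≤ g (u X) * ⟪gradient u X, gradient χ X⟫ := by
        have := mul_le_mul_of_nonneg_left (neg_le_of_abs_le i2) hg0'
        linarith
      have j2 : -(χ X * (g (u X) * (p * c))) ≤ χ X * (g (u X) * ⟪gradient u X, gradient χ X⟫) := by
        have := mul_le_mul_of_nonneg_left j1 (hχ0 X)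
        linarith
      have j3 : g (u X) ≤ √(deriv g (u X)) * √(F (u X)) := by
        rw [← Real.sqrt_mul h1]
        exact Real.le_sqrt_of_sq_le h3
      have j4 := Real.sq_sqrt h1
      have j5 := Real.sq_sqrt h2
      have j6 : χ X * (g (u X) * (p * c)) ≤ (χ X * p * √(deriv g (u X))) * (√(F (u X)) * c) := by
        calc χ X * (g (u X) * (p * c)) ≤ χ X * ((√(deriv g (u X)) * √(F (u X))) * (p * c)) := by
              gcongr
              exact hχ0 X
          _ = _ := by ring
      have e1 : χ X ^ 2 * (deriv g (u X) * p ^ 2) = (χ X * p * √(deriv g (u X))) ^ 2 := by rw [mul_pow, mul_pow, j4]; ring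
      have e2 : c ^ 2 * F (u X) = (√(F (u X)) * c) ^ 2 := by rw [mul_pow, j5]; ring
      have e3 := sq_nonneg (χ X * p * √(deriv g (u X)) - 2 * (√(F (u X)) * c))
      rw [sub_sq, ← e1] at e3
      linarith
    have hnn : 0 ≤ χ X ^ 2 * (deriv g (u X) * p ^ 2) := by positivity
    by_cases hXi : X ∈ ball X0 ri
    · rw [indicator_of_mem hXi]
      rw [hχi X hXi] at *
      linarith
    · rw [indicator_of_notMem hXi]
      linarith
  have hpt0 : ∀ X ∈ Ω, 0 ≤ (1 / 2) * ((ball X0 ri).indicator (fun X => deriv g (u X) * ‖fderiv ℝ u X‖ ^ 2) X) := by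
    intro X hX
    apply mul_nonneg (by norm_num)
    by_cases hXi : X ∈ ball X0 ri
    · rw [indicator_of_mem hXi]
      have := (hgF X ⟨hX, ball_subset_ball hro.le hXi⟩).1
      positivity
    · rw [indicator_of_notMem hXi]
  have hΩm := hΩ.nta.isOpen.measurableSet
  have hA : ∫⁻ X in Ω, ENNReal.ofReal ((1 / 2) * ((ball X0 ri).indicator (fun X => deriv g (u X) * ‖fderiv ℝ u X‖ ^ 2) X)) ≤
      ENNReal.ofReal ((∫ X in Ω, wInt u u ζ g X) + 2 * c ^ 2 * ∫ X in S, F (u X)) := by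
    have e : (∫ X in Ω, wInt u u ζ g X) + 2 * c ^ 2 * ∫ X in S, F (u X) =
        ∫ X in Ω, (wInt u u ζ g X + S.indicator (fun X => 2 * c ^ 2 * F (u X)) X) := by
      rw [integral_add hint hFi, integral_indicator hSm, Measure.restrict_restrict hSm,
        inter_eq_self_of_subset_left (inter_subset_left : S ⊆ Ω), integral_const_mul]
    have hadd : Integrable (fun X => wInt u u ζ g X + S.indicator (fun X => 2 * c ^ 2 * F (u X)) X) (volume.restrict Ω) :=
      hint.add hFi
    rw [e, ofReal_integral_eq_lintegral_ofReal hadd]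
    · exact setLIntegral_mono_ae' hΩm (Filter.Eventually.of_forall fun X hX => ENNReal.ofReal_le_ofReal (hpt X hX))
    · filter_upwards [ae_restrict_mem hΩm] with X hX using (hpt0 X hX).trans (hpt X hX)
  -- boundary
  haveI : IsFiniteMeasure (σ.restrict (frontier Ω)) := ⟨by
    rw [Measure.restrict_apply_univ]; exact lt_top_iff_ne_top.2 hΩ.finite⟩
  have hFc : frontier Ω ⊆ closure Ω := frontier_subset_closure
  have hfm : MeasurableSet (frontier Ω) := isClosed_frontier.measurableSet
  have hbc : ContinuousOn (fun P => (u P * g (u P)) * ζ P) (frontier Ω) := by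
    have hc1 := hs.contOn.mono (inter_subset_inter_left (ball Q R) hFc)
    exact cont_mul_cut isOpen_ball (hc1.mul (hg.continuous.comp_continuousOn hc1)) (hχ.pow 2).continuous hζs
  have hbcomp : IsCompact (frontier Ω) := by
    apply Metric.isCompact_of_isClosed_isBounded isClosed_frontier (hΩ.bounded.closure.subset hFc)
  have hbi : Integrable (fun P => (u P * g (u P)) * ζ P) (σ.restrict (frontier Ω)) := by
    obtain ⟨B, hB⟩ := hbcomp.exists_bound_of_continuousOn hbc
    refine Integrable.of_bound (hbc.aestronglyMeasurable hfm) B ?_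
    filter_upwards [ae_restrict_mem hfm] with P hP using hB P hP
  have hb0 : ∀ P ∈ frontier Ω, 0 ≤ (u P * g (u P)) * ζ P := by
    intro P hP
    by_cases hPo : P ∈ ball X0 ro
    · have := hs.nonneg P ⟨hFc hP, hbsub hPo⟩
      have := hg0 P ⟨hFc hP, hPo⟩
      simp only [hζ]
      positivity
    · simp [hζ, hχo P hPo]
  have hBd : ∫⁻ P in frontier Ω ∩ ball X0 ri, ENNReal.ofReal (u P * g (u P)) ∂σ ≤
      ENNReal.ofReal (∫ P in frontier Ω, (u P * g (u P)) * ζ P ∂σ) := by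
    rw [ofReal_integral_eq_lintegral_ofReal hbi]
    · calc _ = ∫⁻ P in frontier Ω ∩ ball X0 ri, ENNReal.ofReal ((u P * g (u P)) * ζ P) ∂σ := by
            apply setLIntegral_congr_fun (hfm.inter isOpen_ball.measurableSet)
            intro P hP
            simp only [hζ]
            rw [hχi P hP.2]; simp
        _ ≤ _ := lintegral_mono_set inter_subset_left
    · filter_upwards [ae_restrict_mem hfm] with P hP using hb0 P hP
  have hwk : (∫ X in Ω, wInt u u ζ g X) = - (a * ∫ P in frontier Ω, (u P * g (u P)) * ζ P ∂σ) := by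
    have e : ∫ P in frontier Ω, u P * (ζ P * g (u P)) ∂σ = ∫ P in frontier Ω, (u P * g (u P)) * ζ P ∂σ := by
      congr 1; ext P; ring
    rw [← e]
    linarith [hweak]
  set Bt := ∫ P in frontier Ω, (u P * g (u P)) * ζ P ∂σ with hBt
  have hBt0 : 0 ≤ Bt := integral_nonneg_of_ae (by
    filter_upwards [ae_restrict_mem hfm] with P hP using hb0 P hP)
  have hIF : ENNReal.ofReal (∫ X in S, F (u X)) = ∫⁻ X in S, ENNReal.ofReal (F (u X)) := by
    apply ofReal_integral_eq_lintegral_ofReal hFint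
    filter_upwards [ae_restrict_mem hSm] with X hX using (hgF X hX).2.1
  have hLeq : ∫⁻ X in Ω, ENNReal.ofReal ((1 / 2) * ((ball X0 ri).indicator (fun X => deriv g (u X) * ‖fderiv ℝ u X‖ ^ 2) X)) =
      ENNReal.ofReal (1/2) * ∫⁻ X in Ω ∩ ball X0 ri, ENNReal.ofReal (deriv g (u X) * ‖fderiv ℝ u X‖ ^ 2) := by
    rw [← lintegral_const_mul' _ _ ENNReal.ofReal_ne_top, inter_comm, ← Measure.restrict_restrict isOpen_ball.measurableSet,
      ← lintegral_indicator isOpen_ball.measurableSet]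
    congr 1
    ext X
    by_cases hXi : X ∈ ball X0 ri
    · rw [indicator_of_mem hXi, indicator_of_mem hXi, ENNReal.ofReal_mul (by norm_num)]
    · rw [indicator_of_notMem hXi, indicator_of_notMem hXi]; simp
  rw [hLeq, hwk] at hA
  set LA := ∫⁻ X in Ω ∩ ball X0 ri, ENNReal.ofReal (deriv g (u X) * ‖fderiv ℝ u X‖ ^ 2) with hLA
  set IF := ∫ X in S, F (u X) with hIFd
  have hIF0 : 0 ≤ IF := setIntegral_nonneg hSm fun X hX => (hgF X hX).2.1
  have hle : a * Bt ≤ 2 * c ^ 2 * IF := by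
    by_contra h
    have hne : 0 ≤ ∫ X in Ω, (wInt u u ζ g X + S.indicator (fun X => 2 * c ^ 2 * F (u X)) X) :=
      setIntegral_nonneg hΩm fun X hX => (hpt0 X hX).trans (hpt X hX)
    rw [integral_add hint hFi, integral_indicator hSm, Measure.restrict_restrict hSm,
        inter_eq_self_of_subset_left (inter_subset_left : S ⊆ Ω), integral_const_mul, hwk] at hne
    linarith
  have hLA2 : LA ≤ ENNReal.ofReal (2 * (2 * c ^ 2 * IF - a * Bt)) := by
    have e : LA = ENNReal.ofReal 2 * (ENNReal.ofReal (1/2) * LA) := by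
      rw [← mul_assoc, ← ENNReal.ofReal_mul (by norm_num)]; norm_num
    rw [e, ENNReal.ofReal_mul (by norm_num)]
    gcongr
    refine hA.trans (ENNReal.ofReal_le_ofReal (by linarith))
  rw [← hIF, ← ENNReal.ofReal_mul (by positivity)]
  calc LA + ENNReal.ofReal a * _ ≤ ENNReal.ofReal (2 * (2 * c ^ 2 * IF - a * Bt)) + ENNReal.ofReal (a * Bt) := by
        rw [ENNReal.ofReal_mul ha]
        gcongr
    _ = ENNReal.ofReal (2 * (2 * c ^ 2 * IF - a * Bt) + a * Bt) := by
        rw [ENNReal.ofReal_add (by linarith) (by positivity)]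
    _ ≤ _ := by
        apply ENNReal.ofReal_le_ofReal
        have : 0 ≤ a * Bt := by positivity
        linarith

lemma robin_mono {n : ℕ} {Ω : Set (Eu n)} {σ : Measure (Eu n)} {a : ℝ} {Q z : Eu n} {R t : ℝ} {u : Eu n → ℝ}
    (hs : IsRobinLocalSolution Ω σ a Q R u) (h : dist z Q + t ≤ R) : IsRobinLocalSolution Ω σ a z t u := by
  have hb : ∀ t' ≤ t, ball z t' ⊆ ball Q (R - (t - t')) := by
    intro t' ht' Y hY
    rw [mem_ball] at *
    linarith [dist_triangle Y z Q]
  have hb0 : ball z t ⊆ ball Q R := by simpa using hb t le_rfl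
  refine ⟨fun X hX => hs.nonneg X ⟨hX.1, hb0 hX.2⟩, hs.contOn.mono (inter_subset_inter_right _ hb0),
    hs.harmonic.mono (inter_subset_inter_right _ hb0), fun ρ' hρ' => ?_, fun φ h1 h2 h3 => hs.weak φ h1 h2 (h3.trans hb0)⟩
  exact (hs.grad_L2 (R - (t - ρ')) (by linarith)).mono_set (inter_subset_inter_right _ (hb ρ' hρ'.le))

end

open MeasureTheory Metric Set
open scoped RealInnerProductSpace ENNReal NNReal Topology

noncomputable section

local notation "GG" => expNegInvGlue

lemma GG_deriv (t : ℝ) : HasDerivAt expNegInvGlue (t⁻¹ ^ 2 * GG t) t := by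
  have := expNegInvGlue.hasDerivAt_polynomial_eval_inv_mul (1 : Polynomial ℝ) t
  simpa using this

def Fn (t : ℝ) : ℝ := t ^ 2 * GG t

lemma Fn_nonneg (t : ℝ) : 0 ≤ Fn t := mul_nonneg (sq_nonneg _) (expNegInvGlue.nonneg _)
lemma Fn_zero {t : ℝ} (h : t ≤ 0) : Fn t = 0 := by unfold Fn; rw [expNegInvGlue.zero_of_nonpos h, mul_zero]
lemma Fn_contDiff : ContDiff ℝ (⊤ : ℕ∞) Fn := (contDiff_id.pow 2).mul expNegInvGlue.contDiff

lemma Fn_deriv (t : ℝ) : HasDerivAt Fn ((2 * t + 1) * GG t) t := by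
  have h := (hasDerivAt_pow 2 t).mul (GG_deriv t)
  refine h.congr_deriv ?_
  rcases eq_or_ne t 0 with rfl | ht
  · simp
  · simp; field_simp

lemma Fn_deriv2 (t : ℝ) : HasDerivAt (deriv Fn) (2 * GG t + (2 * t + 1) * (t⁻¹ ^ 2 * GG t)) t := by
  have e : deriv Fn = fun t => (2 * t + 1) * GG t := by ext t; exact (Fn_deriv t).deriv
  rw [e]
  have h := (((hasDerivAt_id t).const_mul 2).add_const 1).mul (GG_deriv t)
  refine h.congr_deriv ?_
  simp

lemma GG_mul_nonneg (t : ℝ) : 0 ≤ (2 * t + 1) * GG t := by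
  rcases le_or_gt t 0 with h | h
  · rw [expNegInvGlue.zero_of_nonpos h, mul_zero]
  · exact mul_nonneg (by linarith) (expNegInvGlue.nonneg _)

lemma Fn_deriv2_nonneg (t : ℝ) : 0 ≤ deriv (deriv Fn) t := by
  rw [(Fn_deriv2 t).deriv]
  have := GG_mul_nonneg t
  have h2 := expNegInvGlue.nonneg t
  have : 0 ≤ t⁻¹ ^ 2 * ((2 * t + 1) * GG t) := by positivity
  nlinarith

lemma Fn_mono : Monotone Fn := by
  apply monotone_of_deriv_nonneg (Fn_contDiff.differentiable (by simp))
  intro t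
  rw [(Fn_deriv t).deriv]
  exact GG_mul_nonneg t

lemma GG_le_one (t : ℝ) : GG t ≤ 1 := by
  unfold expNegInvGlue
  split_ifs with h
  · norm_num
  · apply Real.exp_le_one_iff.2
    have : 0 < t := by linarith
    simp; positivity

lemma Fn_le_one {t : ℝ} (h : t ≤ 1) : Fn t ≤ 1 := by
  refine (Fn_mono h).trans ?_
  unfold Fn
  simpa using GG_le_one 1

lemma Fn_eq {t : ℝ} (h : 0 < t) : Fn t = t ^ 2 * Real.exp (- t⁻¹) := by
  unfold Fn expNegInvGlue
  rw [if_neg (by linarith)]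

/-- Laplacian of a composition -/
lemma lap_comp {n : ℕ} {u : Eu n → ℝ} {φ : ℝ → ℝ} {X : Eu n} (hφ : ContDiff ℝ 2 φ) (hu : ContDiffAt ℝ 2 u X)
    (h2 : 0 ≤ deriv (deriv φ) (u X)) (h1 : 0 ≤ deriv φ (u X)) (hl : 0 ≤ lap u X) :
    0 ≤ lap (fun Y => φ (u Y)) X := by
  rw [lap_eq] at hl ⊢
  have hev : ∀ᶠ Y in 𝓝 X, DifferentiableAt ℝ u Y := by
    filter_upwards [hu.eventually (by simp)] with Y hY using hY.differentiableAt (by simp)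
  have hφd : Differentiable ℝ φ := hφ.differentiable (by simp)
  have hφd2 : Differentiable ℝ (deriv φ) := by
    have : ContDiff ℝ 1 (deriv φ) := (contDiff_succ_iff_deriv.1 (show ContDiff ℝ (1 + 1) φ from by norm_num; exact hφ)).2.2
    exact this.differentiable (by simp)
  have hfd : fderiv ℝ (fun Y => φ (u Y)) =ᶠ[𝓝 X] fun Y => deriv φ (u Y) • fderiv ℝ u Y := by
    filter_upwards [hev] with Y hY
    exact ((hφd _).hasDerivAt.comp_hasFDerivAt Y hY.hasFDerivAt).fderiv
  have hud : DifferentiableAt ℝ u X := hu.differentiableAt (by simp)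
  have hud2 : DifferentiableAt ℝ (fderiv ℝ u) X := (hu.fderiv_right (m := 1) (by norm_num)).differentiableAt (by simp)
  have hd2 : fderiv ℝ (fderiv ℝ (fun Y => φ (u Y))) X = deriv φ (u X) • fderiv ℝ (fderiv ℝ u) X +
      (deriv (deriv φ) (u X) • fderiv ℝ u X).smulRight (fderiv ℝ u X) := by
    rw [hfd.fderiv_eq]
    have hc : HasFDerivAt (fun Y => deriv φ (u Y)) (deriv (deriv φ) (u X) • fderiv ℝ u X) X :=
      (hφd2 _).hasDerivAt.comp_hasFDerivAt X hud.hasFDerivAt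
    exact (hc.smul hud2.hasFDerivAt).fderiv
  rw [hd2]
  simp only [ContinuousLinearMap.add_apply, ContinuousLinearMap.smul_apply, ContinuousLinearMap.smulRight_apply,
    smul_eq_mul, Finset.sum_add_distrib, ← Finset.mul_sum]
  apply add_nonneg (mul_nonneg h1 hl)
  apply Finset.sum_nonneg
  intro i _
  have := mul_nonneg h2 (sq_nonneg ((fderiv ℝ u X) (EuclideanSpace.single i 1)))
  nlinarith

lemma Fn_sub {n : ℕ} {u : Eu n → ℝ} {X : Eu n} {P H : ℝ} (hH : 0 < H) (hu : ContDiffAt ℝ 2 u X) (hl : lap u X = 0) :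
    ContDiffAt ℝ 2 (fun Y => Fn ((u Y - P) / H)) X ∧ 0 ≤ lap (fun Y => Fn ((u Y - P) / H)) X := by
  set φ : ℝ → ℝ := fun s => Fn ((s - P) / H) with hφd
  have hφ : ContDiff ℝ (⊤ : ℕ∞) φ := Fn_contDiff.comp ((contDiff_id.sub contDiff_const).div_const _)
  have hφ2 : ContDiff ℝ 2 φ := hφ.of_le (WithTop.coe_le_coe.2 (le_top : (2:ℕ∞) ≤ ⊤))
  have ha : ∀ s, HasDerivAt (fun s => (s - P) / H) (1 / H) s := fun s => ((hasDerivAt_id s).sub_const P).div_const H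
  have hd : deriv φ = fun s => deriv Fn ((s - P) / H) * (1 / H) := by
    ext s
    exact (((Fn_deriv _).differentiableAt.hasDerivAt).comp s (ha s)).deriv
  refine ⟨hφ2.contDiffAt.comp X hu, ?_⟩
  apply lap_comp hφ2 hu _ _ hl.ge
  · rw [hd]
    have := ((((Fn_deriv2 ((u X - P)/H)).differentiableAt.hasDerivAt).comp (u X) (ha (u X))).mul_const (1/H)).deriv
    simp only [Function.comp_def] at this
    rw [this]
    have := Fn_deriv2_nonneg ((u X - P)/H)
    positivity
  · rw [hd]
    have : 0 ≤ deriv Fn ((u X - P)/H) := by rw [(Fn_deriv _).deriv]; exact GG_mul_nonneg _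
    positivity

lemma meas_ball {n : ℕ} (Ω : Set (Eu n)) (hΩ : MeasurableSet Ω) (ρ : ℝ) (h : Eu n → ℝ≥0∞) (hh : Measurable h) :
    Measurable fun y => ∫⁻ X in Ω ∩ ball y ρ, h X := by
  have hm : Measurable (Function.uncurry fun (y X : Eu n) => (Ω ∩ ball y ρ).indicator h X) := by
    have : (Function.uncurry fun (y X : Eu n) => (Ω ∩ ball y ρ).indicator h X) =
        ({p : Eu n × Eu n | dist p.2 p.1 < ρ} ∩ Prod.snd ⁻¹' Ω).indicator (fun p => h p.2) := by
      ext ⟨y, X⟩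
      simp only [indicator, Function.uncurry]
      congr 1
      simp [and_comm]
    rw [this]
    apply (hh.comp measurable_snd).indicator
    exact (isOpen_lt (by fun_prop) continuous_const).measurableSet.inter (measurable_snd hΩ)
  have e : (fun y => ∫⁻ X in Ω ∩ ball y ρ, h X) = fun y => ∫⁻ X, (Ω ∩ ball y ρ).indicator h X := by
    ext y
    rw [lintegral_indicator (hΩ.inter measurableSet_ball)]
  rw [e]
  exact hm.lintegral_prod_right'

lemma poinc (n : ℕ) (M : ℝ) (hM : 1 < M) : ∃ C K : ℝ, 0 < C ∧ 1 ≤ K ∧ ∀ (Ω : Set (Eu n)), IsOneSidedNTA M Ω →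
    (frontier Ω).Nonempty → ∀ (X0 : Eu n) (ρ s : ℝ), 0 < s → K * s < Metric.diam Ω → ∀ f : Eu n → ℝ,
    (∀ y ∈ Ω ∩ ball X0 (ρ + K * s), ContDiffAt ℝ 1 f y) →
    (∀ y ∈ Ω ∩ ball X0 (ρ + K * s), s ≤ dl Ω y → f y = 0) →
    ∫⁻ X in Ω ∩ ball X0 ρ, ENNReal.ofReal (f X) ≤ ENNReal.ofReal (C * s) * gm f (Ω ∩ ball X0 (ρ + K * s)) := by
  obtain ⟨C0, K0, κ, hC0, hK0, hκ, hκ2, HP⟩ := potential n M hM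
  obtain ⟨ω, hω⟩ : ∃ ω : ℝ≥0, volume (ball (0 : Eu n) 1) = ω := ⟨_, (ENNReal.coe_toNNReal measure_ball_lt_top.ne).symm⟩
  refine ⟨C0 * (K0 ^ n * (ω + 1)) * 4, 2 * K0 + 4 * M + 1, by positivity, by linarith, fun Ω hΩ hF X0 ρ s hs hd f hf hf0 => ?_⟩
  set K := 2 * K0 + 4 * M + 1 with hK
  set τ := 2 * s with hτ
  have hτp : 0 < τ := by positivity
  have hKτ : K0 * τ ≤ K * s := by rw [hK, hτ]; nlinarith
  set T := Ω ∩ ball X0 (ρ + K * s) with hT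
  have hΩm := hΩ.isOpen.measurableSet
  have hTm : MeasurableSet T := hΩm.inter measurableSet_ball
  have hSm : MeasurableSet (Ω ∩ ball X0 ρ) := hΩm.inter measurableSet_ball
  have hpt : ∀ X ∈ Ω ∩ ball X0 ρ, ENNReal.ofReal (f X) ≤ ENNReal.ofReal C0 * ∑' j : ℕ,
      ENNReal.ofReal (τ / 2 ^ j / (τ / 2 ^ j) ^ n) * gm f (Ω ∩ ball X (K0 * (τ / 2 ^ j))) := by
    intro X hX
    have hXT : ∀ t ≤ K * s, ball X t ⊆ ball X0 (ρ + K * s) := by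
      intro t ht Y hY
      have := hX.2
      rw [mem_ball] at *
      linarith [dist_triangle Y X X0]
    have hXm : X ∈ T := ⟨hX.1, hXT (K * s) le_rfl (mem_ball_self (by positivity))⟩
    obtain ⟨A, hA, hA1, hA2, hA3⟩ := HP Ω hΩ hF X (subset_closure hX.1) τ hτp (by linarith) f
      (fun y hy => hf y ⟨hy.1, hXT _ hKτ hy.2⟩) (hf X hXm).continuousAt.continuousWithinAt
    have hav : avg f A (κ * τ) = 0 := by
      rw [avg_congr (g := fun _ => 0)]
      · simp [avg]
      · intro y hy
        have hyb : A + (κ * τ) • y ∈ ball A (s + s / 2) :=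
          mem_ball_smul (by positivity) (by rw [hτ]; nlinarith) (by simpa using (mem_ball.1 hy).le)
        have hyc : dist (A + (κ * τ) • y) A ≤ s := by
          rw [dist_eq_norm, add_sub_cancel_left, norm_smul, Real.norm_of_nonneg (by positivity)]
          have : ‖y‖ ≤ 1 := by simpa using (mem_ball.1 hy).le
          calc κ * τ * ‖y‖ ≤ κ * τ * 1 := by gcongr
            _ ≤ s := by rw [hτ]; nlinarith
        apply hf0
        · refine ⟨ballSub hΩ.isOpen hA (mem_ball.2 (by rw [hτ] at hA1; linarith)), hXT (4 * M * s + s + s) ?_ ?_⟩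
          · rw [hK]; nlinarith
          · rw [mem_ball]
            have := dist_triangle (A + (κ * τ) • y) A X
            rw [hτ] at hA2 this
            linarith
        · have := dl_lip Ω A (A + (κ * τ) • y)
          rw [dist_comm] at hyc
          linarith
    rw [hav, sub_zero] at hA3
    exact (ENNReal.ofReal_le_ofReal (le_abs_self _)).trans hA3
  have hgm : Measurable fun X => ‖fderiv ℝ f X‖ₑ := (measurable_fderiv ℝ f).enorm
  have hj : ∀ j : ℕ, ∫⁻ X in Ω ∩ ball X0 ρ, ENNReal.ofReal (τ / 2 ^ j / (τ / 2 ^ j) ^ n) * gm f (Ω ∩ ball X (K0 * (τ / 2 ^ j)))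
      ≤ ENNReal.ofReal (K0 ^ n * (ω + 1) * τ) * gm f T * (2⁻¹ : ℝ≥0∞) ^ j := by
    intro j
    have hτj : 0 < τ / 2 ^ j := by positivity
    have hτj1 : τ / 2 ^ j ≤ τ := div_le_self hτp.le (one_le_pow₀ (by norm_num))
    rw [lintegral_const_mul' _ _ ENNReal.ofReal_ne_top]
    have ht := tonelli_ball volume (Ω ∩ ball X0 ρ) T Ω hSm hΩm hTm (K0 * (τ / 2 ^ j)) (fun X => ‖fderiv ℝ f X‖ₑ) hgm
      (ENNReal.ofReal ((K0 * (τ / 2 ^ j)) ^ n) * ω) (by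
        intro y hy Z hZ
        refine ⟨hZ.1, ?_⟩
        have h1 := hy.2
        have h2 := hZ.2
        rw [mem_ball] at *
        have : K0 * (τ / 2 ^ j) ≤ K0 * τ := by gcongr
        linarith [dist_triangle Z y X0]) (by
        intro X _
        refine (measure_mono inter_subset_left).trans ?_
        rw [vol_ball X (by positivity), hω])
    calc _ ≤ ENNReal.ofReal (τ / 2 ^ j / (τ / 2 ^ j) ^ n) * (ENNReal.ofReal ((K0 * (τ / 2 ^ j)) ^ n) * ω * gm f T) := by
          gcongr
          exact ht
      _ = ENNReal.ofReal (K0 ^ n * ω * (τ / 2 ^ j)) * gm f T := by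
          have eω : (ω : ℝ≥0∞) = ENNReal.ofReal (ω : ℝ) := by simp
          rw [← mul_assoc, ← mul_assoc, eω, ← ENNReal.ofReal_mul (by positivity), ← ENNReal.ofReal_mul (by positivity)]
          congr 2
          have : (τ / 2 ^ j) ^ n ≠ 0 := by positivity
          rw [mul_pow, div_mul_eq_mul_div, ← mul_assoc (τ / 2 ^ j), mul_div_assoc, div_self this]
          ring
      _ ≤ _ := by
          have e : (2⁻¹ : ℝ≥0∞) ^ j = ENNReal.ofReal ((2⁻¹ : ℝ) ^ j) := by
            rw [ENNReal.ofReal_pow (by positivity), ENNReal.ofReal_inv_of_pos (by norm_num)]; simp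
          rw [e, mul_right_comm (ENNReal.ofReal _) (gm f T), ← ENNReal.ofReal_mul (by positivity)]
          refine mul_le_mul' (ENNReal.ofReal_le_ofReal ?_) le_rfl
          rw [inv_pow, mul_assoc (K0 ^ n * ((ω:ℝ) + 1)), ← div_eq_mul_inv]
          gcongr
          linarith
  calc _ ≤ ∫⁻ X in Ω ∩ ball X0 ρ, ENNReal.ofReal C0 * ∑' j : ℕ,
      ENNReal.ofReal (τ / 2 ^ j / (τ / 2 ^ j) ^ n) * gm f (Ω ∩ ball X (K0 * (τ / 2 ^ j))) := setLIntegral_mono' hSm hpt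
    _ = ENNReal.ofReal C0 * ∑' j : ℕ, ∫⁻ X in Ω ∩ ball X0 ρ, 
      ENNReal.ofReal (τ / 2 ^ j / (τ / 2 ^ j) ^ n) * gm f (Ω ∩ ball X (K0 * (τ / 2 ^ j))) := by
        rw [lintegral_const_mul' _ _ ENNReal.ofReal_ne_top, lintegral_tsum]
        intro j
        exact ((meas_ball Ω hΩm _ _ hgm).const_mul _).aemeasurable
    _ ≤ ENNReal.ofReal C0 * ∑' j : ℕ, ENNReal.ofReal (K0 ^ n * (ω + 1) * τ) * gm f T * (2⁻¹ : ℝ≥0∞) ^ j := by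
        gcongr with j
        exact hj j
    _ = _ := by
        rw [ENNReal.tsum_mul_left, ENNReal.tsum_geometric_two]
        have : (2:ℝ≥0∞) = ENNReal.ofReal 2 := by simp
        rw [this, mul_right_comm, ← ENNReal.ofReal_mul (by positivity), ← mul_assoc, ← ENNReal.ofReal_mul (by positivity)]
        congr 2
        rw [hτ]; ring

end

open MeasureTheory Metric Set
open scoped RealInnerProductSpace ENNReal NNReal Topology

noncomputable section

local notation "GG" => expNegInvGlue

lemma robin_lap {n : ℕ} {Ω : Set (Eu n)} {σ : Measure (Eu n)} {a : ℝ} {Q : Eu n} {R : ℝ} {u : Eu n → ℝ}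
    (hs : IsRobinLocalSolution Ω σ a Q R u) {X : Eu n} (hX : X ∈ Ω ∩ ball Q R) : ContDiffAt ℝ 2 u X ∧ lap u X = 0 :=
  hs.harmonic X hX

lemma dg_grad (n : ℕ) (hn : 1 ≤ n) : ∃ C : ℝ, 0 < C ∧ ∀ (M Cσ d cd : ℝ) (Ω : Set (Eu n)) (σ : Measure (Eu n)),
    IsMixedPair M Cσ d cd Ω σ → (frontier Ω).Nonempty → ∀ (a : ℝ) (Q : Eu n) (R : ℝ) (u : Eu n → ℝ), 0 ≤ a →
    IsRobinLocalSolution Ω σ a Q R u → ∀ (X0 : Eu n) (ri ro : ℝ), 0 < ri → ri < ro → dist X0 Q + ro < R →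
    ∀ (P H : ℝ), 0 < H → (∀ X ∈ Ω ∩ ball X0 ro, u X ≤ P + H) →
    gm (fun X => Fn ((u X - P) / H)) (Ω ∩ ball X0 ri)
      ≤ ENNReal.ofReal (C / (ro - ri)) * ∫⁻ X in Ω ∩ ball X0 ro, ENNReal.ofReal (Fn ((u X - P) / H)) := by
  obtain ⟨C, hC, hcac⟩ := cacc n hn
  refine ⟨(3 / 2) * (C + 1), by positivity, fun M Cσ d cd Ω σ hΩ hFr a Q R u ha hs X0 ri ro hri hro hR P H hH hPH => ?_⟩
  set w := ro - ri with hw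
  have hwp : 0 < w := by linarith
  set g : ℝ → ℝ := fun s => GG ((s - P) / H) with hg
  have hgc : ContDiff ℝ (⊤ : ℕ∞) g := expNegInvGlue.contDiff.comp ((contDiff_id.sub contDiff_const).div_const _)
  have hd : ∀ s, HasDerivAt (fun s => (s - P) / H) (1 / H) s := fun s => ((hasDerivAt_id s).sub_const P).div_const H
  have hgd : ∀ s, deriv g s = ((s - P) / H)⁻¹ ^ 2 * GG ((s - P) / H) * (1 / H) := fun s =>
    ((GG_deriv _).comp s (hd s)).deriv
  have hbsub : ball X0 ro ⊆ ball Q R := by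
    intro Y hY
    rw [mem_ball] at *
    linarith [dist_triangle Y X0 Q]
  have hFcont : Continuous fun s => H * Fn ((s - P) / H) :=
    continuous_const.mul (Fn_contDiff.continuous.comp ((continuous_id.sub continuous_const).div_const _))
  have hc := hcac M Cσ d cd Ω σ hΩ hFr a Q R u ha hs X0 ri ro hri hro hR g (fun s => H * Fn ((s - P) / H)) hgc hFcont
    (fun X _ => expNegInvGlue.nonneg _) (by
      intro X hX
      have h0 := expNegInvGlue.nonneg ((u X - P) / H)
      refine ⟨?_, mul_nonneg hH.le (Fn_nonneg _), ?_⟩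
      · rw [hgd]; positivity
      · rw [hgd]
        simp only [hg, Fn]
        rcases eq_or_ne ((u X - P) / H) 0 with h | h
        · rw [h]; simp
        · apply le_of_eq
          generalize (u X - P) / H = t at *
          field_simp)
  have hc2 := (le_add_right le_rfl).trans hc
  set I := ∫⁻ X in Ω ∩ ball X0 ro, ENNReal.ofReal (Fn ((u X - P) / H)) with hI
  have hFI : ∫⁻ X in Ω ∩ ball X0 ro, ENNReal.ofReal (H * Fn ((u X - P) / H)) = ENNReal.ofReal H * I := by
    simp_rw [ENNReal.ofReal_mul hH.le]
    rw [lintegral_const_mul' _ _ ENNReal.ofReal_ne_top]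
  rw [hFI] at hc2
  have hSm : MeasurableSet (Ω ∩ ball X0 ri) := (hΩ.nta.isOpen.inter isOpen_ball).measurableSet
  have hpt : ∀ X ∈ Ω ∩ ball X0 ri, ‖fderiv ℝ (fun X => Fn ((u X - P) / H)) X‖ₑ ≤
      ENNReal.ofReal ((3/2) * w / H) * ENNReal.ofReal (deriv g (u X) * ‖fderiv ℝ u X‖ ^ 2) +
      ENNReal.ofReal ((3/2) / w) * ENNReal.ofReal (Fn ((u X - P) / H)) := by
    intro X hX
    have hXo : X ∈ Ω ∩ ball X0 ro := ⟨hX.1, ball_subset_ball hro.le hX.2⟩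
    have hud : DifferentiableAt ℝ u X := (robin_lap hs ⟨hX.1, hbsub hXo.2⟩).1.differentiableAt (by simp)
    have hfd : fderiv ℝ (fun X => Fn ((u X - P) / H)) X =
        ((2 * ((u X - P) / H) + 1) * GG ((u X - P) / H) * (1 / H)) • fderiv ℝ u X :=
      (((Fn_deriv _).comp (u X) (hd (u X))).comp_hasFDerivAt X hud.hasFDerivAt).fderiv
    have ht1 : (u X - P) / H ≤ 1 := by rw [div_le_one hH]; linarith [hPH X hXo]
    have h0 := expNegInvGlue.nonneg ((u X - P) / H)
    have hgd0 : 0 ≤ deriv g (u X) := by rw [hgd]; positivity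
    rw [← ENNReal.ofReal_mul (by positivity), ← ENNReal.ofReal_mul (by positivity),
      ← ENNReal.ofReal_add (by positivity) (mul_nonneg (by positivity) (Fn_nonneg _)), ← ofReal_norm]
    apply ENNReal.ofReal_le_ofReal
    rw [hfd, norm_smul, hgd]
    unfold Fn
    set t := (u X - P) / H
    set p := ‖fderiv ℝ u X‖
    have hp : 0 ≤ p := norm_nonneg _
    rcases le_or_gt t 0 with h | h
    · rw [expNegInvGlue.zero_of_nonpos h]; simp
    · rw [Real.norm_of_nonneg (by positivity)]
      have key : p / H ≤ (1/2) * (w * (t⁻¹ * p / H) ^ 2 + t ^ 2 / w) := by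
        have e : p / H = (t⁻¹ * p / H) * t := by field_simp
        have h3 : 0 ≤ (w * (t⁻¹ * p / H) - t) ^ 2 / w := by positivity
        have e3 : (w * (t⁻¹ * p / H) - t) ^ 2 / w = w * (t⁻¹ * p / H) ^ 2 - 2 * ((t⁻¹ * p / H) * t) + t ^ 2 / w := by
          field_simp; ring
        rw [e]; linarith
      calc (2 * t + 1) * GG t * (1 / H) * p = (2 * t + 1) * (GG t * (p / H)) := by ring
        _ ≤ 3 * (GG t * (p / H)) := by gcongr; linarith
        _ ≤ 3 * (GG t * ((1/2) * (w * (t⁻¹ * p / H) ^ 2 + t ^ 2 / w))) := by gcongr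
        _ = _ := by field_simp
  have hm : AEMeasurable (fun X => ENNReal.ofReal ((3/2) / w) * ENNReal.ofReal (Fn ((u X - P) / H))) (volume.restrict (Ω ∩ ball X0 ri)) := by
    apply AEMeasurable.const_mul
    apply ENNReal.measurable_ofReal.comp_aemeasurable
    apply (ContinuousOn.aemeasurable _ hSm)
    apply Fn_contDiff.continuous.comp_continuousOn
    apply ContinuousOn.div_const
    apply ContinuousOn.sub _ continuousOn_const
    exact hs.contOn.mono fun X hX => ⟨subset_closure hX.1, hbsub (ball_subset_ball hro.le hX.2)⟩
  unfold gm
  calc _ ≤ _ := setLIntegral_mono' hSm hpt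
    _ = ENNReal.ofReal ((3/2) * w / H) * (∫⁻ X in Ω ∩ ball X0 ri, ENNReal.ofReal (deriv g (u X) * ‖fderiv ℝ u X‖ ^ 2)) +
      ENNReal.ofReal ((3/2) / w) * ∫⁻ X in Ω ∩ ball X0 ri, ENNReal.ofReal (Fn ((u X - P) / H)) := by
        rw [lintegral_add_right' _ hm, lintegral_const_mul' _ _ ENNReal.ofReal_ne_top,
          lintegral_const_mul' _ _ ENNReal.ofReal_ne_top]
    _ ≤ ENNReal.ofReal ((3/2) * w / H) * (ENNReal.ofReal (C / w ^ 2) * (ENNReal.ofReal H * I)) +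
      ENNReal.ofReal ((3/2) / w) * I := by
        gcongr
        exact lintegral_mono_set (inter_subset_inter_right _ (ball_subset_ball hro.le))
    _ = _ := by
        rw [← mul_assoc, ← mul_assoc, ← ENNReal.ofReal_mul (by positivity), ← ENNReal.ofReal_mul (by positivity), ← add_mul,
          ← ENNReal.ofReal_add (by positivity) (by positivity)]
        congr 2
        field_simp

lemma dg_iter (n : ℕ) (hn : 1 ≤ n) (M : ℝ) (hM : 1 < M) : ∃ K : ℝ, 1 ≤ K ∧ ∀ (Cσ d cd : ℝ) (Ω : Set (Eu n)) (σ : Measure (Eu n)),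
    IsMixedPair M Cσ d cd Ω σ → (frontier Ω).Nonempty → ∀ (a : ℝ) (Q : Eu n) (R : ℝ) (u : Eu n → ℝ), 0 ≤ a →
    IsRobinLocalSolution Ω σ a Q R u → ∀ (X0 : Eu n) (D s : ℝ), 0 < s → K * s < Metric.diam Ω → dist X0 Q + D < R →
    ∀ (P H : ℝ), 0 < H → (∀ X ∈ Ω ∩ ball X0 D, u X ≤ P + H) → (∀ X ∈ Ω ∩ ball X0 D, s ≤ dl Ω X → u X ≤ P) →
    ∀ (J : ℕ) (ρ : ℝ), 0 < ρ → ρ + J * (K * s) ≤ D → 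
    ∫⁻ X in Ω ∩ ball X0 ρ, ENNReal.ofReal (Fn ((u X - P) / H)) ≤ (2⁻¹ : ℝ≥0∞) ^ J * volume (ball X0 D) := by
  obtain ⟨C1, hC1, hgrad⟩ := dg_grad n hn
  obtain ⟨C2, K2, hC2, hK2, hpo⟩ := poinc n M hM
  refine ⟨K2 + 2 * C1 * C2, by nlinarith [mul_pos hC1 hC2], fun Cσ d cd Ω σ hΩ hFr a Q R u ha hs X0 D s hsp hKs hR P H hH hPH hP J => ?_⟩
  set K := K2 + 2 * C1 * C2 with hK
  have hKK : K2 < K := by nlinarith [mul_pos hC1 hC2]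
  have hbsub : ball X0 D ⊆ ball Q R := by
    intro Y hY
    rw [mem_ball] at *
    linarith [dist_triangle Y X0 Q]
  have hΩm := hΩ.nta.isOpen.measurableSet
  induction J with
  | zero =>
    intro ρ hρ hρD
    simp only [Nat.cast_zero, zero_mul, add_zero] at hρD
    rw [pow_zero, one_mul]
    calc _ ≤ ∫⁻ X in Ω ∩ ball X0 ρ, 1 := by
          apply setLIntegral_mono' (hΩm.inter measurableSet_ball)
          intro X hX
          rw [← ENNReal.ofReal_one]
          apply ENNReal.ofReal_le_ofReal
          apply Fn_le_one
          rw [div_le_one hH]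
          linarith [hPH X ⟨hX.1, ball_subset_ball hρD hX.2⟩]
      _ ≤ _ := by
          rw [lintegral_one, Measure.restrict_apply_univ]
          exact measure_mono (inter_subset_right.trans (ball_subset_ball hρD))
  | succ J ih =>
    intro ρ hρ hρD
    push_cast at hρD
    have hKs0 : K2 * s < K * s := by gcongr
    have hJ0 : 0 ≤ (J:ℝ) * (K * s) := by positivity
    have hb : ball X0 (ρ + K * s) ⊆ ball X0 D := ball_subset_ball (by linarith)
    have h2 : ball X0 (ρ + K2 * s) ⊆ ball X0 D := (ball_subset_ball (by linarith)).trans hb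
    have s1 := hpo Ω hΩ.nta hFr X0 ρ s hsp (by linarith) (fun X => Fn ((u X - P) / H))
      (fun y hy => (Fn_sub hH (robin_lap hs ⟨hy.1, hbsub (h2 hy.2)⟩).1 (robin_lap hs ⟨hy.1, hbsub (h2 hy.2)⟩).2).1.of_le (by norm_num))
      (fun y hy hys => Fn_zero (div_nonpos_of_nonpos_of_nonneg (by linarith [hP y ⟨hy.1, h2 hy.2⟩ hys]) hH.le))
    have s2 := hgrad M Cσ d cd Ω σ hΩ hFr a Q R u ha hs X0 (ρ + K2 * s) (ρ + K * s) (by positivity) (by linarith)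
      (by linarith) P H hH (fun X hX => hPH X ⟨hX.1, hb hX.2⟩)
    have s3 := ih (ρ + K * s) (by positivity) (by linarith)
    have e : ENNReal.ofReal (C2 * s) * ENNReal.ofReal (C1 / (ρ + K * s - (ρ + K2 * s))) = 2⁻¹ := by
      rw [← ENNReal.ofReal_mul (by positivity)]
      have : C2 * s * (C1 / (ρ + K * s - (ρ + K2 * s))) = 2⁻¹ := by
        have : ρ + K * s - (ρ + K2 * s) = 2 * C1 * C2 * s := by rw [hK]; ring
        rw [this]; field_simp
      rw [this, ENNReal.ofReal_inv_of_pos (by norm_num)]; simp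
    calc _ ≤ _ := s1
      _ ≤ ENNReal.ofReal (C2 * s) * (ENNReal.ofReal (C1 / (ρ + K * s - (ρ + K2 * s))) * ((2⁻¹ : ℝ≥0∞) ^ J * volume (ball X0 D))) := by
          gcongr
          refine s2.trans ?_
          gcongr
      _ = _ := by rw [← mul_assoc, e, pow_succ']; ring

lemma avg_le_lint (n : ℕ) : ∃ C : ℝ, 0 < C ∧ ∀ (f : Eu n → ℝ) (A : Eu n) (t ρ : ℝ), 0 < t → t < ρ → ContinuousOn f (ball A ρ) →
    (∀ y, 0 ≤ f y) → ENNReal.ofReal (avg f A t) ≤ ENNReal.ofReal (C / t ^ n) * ∫⁻ y in ball A t, ENNReal.ofReal (f y) := by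
  obtain ⟨C, hC, hk⟩ := kern_bdd n
  refine ⟨C, hC, fun f A t ρ ht htρ hf hf0 => ?_⟩
  have hi : Integrable (fun y => kern n y * f (A + t • y)) := avg_integrable ht.le htρ hf
  have hi2 := avg_integrable' ht htρ hf
  rw [avg_eq f A ht, ENNReal.ofReal_mul (by positivity), ofReal_integral_eq_lintegral_ofReal hi2
    (Filter.Eventually.of_forall fun y => mul_nonneg (kern_nonneg _ _) (hf0 _))]
  calc _ ≤ ENNReal.ofReal (t ^ n)⁻¹ * ∫⁻ y, (ball A t).indicator (fun y => ENNReal.ofReal C * ENNReal.ofReal (f y)) y := by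
        gcongr with y
        by_cases hy : y ∈ ball A t
        · rw [indicator_of_mem hy, ← ENNReal.ofReal_mul hC.le]
          apply ENNReal.ofReal_le_ofReal
          gcongr
          · exact hf0 y
          · exact hk _
        · rw [kern_zero]
          · simp
          · rw [mem_ball, dist_eq_norm, not_lt] at hy
            rw [norm_smul, norm_inv, Real.norm_of_nonneg ht.le, inv_mul_eq_div, one_le_div ht]
            exact hy
    _ = _ := by
        rw [lintegral_indicator measurableSet_ball, lintegral_const_mul' _ _ ENNReal.ofReal_ne_top, ← mul_assoc,
          ← ENNReal.ofReal_mul (by positivity)]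
        congr 2
        field_simp

end

open MeasureTheory Metric Set
open scoped RealInnerProductSpace ENNReal NNReal Topology

noncomputable section

lemma half_pow_le {K x : ℝ} (hK : 1 ≤ K) (hx : 1 ≤ x) : ((2:ℝ)⁻¹) ^ ⌊(x - 1) / K⌋₊ ≤ 4 * Real.exp (-(Real.log 2 / K * x)) := by
  have h1 : x / K - 2 ≤ (⌊(x - 1) / K⌋₊ : ℝ) := by
    have := Nat.lt_floor_add_one ((x - 1) / K)
    have h2 : (1:ℝ) / K ≤ 1 := by rw [div_le_one (by linarith)]; exact hK
    rw [sub_div] at this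
    rw [sub_div]
    linarith
  have e : ((2:ℝ)⁻¹) ^ ⌊(x - 1) / K⌋₊ = Real.exp (-(Real.log 2 * (⌊(x - 1) / K⌋₊ : ℝ))) := by
    rw [inv_pow, Real.exp_neg, mul_comm, Real.exp_nat_mul, Real.exp_log (by norm_num)]
  have e4 : (4:ℝ) = Real.exp (Real.log 2 * 2) := by
    rw [mul_comm, show (2:ℝ) * Real.log 2 = ((2:ℕ):ℝ) * Real.log 2 by norm_num, Real.exp_nat_mul, Real.exp_log (by norm_num)]; norm_num
  rw [e, e4, ← Real.exp_add]
  apply Real.exp_le_exp.mpr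
  have hl : 0 < Real.log 2 := Real.log_pos (by norm_num)
  have := mul_le_mul_of_nonneg_left h1 hl.le
  have e5 : Real.log 2 * (x / K - 2) = Real.log 2 / K * x - Real.log 2 * 2 := by ring
  linarith

lemma dg_step (n : ℕ) (hn : 1 ≤ n) (M : ℝ) (hM : 1 < M) : ∃ C c K : ℝ, 0 < C ∧ 0 < c ∧ 1 ≤ K ∧
    ∀ (Cσ d cd : ℝ) (Ω : Set (Eu n)) (σ : Measure (Eu n)),
    IsMixedPair M Cσ d cd Ω σ → (frontier Ω).Nonempty → ∀ (a : ℝ) (Q : Eu n) (R : ℝ) (u : Eu n → ℝ), 0 ≤ a →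
    IsRobinLocalSolution Ω σ a Q R u → ∀ (X0 : Eu n) (D s w : ℝ), 0 < s → s ≤ w → w < D → K * s < Metric.diam Ω →
    dist X0 Q + D < R →
    ∀ (P H : ℝ), 0 < H → (∀ X ∈ Ω ∩ ball X0 D, u X ≤ P + H) → (∀ X ∈ Ω ∩ ball X0 D, s ≤ dl Ω X → u X ≤ P) →
    ∀ Y ∈ Ω ∩ ball X0 (D - w), s / 4 ≤ dl Ω Y → Fn ((u Y - P) / H) ≤ C * (D / s) ^ n * Real.exp (-(c * (w / s))) := by
  obtain ⟨K, hK, hit⟩ := dg_iter n hn M hM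
  obtain ⟨C1, hC1, hav⟩ := avg_le_lint n
  set V := (volume (ball (0 : Eu n) 1)).toReal with hV
  have hVe : volume (ball (0 : Eu n) 1) = ENNReal.ofReal V := (ENNReal.ofReal_toReal measure_ball_lt_top.ne).symm
  have hV0 : 0 ≤ V := ENNReal.toReal_nonneg
  refine ⟨C1 * 8 ^ n * 4 * (V + 1), Real.log 2 / K, K, by positivity, div_pos (Real.log_pos (by norm_num)) (by linarith), hK, ?_⟩
  intro Cσ d cd Ω σ hΩ hFr a Q R u ha hs X0 D s w hsp hsw hwD hKs hR P H hH hPH hP Y hY hYs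
  have hD : 0 < D := by linarith
  have hK0 : 0 < K := by linarith
  have hbsub : ball X0 D ⊆ ball Q R := by
    intro Y hY
    rw [mem_ball] at *
    linarith [dist_triangle Y X0 Q]
  have hYb : ball Y (s / 4) ⊆ Ω ∩ ball X0 (D - w + s) := by
    intro Z hZ
    refine ⟨ballSub hΩ.nta.isOpen hY.1 (ball_subset_ball hYs hZ), ?_⟩
    have := hY.2
    rw [mem_ball] at *
    linarith [dist_triangle Z Y X0]
  have hYb2 : ∀ Z ∈ ball Y (s / 4), Z ∈ Ω ∩ ball Q R := fun Z hZ =>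
    ⟨(hYb hZ).1, hbsub (ball_subset_ball (by linarith) (hYb hZ).2)⟩
  have hsubf : ∀ Z ∈ ball Y (s / 4), _ := fun Z hZ => Fn_sub (P := P) hH (robin_lap hs (hYb2 Z hZ)).1 (robin_lap hs (hYb2 Z hZ)).2
  have h1 := submvp (t := s / 8) (by positivity) (by linarith) (fun Z hZ => (hsubf Z hZ).1) (fun Z hZ => (hsubf Z hZ).2)
  have h2 := hav (fun Y => Fn ((u Y - P) / H)) Y (s / 8) (s / 4) (by positivity) (by linarith)
    (fun Z hZ => (hsubf Z hZ).1.continuousAt.continuousWithinAt) (fun y => Fn_nonneg _)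
  set J := ⌊(w / s - 1) / K⌋₊ with hJ
  have hws : 1 ≤ w / s := by rw [one_le_div hsp]; exact hsw
  have hJle : (J:ℝ) * (K * s) ≤ w - s := by
    have : (J:ℝ) ≤ (w / s - 1) / K := Nat.floor_le (div_nonneg (by linarith) hK0.le)
    rw [le_div_iff₀ hK0] at this
    have h4 := mul_le_mul_of_nonneg_right this hsp.le
    have e : (w / s - 1) * s = w - s := by field_simp
    nlinarith
  have h3 := hit Cσ d cd Ω σ hΩ hFr a Q R u ha hs X0 D s hsp hKs hR P H hH hPH hP J (D - w + s) (by linarith) (by linarith)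
  have h5 := half_pow_le hK hws
  rw [← hJ] at h5
  have e2 : (2⁻¹ : ℝ≥0∞) = ENNReal.ofReal (2⁻¹) := by
    rw [ENNReal.ofReal_inv_of_pos (by norm_num)]; simp
  rw [vol_ball _ hD, e2, ← ENNReal.ofReal_pow (by norm_num), hVe, ← ENNReal.ofReal_mul (by positivity),
    ← ENNReal.ofReal_mul (by positivity)] at h3
  have h6 : ENNReal.ofReal (Fn ((u Y - P) / H)) ≤ ENNReal.ofReal (C1 / (s / 8) ^ n * ((2⁻¹) ^ J * (D ^ n * V))) := by
    rw [ENNReal.ofReal_mul (by positivity)]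
    refine (ENNReal.ofReal_le_ofReal h1).trans (h2.trans ?_)
    gcongr
    refine le_trans (lintegral_mono_set ?_) h3
    exact (ball_subset_ball (by linarith)).trans hYb
  rw [ENNReal.ofReal_le_ofReal_iff (by positivity)] at h6
  calc _ ≤ _ := h6
    _ ≤ C1 / (s / 8) ^ n * ((4 * Real.exp (-(Real.log 2 / K * (w / s)))) * (D ^ n * (V + 1))) := by gcongr; linarith
    _ = _ := by rw [div_pow, div_pow]; field_simp

lemma exp_small (c δ : ℝ) (m : ℕ) (hc : 0 < c) (hδ : 0 < δ) : ∃ X1 : ℝ, 1 ≤ X1 ∧ ∀ x, X1 ≤ x → x ^ m * Real.exp (-(c * x)) < δ := by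
  have h := (Real.tendsto_pow_mul_exp_neg_atTop_nhds_zero m).eventually (gt_mem_nhds (show (0:ℝ) < c ^ m * δ by positivity))
  obtain ⟨Y, hY⟩ := Filter.eventually_atTop.1 h
  refine ⟨max 1 (Y / c), le_max_left _ _, fun x hx => ?_⟩
  have := hY (c * x) (by rw [mul_comm]; exact (div_le_iff₀ hc).1 ((le_max_right _ _).trans hx))
  rw [mul_pow, mul_assoc] at this
  exact lt_of_mul_lt_mul_left this (by positivity)

set_option maxHeartbeats 1000000 in
lemma dg (n : ℕ) (hn : 1 ≤ n) (M : ℝ) (hM : 1 < M) (ϑ : ℝ) (hϑ : 0 < ϑ) (hϑ1 : ϑ ≤ 1) : ∃ ε : ℝ, 0 < ε ∧ ε ≤ 1 / 4 ∧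
    ∀ (Cσ d cd : ℝ) (Ω : Set (Eu n)) (σ : Measure (Eu n)),
    IsMixedPair M Cσ d cd Ω σ → (frontier Ω).Nonempty → ∀ (a : ℝ) (Q : Eu n) (R : ℝ) (u : Eu n → ℝ), 0 ≤ a →
    IsRobinLocalSolution Ω σ a Q R u → ∀ (X0 : Eu n) (D : ℝ), 0 < D → D < Metric.diam Ω → dist X0 Q + D < R →
    ∀ (P H : ℝ), 0 < H → (∀ X ∈ Ω ∩ ball X0 D, u X ≤ P + H) → (∀ X ∈ Ω ∩ ball X0 D, ε * D ≤ dl Ω X → u X ≤ P) →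
    ∀ X ∈ closure Ω ∩ ball X0 (D / 2), u X ≤ P + ϑ * H := by
  obtain ⟨C, c, K, hC, hc, hK, hst⟩ := dg_step n hn M hM
  obtain ⟨X1, hX1, hsm⟩ := exp_small (c / 8) (ϑ ^ 2 / (4 * C)) (2 * n + 2) (by positivity) (by positivity)
  set ε := min (min (1 / 4) (1 / K)) (min (c * ϑ / 16) (1 / X1)) with hε
  have hX1p : 0 < X1 := by linarith
  have hKp : 0 < K := by linarith
  have hε0 : 0 < ε := by positivity
  have he1 : ε ≤ 1 / 4 := (min_le_left _ _).trans (min_le_left _ _)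
  have he2 : ε ≤ 1 / K := (min_le_left _ _).trans (min_le_right _ _)
  have he3 : ε ≤ c * ϑ / 16 := (min_le_right _ _).trans (min_le_left _ _)
  have he4 : ε ≤ 1 / X1 := (min_le_right _ _).trans (min_le_right _ _)
  refine ⟨ε, hε0, he1, ?_⟩
  intro Cσ d cd Ω σ hΩ hFr a Q R u ha hs X0 D hD hDd hR P H hH hPH hP
  have main : ∀ k : ℕ, ∀ Y ∈ Ω ∩ ball X0 (D * (1 / 2 + (1 / 2) ^ k / 2)), ε * D / 4 ^ k ≤ dl Ω Y →
      u Y ≤ P + ϑ * H * (1 - (1 / 2) ^ k) := by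
    intro k
    induction k with
    | zero =>
      intro Y hY hYs
      simp only [pow_zero, div_one, sub_self, mul_zero, add_zero] at *
      exact hP Y (by convert hY using 3; ring) hYs
    | succ k ih =>
      intro Y hY hYs
      by_contra hcon
      push Not at hcon
      set p : ℝ := (1 / 2) ^ k with hp
      have hp0 : 0 < p := by positivity
      have hp1 : p ≤ 1 := pow_le_one₀ (by norm_num) (by norm_num)
      have e4 : (4:ℝ) ^ k = (p ^ 2)⁻¹ := by
        rw [hp, ← pow_mul, mul_comm, pow_mul, ← inv_pow]; norm_num
      have hpk : (1 / 2 : ℝ) ^ (k + 1) = p / 2 := by rw [pow_succ]; ring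
      rw [hpk] at hY hcon
      have hDk : ball X0 (D * (1 / 2 + p / 2)) ⊆ ball X0 D := ball_subset_ball (by have := mul_le_mul_of_nonneg_left hp1 hD.le; linarith)
      have hDp : 0 < D * p := by positivity
      have hDp1 : D * p ≤ D * 1 := by gcongr
      have hs4 : ε * D / 4 ^ k = ε * D * p ^ 2 := by rw [e4]; field_simp
      rw [hs4] at ih
      have hs5 : ε * D / 4 ^ (k + 1) = ε * D * p ^ 2 / 4 := by rw [pow_succ, e4]; field_simp
      rw [hs5] at hYs
      have hkD : K * (ε * D * p ^ 2) < Metric.diam Ω := by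
        have : K * ε ≤ 1 := by rw [le_div_iff₀ hKp] at he2; linarith
        have h2 : p ^ 2 ≤ 1 := pow_le_one₀ hp0.le hp1
        have h3 : (K * ε) * (D * p ^ 2) ≤ 1 * (D * 1) := by gcongr
        linarith
      have key := hst Cσ d cd Ω σ hΩ hFr a Q R u ha hs X0 (D * (1 / 2 + p / 2)) (ε * D * p ^ 2) (D * p / 4) (by positivity)
        (by
          have h2 : p ^ 2 ≤ p := pow_le_of_le_one hp0.le hp1 (by norm_num)
          have : ε * (D * p ^ 2) ≤ 1 / 4 * (D * p) := by gcongr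
          linarith) (by linarith) hkD (by linarith) (P + ϑ * H * (1 - p)) H hH
        (fun X hX => by
          have := hPH X ⟨hX.1, hDk hX.2⟩
          have : 0 ≤ ϑ * H * (1 - p) := mul_nonneg (by positivity) (by linarith)
          linarith)
        ih Y ⟨hY.1, by convert hY.2 using 2; ring⟩ hYs
      set x : ℝ := 1 / (ε * p) with hx
      have hxp : 0 < x := by positivity
      have hxX : X1 ≤ x := by
        rw [hx, le_div_iff₀ (by positivity)]
        rw [le_div_iff₀ hX1p] at he4
        have : X1 * (ε * p) ≤ X1 * (ε * 1) := by gcongr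
        linarith
      have hxs := hsm x hxX
      have hD' : D * (1 / 2 + p / 2) / (ε * D * p ^ 2) ≤ x ^ 2 := by
        rw [hx, div_pow, div_le_div_iff₀ (by positivity) (by positivity)]
        have : ε ^ 2 ≤ ε := pow_le_of_le_one hε0.le (by linarith) (by norm_num)
        have h2 : (1 / 2 + p / 2) * ε ^ 2 ≤ 1 * ε := by gcongr; linarith
        have := mul_le_mul_of_nonneg_right h2 (show 0 ≤ D * p ^ 2 by positivity)
        linarith
      have hw : D * p / 4 / (ε * D * p ^ 2) = x / 4 := by rw [hx]; field_simp
      rw [hw] at key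
      have hτ : ϑ * (p / 2) ≤ (u Y - (P + ϑ * H * (1 - p))) / H := by
        rw [le_div_iff₀ hH]; linarith
      have k2 := (Fn_mono hτ).trans key
      rw [Fn_eq (by positivity)] at k2
      have hτx : ϑ / (2 * x) ≤ ϑ * (p / 2) := by
        rw [hx]
        have : ϑ / (2 * (1 / (ε * p))) = ϑ * (p / 2) * ε := by field_simp
        rw [this]
        exact mul_le_of_le_one_right (by positivity) (by linarith)
      have hτi : (ϑ * (p / 2))⁻¹ ≤ c / 8 * x := by
        rw [hx, inv_le_iff_one_le_mul₀ (by positivity)]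
        have : c / 8 * (1 / (ε * p)) * (ϑ * (p / 2)) = c * ϑ / 16 / ε := by field_simp; ring
        rw [this, one_le_div hε0]; exact he3
      have k3 : (ϑ / (2 * x)) ^ 2 * Real.exp (-(c / 8 * x)) ≤ C * (x ^ 2) ^ n * Real.exp (-(c * (x / 4))) := by
        refine le_trans ?_ (k2.trans ?_)
        · gcongr
        · gcongr
      have e1 : Real.exp (-(c * (x / 4))) = Real.exp (-(c / 8 * x)) * Real.exp (-(c / 8 * x)) := by
        rw [← Real.exp_add]; congr 1; ring
      rw [e1, ← mul_assoc] at k3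
      have k4 := le_of_mul_le_mul_right k3 (Real.exp_pos _)
      rw [lt_div_iff₀ (by positivity)] at hxs
      rw [div_pow, div_le_iff₀ (by positivity)] at k4
      have e5 : x ^ (2 * n + 2) = (x ^ 2) ^ n * x ^ 2 := by rw [← pow_mul, pow_add]
      rw [e5] at hxs
      linarith
  have hint : ∀ Y ∈ Ω ∩ ball X0 (D / 2), u Y ≤ P + ϑ * H := by
    intro Y hY
    have hd := dl_pos hΩ.nta.isOpen hFr hY.1
    obtain ⟨k, hk⟩ := exists_pow_lt_of_lt_one (show 0 < dl Ω Y / (ε * D) by positivity) (show (1 / 4 : ℝ) < 1 by norm_num)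
    rw [lt_div_iff₀ (by positivity)] at hk
    have hp0 : (0:ℝ) < (1 / 2) ^ k := by positivity
    have := main k Y ⟨hY.1, ball_subset_ball (by have := mul_pos hD hp0; linarith) hY.2⟩ (by
      rw [div_pow, one_pow] at hk
      calc _ = 1 / 4 ^ k * (ε * D) := by ring
        _ ≤ _ := hk.le)
    have h3 : ϑ * H * (1 - (1 / 2) ^ k) ≤ ϑ * H * 1 := by gcongr; linarith
    linarith
  intro X hX
  have hbsub : ball X0 (D / 2) ⊆ ball Q R := by
    intro Y hY
    rw [mem_ball] at *
    linarith [dist_triangle Y X0 Q]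
  have hXc : X ∈ closure (Ω ∩ ball X0 (D / 2)) := by
    rw [inter_comm]
    exact isOpen_ball.inter_closure ⟨hX.2, hX.1⟩
  refine ContinuousWithinAt.closure_le hXc ?_ continuousWithinAt_const hint
  exact (hs.contOn X ⟨hX.1, hbsub hX.2⟩).mono fun Z hZ => ⟨subset_closure hZ.1, hbsub hZ.2⟩

end

open MeasureTheory Metric Set
open scoped RealInnerProductSpace ENNReal NNReal Topology

noncomputable section

lemma carleson (n : ℕ) (hn : 1 ≤ n) (M : ℝ) (hM : 1 < M) : ∃ (C K : ℝ) (γ : ℕ), 1 ≤ C ∧ 1 ≤ K ∧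
    ∀ (Cσ d cd : ℝ) (Ω : Set (Eu n)) (σ : Measure (Eu n)),
    IsMixedPair M Cσ d cd Ω σ → (frontier Ω).Nonempty → ∀ (a : ℝ) (Q : Eu n) (R : ℝ) (u : Eu n → ℝ), 0 ≤ a →
    IsRobinLocalSolution Ω σ a Q R u → ∀ (X ξ : Eu n) (L r : ℝ), X ∈ closure Ω → ξ ∈ Ω → 0 < r → r ≤ L →
    dist X ξ ≤ L → r / 2 ≤ dl Ω ξ → K * L < Metric.diam Ω → dist ξ Q + K * L ≤ R →
    u X ≤ C * (L / r) ^ γ * u ξ := by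
  obtain ⟨C, K, γ, hC, hK, hγ, hlad⟩ := ladder n M hM
  obtain ⟨ε, hε, hε4, hdg⟩ := dg n hn M hM ((1 / 2) ^ (γ + 1)) (by positivity) (pow_le_one₀ (by norm_num) (by norm_num))
  refine ⟨2 * C * (4 / ε) ^ γ, 2 * K + 4, γ, ?_, by linarith, ?_⟩
  · have : 1 ≤ (4 / ε) ^ γ := one_le_pow₀ (by rw [one_le_div hε]; linarith)
    have := mul_le_mul hC this (by norm_num) (by linarith)
    linarith
  intro Cσ d cd Ω σ hΩ hFr a Q R u ha hs X ξ L r hX hξ hr hrL hXξ hrξ hKL hR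
  have hL : 0 < L := by linarith
  have hKL0 : L ≤ K * L := le_mul_of_one_le_left hL.le hK
  have hball : ∀ Y, dist Y ξ ≤ 3 * L → Y ∈ ball Q R := by
    intro Y hY
    rw [mem_ball]
    linarith [dist_triangle Y ξ Q]
  have hu0 : 0 ≤ u ξ := hs.nonneg ξ ⟨subset_closure hξ, hball ξ (by rw [dist_self]; linarith)⟩
  set S := closure Ω ∩ closedBall X r with hS
  have hSc : IsCompact S := (isCompact_closedBall X r).inter_left isClosed_closure
  have hSb : ∀ Y ∈ S, Y ∈ closure Ω ∩ ball Q R := fun Y hY => ⟨hY.1, hball Y (by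
    have := mem_closedBall.1 hY.2
    linarith [dist_triangle Y X ξ])⟩
  have hfc : ContinuousOn (fun Y => u Y * (r - dist Y X) ^ γ) S :=
    (hs.contOn.mono hSb).mul (by fun_prop)
  obtain ⟨X0, hX0, hmax⟩ := hSc.exists_isMaxOn ⟨X, hX, mem_closedBall_self hr.le⟩ hfc
  have hmax' : ∀ Y ∈ S, u Y * (r - dist Y X) ^ γ ≤ u X0 * (r - dist X0 X) ^ γ := fun Y hY => hmax hY
  set D := r - dist X0 X with hD
  have h1 := hmax' X ⟨hX, mem_closedBall_self hr.le⟩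
  rw [dist_self, sub_zero] at h1
  have hX0r := mem_closedBall.1 hX0.2
  have hD0 : 0 ≤ D := by linarith
  have hDr : D ≤ r := by have := dist_nonneg (x := X0) (y := X); linarith
  have hX00 := hs.nonneg X0 (hSb X0 hX0)
  have hrpos : (0:ℝ) < r ^ γ := by positivity
  have hrhs : 0 ≤ 2 * C * (4 / ε) ^ γ * (L / r) ^ γ * u ξ := by positivity
  rcases (mul_nonneg hX00 (pow_nonneg hD0 γ)).eq_or_lt with h0 | h0
  · rw [← h0] at h1
    exact (nonpos_of_mul_nonpos_left h1 hrpos).trans hrhs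
  have hDp : 0 < D := by
    rcases hD0.eq_or_lt with h | h
    · rw [← h, zero_pow (by omega), mul_zero] at h0
      exact absurd h0 (lt_irrefl _)
    · exact h
  have hup : 0 < u X0 := pos_of_mul_pos_left h0 (pow_nonneg hD0 γ)
  set P := C * (2 * L / (ε * (D / 2))) ^ γ * u ξ with hP
  have hX0ξ : dist X0 ξ ≤ r + L := by linarith [dist_triangle X0 X ξ]
  have key := hdg Cσ d cd Ω σ hΩ hFr a Q R u ha hs X0 (D / 2) (by linarith) (by linarith)
    (by linarith [dist_triangle X0 ξ Q]) P (2 ^ γ * u X0) (by positivity) (by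
      intro Y hY
      have hYX0 := mem_ball.1 hY.2
      have hYX := dist_triangle Y X0 X
      have h2 := hmax' Y ⟨subset_closure hY.1, mem_closedBall.2 (by linarith)⟩
      have hDY : D / 2 ≤ r - dist Y X := by linarith
      have hY0 := hs.nonneg Y (hSb Y ⟨subset_closure hY.1, mem_closedBall.2 (by linarith)⟩)
      have h3 : u Y * (D / 2) ^ γ ≤ u X0 * D ^ γ := le_trans (by gcongr) h2
      have h4 : u Y ≤ 2 ^ γ * u X0 := by
        rw [div_pow, ← mul_div_assoc, div_le_iff₀ (by positivity)] at h3
        have : u Y * D ^ γ ≤ (2 ^ γ * u X0) * D ^ γ := by linarith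
        exact le_of_mul_le_mul_right this (by positivity)
      have : 0 ≤ P := by positivity
      linarith) (by
      intro Y hY hYd
      have hYX0 := mem_ball.1 hY.2
      have hεD : ε * (D / 2) ≤ 1 / 4 * (D / 2) := by gcongr
      refine hlad Ω hΩ.nta hFr Y hY.1 ξ hξ (2 * L) (ε * (D / 2)) (by positivity) (by linarith) hYd (by linarith)
        (by linarith [dist_triangle Y X0 ξ, dist_triangle X0 X ξ]) (by linarith) u ?_ ?_
      · refine hs.harmonic.mono fun Z hZ => ⟨hZ.1, ?_⟩
        have := mem_ball.1 hZ.2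
        rw [mem_ball]; linarith [dist_triangle Z ξ Q]
      · intro Z hZ
        refine hs.nonneg Z ⟨subset_closure hZ.1, ?_⟩
        have := mem_ball.1 hZ.2
        rw [mem_ball]; linarith [dist_triangle Z ξ Q]) X0 ⟨hX0.1, mem_ball_self (by linarith)⟩
  have e1 : (1 / 2 : ℝ) ^ (γ + 1) * (2 ^ γ * u X0) = u X0 / 2 := by
    rw [pow_succ, one_div, inv_pow]; field_simp
  rw [e1] at key
  have h5 : u X * r ^ γ ≤ 2 * P * D ^ γ := h1.trans (by gcongr; linarith)
  have e2 : 2 * P * D ^ γ = 2 * C * (4 / ε) ^ γ * (L / r) ^ γ * u ξ * r ^ γ := by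
    have e3 : (2 * L / (ε * (D / 2))) ^ γ * D ^ γ = (4 / ε) ^ γ * (L / r) ^ γ * r ^ γ := by
      rw [← mul_pow, ← mul_pow, ← mul_pow]; congr 1; field_simp; ring
    calc _ = 2 * C * u ξ * ((2 * L / (ε * (D / 2))) ^ γ * D ^ γ) := by rw [hP]; ring
      _ = _ := by rw [e3]; ring
  rw [e2] at h5
  exact le_of_mul_le_mul_right h5 hrpos

end

open MeasureTheory Metric Set
open scoped RealInnerProductSpace ENNReal NNReal Topology

noncomputable section

lemma fin_sig {n : ℕ} {M Cσ d cd : ℝ} {Ω : Set (Eu n)} {σ : Measure (Eu n)} (h : IsMixedPair M Cσ d cd Ω σ) :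
    IsFiniteMeasure σ := ⟨by
  have := measure_union_le (μ := σ) (frontier Ω) (frontier Ω)ᶜ
  rw [union_compl_self, h.null_outside, add_zero] at this
  exact this.trans_lt h.finite.lt_top⟩

lemma energy (n : ℕ) (hn : 1 ≤ n) : ∃ C : ℝ, 0 < C ∧ ∀ (M Cσ d cd : ℝ) (Ω : Set (Eu n)) (σ : Measure (Eu n)),
    IsMixedPair M Cσ d cd Ω σ → (frontier Ω).Nonempty → ∀ (a : ℝ) (Q : Eu n) (R : ℝ) (u : Eu n → ℝ), 0 ≤ a →
    IsRobinLocalSolution Ω σ a Q R u → ∀ (z : Eu n) (t S : ℝ), 0 < t → dist z Q + t ≤ R →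
    (∀ X ∈ Ω ∩ ball z t, u X ≤ S) →
    (∫⁻ X in Ω ∩ ball z (t / 2), ‖fderiv ℝ u X‖ₑ ^ 2) +
      ENNReal.ofReal a * (∫⁻ P in frontier Ω ∩ ball z (t / 2), ENNReal.ofReal (u P ^ 2) ∂σ)
      ≤ ENNReal.ofReal (C * (t ^ n / t ^ 2) * S ^ 2) := by
  obtain ⟨C, hC, hcac⟩ := cacc n hn
  set V := (volume (ball (0 : Eu n) 1)).toReal with hV
  have hVe : volume (ball (0 : Eu n) 1) = ENNReal.ofReal V := (ENNReal.ofReal_toReal measure_ball_lt_top.ne).symm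
  have hV0 : 0 ≤ V := ENNReal.toReal_nonneg
  refine ⟨16 * C * (V + 1), by positivity, fun M Cσ d cd Ω σ hΩ hFr a Q R u ha hs z t S ht hR hS => ?_⟩
  have hbs : ball z (3 * t / 4) ⊆ ball Q R := by
    intro Y hY
    rw [mem_ball] at *
    linarith [dist_triangle Y z Q]
  have h := hcac M Cσ d cd Ω σ hΩ hFr a Q R u ha hs z (t / 2) (3 * t / 4) (by linarith) (by linarith) (by linarith)
    (fun s => s) (fun s => s ^ 2) contDiff_id (by fun_prop)
    (fun X hX => hs.nonneg X ⟨hX.1, hbs hX.2⟩) (fun X _ => by simp [sq_nonneg])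
  have e1 : ∀ X, ENNReal.ofReal (deriv (fun s : ℝ => s) (u X) * ‖fderiv ℝ u X‖ ^ 2) = ‖fderiv ℝ u X‖ₑ ^ 2 := by
    intro X
    rw [deriv_id'', one_mul, ENNReal.ofReal_pow (norm_nonneg _), ofReal_norm]
  simp only [e1, ← pow_two] at h
  refine h.trans ?_
  calc _ ≤ ENNReal.ofReal (C / (3 * t / 4 - t / 2) ^ 2) * ∫⁻ X in Ω ∩ ball z (3 * t / 4), ENNReal.ofReal (S ^ 2) := by
        refine mul_le_mul' le_rfl ?_
        apply setLIntegral_mono' (hΩ.nta.isOpen.inter isOpen_ball).measurableSet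
        intro X hX
        apply ENNReal.ofReal_le_ofReal
        have := hs.nonneg X ⟨subset_closure hX.1, hbs hX.2⟩
        have := hS X ⟨hX.1, ball_subset_ball (by linarith) hX.2⟩
        gcongr
    _ ≤ ENNReal.ofReal (C / (3 * t / 4 - t / 2) ^ 2) * (ENNReal.ofReal (S ^ 2) * (ENNReal.ofReal (t ^ n) * ENNReal.ofReal V)) := by
        rw [setLIntegral_const, ← hVe, ← vol_ball z ht]
        gcongr
        exact inter_subset_right.trans (ball_subset_ball (by linarith))
    _ ≤ _ := by
        rw [← ENNReal.ofReal_mul (by positivity), ← ENNReal.ofReal_mul (by positivity), ← ENNReal.ofReal_mul (by positivity)]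
        apply ENNReal.ofReal_le_ofReal
        have e : C / (3 * t / 4 - t / 2) ^ 2 * (S ^ 2 * (t ^ n * V)) = 16 * C * (t ^ n / t ^ 2) * S ^ 2 * V := by
          rw [show 3 * t / 4 - t / 2 = t / 4 by ring]; field_simp; ring
        rw [e]
        have : 0 ≤ 16 * C * (t ^ n / t ^ 2) * S ^ 2 := by positivity
        linarith

lemma sig_small {n : ℕ} {M Cσ d cd : ℝ} {Ω : Set (Eu n)} {σ : Measure (Eu n)} (h : IsMixedPair M Cσ d cd Ω σ)
    {z : Eu n} {t ρ : ℝ} (ht : 0 < t) (htd : t < Metric.diam Ω) (hρ : 0 < ρ) (hρt : 8 * ρ < t) (X : Eu n) :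
    σ (ball X ρ ∩ (frontier Ω ∩ ball z (t / 4))) ≤ ENNReal.ofReal (cd⁻¹ * (8 * ρ / t) ^ d * (σ (ball z t)).toReal) := by
  haveI := fin_sig h
  rcases (ball X ρ ∩ (frontier Ω ∩ ball z (t / 4))).eq_empty_or_nonempty with he | ⟨y, hy1, hy2, hy3⟩
  · rw [he]; simp
  have h1 := h.lower_dim y hy2 (t / 4) (2 * ρ) (by positivity) (by linarith) (by linarith)
  have h2 : (σ (ball y (t / 4))).toReal ≤ (σ (ball z t)).toReal := by
    apply ENNReal.toReal_mono (measure_ne_top _ _) (measure_mono _)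
    intro Y hY
    rw [mem_ball] at *
    linarith [dist_triangle Y y z]
  have h3 : σ (ball X ρ ∩ (frontier Ω ∩ ball z (t / 4))) ≤ σ (ball y (2 * ρ)) := by
    apply measure_mono
    intro Y hY
    have := mem_ball.1 hY.1
    rw [mem_ball] at *
    linarith [dist_triangle Y X y, dist_comm X y]
  refine h3.trans ?_
  rw [← ENNReal.ofReal_toReal (measure_ne_top σ (ball y (2 * ρ)))]
  apply ENNReal.ofReal_le_ofReal
  have e : (8 * ρ / t) ^ d = ((t / 4 / (2 * ρ)) ^ d)⁻¹ := by
    rw [← Real.inv_rpow (by positivity)]; congr 1; field_simp; norm_num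
  rw [e]
  have hp : 0 < (t / 4 / (2 * ρ)) ^ d := by positivity
  have hc := h.cd_pos
  rw [← mul_inv, inv_mul_eq_div, le_div_iff₀ (by positivity)]
  linarith

lemma amgm_gm {n : ℕ} (u : Eu n → ℝ) (S : Set (Eu n)) {τ l : ℝ} (hτ : 0 < τ) (hl : 0 < l) :
    ENNReal.ofReal (τ / τ ^ n) * gm u S ≤ ENNReal.ofReal (l / τ ^ n) * volume S +
      ENNReal.ofReal (τ ^ 2 / τ ^ n / l) * ∫⁻ X in S, ‖fderiv ℝ u X‖ₑ ^ 2 := by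
  unfold gm
  rw [← lintegral_const_mul' _ _ ENNReal.ofReal_ne_top, ← lintegral_const_mul' _ _ ENNReal.ofReal_ne_top, ← setLIntegral_const,
    ← lintegral_add_left measurable_const]
  apply lintegral_mono
  intro X
  simp only
  rw [← ofReal_norm, ← ENNReal.ofReal_pow (norm_nonneg _), ← ENNReal.ofReal_mul (by positivity), ← ENNReal.ofReal_mul (by positivity),
    ← ENNReal.ofReal_add (by positivity) (by positivity)]
  apply ENNReal.ofReal_le_ofReal
  set p := ‖fderiv ℝ u X‖
  have hp : 0 ≤ p := norm_nonneg _
  have h1 : τ * p ≤ l + τ ^ 2 * p ^ 2 / l := by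
    rw [← sub_le_iff_le_add', le_div_iff₀ hl]
    nlinarith [sq_nonneg (τ * p - l), mul_nonneg hτ.le hp, sq_nonneg (τ * p), sq_nonneg l, mul_nonneg (mul_nonneg hτ.le hp) hl.le]
  have h2 := div_le_div_of_nonneg_right h1 (show 0 ≤ τ ^ n by positivity)
  calc _ = τ * p / τ ^ n := by ring
    _ ≤ _ := h2
    _ = _ := by rw [add_div]; congr 1; field_simp

lemma avg_ge {n : ℕ} {f : Eu n → ℝ} {A : Eu n} {t ρ m : ℝ} (ht : 0 ≤ t) (htρ : t < ρ) (hf : ContinuousOn f (ball A ρ))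
    (h : ∀ y ∈ ball A ρ, m ≤ f y) : m ≤ avg f A t := by
  have hi := avg_integrable ht htρ hf
  have e : m = ∫ y, kern n y * m := by rw [integral_mul_const, kern_int, one_mul]
  rw [e]
  unfold avg
  apply integral_mono ((kern_integrable n).mul_const m) hi
  intro y
  simp only
  rcases le_or_gt 1 ‖y‖ with h1 | h1
  · rw [kern_zero n y h1]; simp
  · exact mul_le_mul_of_nonneg_left (h _ (mem_ball_smul ht htρ h1.le)) (kern_nonneg n y)

lemma rpow_small (κ c m0 : ℝ) (hκ : 0 < κ) (hc : 0 < c) (hm : 0 < m0) : ∃ m : ℝ, 0 < m ∧ m ≤ m0 ∧ m ^ κ ≤ c := by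
  refine ⟨min m0 (c ^ (1 / κ)), by positivity, min_le_left _ _, ?_⟩
  calc _ ≤ (c ^ (1 / κ)) ^ κ := by gcongr; exact min_le_right _ _
    _ = c := by rw [← Real.rpow_mul hc.le]; field_simp; simp

end

open MeasureTheory Metric Set
open scoped RealInnerProductSpace ENNReal NNReal Topology

noncomputable section

lemma tr_term (n j : ℕ) {C1 cd K ν S q m t d B Cc p : ℝ} (hK : 0 < K) (hS : 0 < S) (hq : 0 < q)
    (hm : 0 < m) (ht : 0 < t) (hp : p = 2 ^ (-d)) (hqp : q ^ 2 = p * (2 ^ n / 4)) :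
    C1 * ((m * t / 2 ^ j) ^ 2 / (m * t / 2 ^ j) ^ n / (ν * S * q ^ j)) * (cd⁻¹ * (8 * (K * (m * t / 2 ^ j)) / t) ^ d * B) *
      (Cc * (t ^ n / t ^ 2) * S ^ 2) = (C1 * cd⁻¹ * (8 * K) ^ d / ν * Cc * m ^ (d + 2 - n) * S * B) * q ^ j := by
  have hp0 : 0 < p := by rw [hp]; positivity
  have h1 : (8 * (K * (m * t / 2 ^ j)) / t) ^ d = (8 * K) ^ d * m ^ d * p ^ j := by
    have e : 8 * (K * (m * t / 2 ^ j)) / t = (8 * K) * m * (2 ^ j)⁻¹ := by field_simp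
    rw [e, Real.mul_rpow (by positivity) (by positivity), Real.mul_rpow (by positivity) (by positivity), hp]
    congr 1
    rw [Real.inv_rpow (by positivity), ← Real.rpow_natCast, ← Real.rpow_natCast, ← Real.rpow_mul (by norm_num),
      ← Real.rpow_mul (by norm_num), ← Real.rpow_neg (by norm_num)]
    congr 1; ring
  have h2 : (m * t / 2 ^ j) ^ 2 / (m * t / 2 ^ j) ^ n = m ^ 2 / m ^ n * (t ^ 2 / t ^ n) * (2 ^ n / 4) ^ j := by
    rw [div_pow, div_pow, div_pow, mul_pow, mul_pow, ← pow_mul, ← pow_mul, ← pow_mul, mul_comm j 2, pow_mul 2 2 j, mul_comm j n]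
    field_simp; norm_num
  have h3 : m ^ (d + 2 - n) = m ^ d * (m ^ 2 / m ^ n) := by
    rw [Real.rpow_sub hm, Real.rpow_add hm, Real.rpow_natCast]
    norm_num [mul_div_assoc]
  have h4 : (2 ^ n / 4 : ℝ) ^ j = q ^ j * q ^ j / p ^ j := by
    rw [eq_div_iff (by positivity), ← mul_pow, ← mul_pow, ← pow_two, hqp, mul_comm]
  rw [h1, h2, h3, h4]
  field_simp

lemma tsum_geo {G q : ℝ} (hG : 0 ≤ G) (hq : 0 ≤ q) (hq1 : q < 1) :
    ∑' j : ℕ, ENNReal.ofReal (G * q ^ j) = ENNReal.ofReal (G / (1 - q)) := by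
  rw [← ENNReal.ofReal_tsum_of_nonneg (fun j => by positivity) ((summable_geometric_of_lt_one hq hq1).mul_left G), tsum_mul_left,
    tsum_geometric_of_lt_one hq hq1, div_eq_mul_inv]

lemma dbl2 {n : ℕ} {M Cσ d cd : ℝ} {Ω : Set (Eu n)} {σ : Measure (Eu n)} (h : IsMixedPair M Cσ d cd Ω σ) {z : Eu n}
    (hz : z ∈ frontier Ω) {t : ℝ} (ht : 0 < t) (htd : t < Metric.diam Ω) (m : ℕ) :
    (σ (ball z t)).toReal ≤ Cσ ^ m * (σ (ball z (t / 2 ^ m))).toReal := by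
  have hc := h.Cσ_pos
  induction m with
  | zero => simp
  | succ m ih =>
    have h2 : t / 2 ^ (m + 1) < Metric.diam Ω := lt_of_le_of_lt (div_le_self ht.le (one_le_pow₀ (by norm_num))) htd
    have := h.doubling z hz (t / 2 ^ (m + 1)) (by positivity) h2
    have e : 2 * (t / 2 ^ (m + 1)) = t / 2 ^ m := by rw [pow_succ]; field_simp
    rw [e] at this
    calc _ ≤ _ := ih
      _ ≤ Cσ ^ m * (Cσ * (σ (ball z (t / 2 ^ (m + 1)))).toReal) := by gcongr
      _ = _ := by ring

lemma trace (n : ℕ) (hn : 1 ≤ n) (M Cσ d cd : ℝ) (hM : 1 < M) (hCσ : 0 < Cσ) (hd : (n:ℝ) - 2 < d) (hcd : 0 < cd) :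
    ∃ μ M1 : ℝ, 0 < μ ∧ μ ≤ 1 ∧ 0 < M1 ∧ ∀ (Ω : Set (Eu n)) (σ : Measure (Eu n)),
    IsMixedPair M Cσ d cd Ω σ → (frontier Ω).Nonempty → ∀ (a : ℝ) (Q : Eu n) (R : ℝ) (u : Eu n → ℝ), 0 ≤ a →
    IsRobinLocalSolution Ω σ a Q R u → ∀ z ∈ frontier Ω, ∀ (t S : ℝ), 0 < t → t < Metric.diam Ω → dist z Q + t ≤ R → 0 < S →
    (∀ X ∈ Ω ∩ ball z t, u X ≤ S) → (∀ X ∈ Ω ∩ ball z (t / 2), μ * t ≤ dl Ω X → 3 / 4 * S ≤ u X) →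
    a * (σ (ball z t)).toReal ≤ M1 * (t ^ n / t ^ 2) := by
  obtain ⟨C1, K, κ, hC1, hK, hκ, hκ2, hpot⟩ := potential n M hM
  obtain ⟨Cc, hCc, hen⟩ := energy n hn
  set V := (volume (ball (0 : Eu n) 1)).toReal with hV
  have hVe : volume (ball (0 : Eu n) 1) = ENNReal.ofReal V := (ENNReal.ofReal_toReal measure_ball_lt_top.ne).symm
  have hV0 : 0 ≤ V := ENNReal.toReal_nonneg
  obtain ⟨p, hp⟩ : ∃ p : ℝ, p = 2 ^ (-d) := ⟨_, rfl⟩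
  have hp0 : 0 < p := by rw [hp]; positivity
  obtain ⟨q, hq⟩ : ∃ q : ℝ, q = Real.sqrt (p * (2 ^ n / 4)) := ⟨_, rfl⟩
  have hq0 : 0 < q := by rw [hq]; positivity
  have hq2 : q ^ 2 = p * (2 ^ n / 4) := by rw [hq]; exact Real.sq_sqrt (by positivity)
  have hq1 : q < 1 := by
    have : q ^ 2 < 1 := by
      rw [hq2, hp, show (2:ℝ) ^ n / 4 = 2 ^ ((n:ℝ) - 2) by rw [Real.rpow_sub (by norm_num), Real.rpow_natCast]; norm_num,
        ← Real.rpow_add (by norm_num)]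
      exact Real.rpow_lt_one_of_one_lt_of_neg (by norm_num) (by linarith)
    exact (sq_lt_one_iff₀ hq0.le).1 this
  have hq1' : 0 < 1 - q := by linarith
  have hK0 : 0 < K := by linarith
  obtain ⟨ν, hν⟩ : ∃ ν : ℝ, ν = (1 - q) / (8 * C1 * (V * K ^ n + 1)) := ⟨_, rfl⟩
  have hν0 : 0 < ν := by rw [hν]; positivity
  obtain ⟨G, hG⟩ : ∃ G : ℝ, G = C1 * cd⁻¹ * (8 * K) ^ d / ν * Cc := ⟨_, rfl⟩
  have hG0 : 0 < G := by rw [hG]; positivity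
  obtain ⟨m, hm0, hm1, hm2⟩ := rpow_small (d + 2 - n) ((1 - q) / (8 * G * Cσ ^ 2)) (1 / (24 * (M + K))) (by linarith)
    (by positivity) (by positivity)
  rw [le_div_iff₀ (by positivity)] at hm1
  have hmM : 24 * (M * m) ≤ 1 := by have := mul_pos hm0 hK0; linarith
  have hmK : 24 * (K * m) ≤ 1 := by have := mul_pos hm0 (show 0 < M by linarith); linarith
  have hmm : m ≤ K * m := le_mul_of_one_le_left hm0.le hK
  refine ⟨m / 4, 4 * Cc * Cσ ^ 2, by positivity, by linarith, by positivity, ?_⟩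
  intro Ω σ hΩ hFr a Q R u ha hs z hz t S ht htd hR hS huS hdeep
  haveI := fin_sig hΩ
  have hΩo := hΩ.nta.isOpen
  have hbs : ball z t ⊆ ball Q R := by
    intro Y hY
    rw [mem_ball] at *
    linarith [dist_triangle Y z Q]
  obtain ⟨T, hT⟩ : ∃ T, T = frontier Ω ∩ ball z (t / 4) := ⟨_, rfl⟩
  have hTm : MeasurableSet T := by rw [hT]; exact isClosed_frontier.measurableSet.inter measurableSet_ball
  obtain ⟨s, hs'⟩ : ∃ s, s = (σ T).toReal := ⟨_, rfl⟩
  have hσT : σ T = ENNReal.ofReal s := by rw [hs', ENNReal.ofReal_toReal (measure_ne_top _ _)]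
  have hs0 : 0 ≤ s := by rw [hs']; exact ENNReal.toReal_nonneg
  obtain ⟨B, hB⟩ : ∃ B, B = (σ (ball z t)).toReal := ⟨_, rfl⟩
  have hB0 : 0 ≤ B := by rw [hB]; exact ENNReal.toReal_nonneg
  have hBs : B ≤ Cσ ^ 2 * s := by
    have := dbl2 hΩ hz ht htd 2
    rw [← hB] at this
    have e : σ (ball z (t / 2 ^ 2)) = σ T := by
      rw [show (2:ℝ) ^ 2 = 4 by norm_num, hT]
      refine le_antisymm ?_ (measure_mono inter_subset_right)
      calc _ ≤ σ (frontier Ω ∩ ball z (t / 4)) + σ (frontier Ω)ᶜ := by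
            refine (measure_mono ?_).trans (measure_union_le _ _)
            intro Y hY
            by_cases h : Y ∈ frontier Ω
            · exact Or.inl ⟨h, hY⟩
            · exact Or.inr h
        _ = _ := by rw [hΩ.null_outside, add_zero]
    rw [e, ← hs'] at this
    exact this
  rw [← hB]
  have hτ0 : 0 < m * t := by positivity
  have hmt : K * (m * t) ≤ t / 24 := by
    have := mul_le_mul_of_nonneg_right hmK ht.le
    linarith
  have hMt : M * (m * t) ≤ t / 24 := by
    have := mul_le_mul_of_nonneg_right hmM ht.le
    linarith
  have hmt1 : m * t ≤ K * (m * t) := le_mul_of_one_le_left hτ0.le hK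
  have hτj : ∀ j : ℕ, 0 < m * t / 2 ^ j ∧ m * t / 2 ^ j ≤ m * t := fun j => ⟨by positivity, div_le_self hτ0.le (one_le_pow₀ (by norm_num))⟩
  have hρj : ∀ j : ℕ, K * (m * t / 2 ^ j) ≤ t / 24 := fun j => (mul_le_mul_of_nonneg_left (hτj j).2 hK0.le).trans hmt
  obtain ⟨W, hW⟩ : ∃ W : ℕ → Eu n → ℝ≥0∞, W = fun j y => ENNReal.ofReal (C1 * ((m * t / 2 ^ j) ^ 2 / (m * t / 2 ^ j) ^ n / (ν * S * q ^ j))) *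
      ∫⁻ X in Ω ∩ ball y (K * (m * t / 2 ^ j)), ‖fderiv ℝ u X‖ₑ ^ 2 := ⟨_, rfl⟩
  have hfm : Measurable fun X => ‖fderiv ℝ u X‖ₑ ^ 2 := (measurable_fderiv ℝ u).enorm.pow_const 2
  have hWm : ∀ j, Measurable (W j) := by
    intro j
    rw [hW]
    exact (meas_ball Ω hΩo.measurableSet _ _ hfm).const_mul _
  have hpt : ∀ y ∈ T, ENNReal.ofReal (3 / 8 * S) ≤ ENNReal.ofReal (1 / S) * ENNReal.ofReal (u y ^ 2) + ∑' j, W j y := by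
    intro y hy
    rw [hT] at hy
    have hyz := mem_ball.1 hy.2
    have hyc : y ∈ closure Ω := frontier_subset_closure hy.1
    have hyb : y ∈ ball Q R := hbs (mem_ball.2 (by linarith))
    obtain ⟨A, hA, hAd, hAy, hAp⟩ := hpot Ω hΩ.nta hFr y hyc (m * t) hτ0 (by linarith) u
      (fun Y hY => (robin_lap hs ⟨hY.1, hbs (by
        have := mem_ball.1 hY.2
        rw [mem_ball]; linarith [dist_triangle Y y z])⟩).1.of_le (by norm_num))
      ((hs.contOn y ⟨hyc, hyb⟩).mono_of_mem_nhdsWithin (by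
        rw [mem_nhdsWithin]
        exact ⟨ball Q R, isOpen_ball, hyb, fun Z hZ => ⟨subset_closure hZ.2, hZ.1⟩⟩))
    have hAb : ∀ Y ∈ ball A (3 / 4 * (m * t)), Y ∈ Ω ∩ ball z (t / 2) ∧ m / 4 * t ≤ dl Ω Y := by
      intro Y hY
      refine ⟨⟨ballSub hΩo hA (ball_subset_ball (by linarith) hY), ?_⟩, ?_⟩
      · have := mem_ball.1 hY
        rw [mem_ball]; linarith [dist_triangle Y A y, dist_triangle Y y z]
      · have := ball_dl (Ω := Ω) hY
        linarith
    have hκt : κ * (m * t) ≤ 1 / 2 * (m * t) := by gcongr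
    have hav : 3 / 4 * S ≤ avg u A (κ * (m * t)) := by
      refine avg_ge (ρ := 3 / 4 * (m * t)) (by positivity) (by linarith) ?_ (fun Y hY => hdeep Y (hAb Y hY).1 (hAb Y hY).2)
      exact hs.contOn.mono fun Y hY => ⟨subset_closure (hAb Y hY).1.1, hbs (ball_subset_ball (by linarith) (hAb Y hY).1.2)⟩
    have huy := hs.nonneg y ⟨hyc, hyb⟩
    have hsum : ENNReal.ofReal C1 * ∑' j : ℕ,
      ENNReal.ofReal (m * t / 2 ^ j / (m * t / 2 ^ j) ^ n) * gm u (Ω ∩ ball y (K * (m * t / 2 ^ j))) ≤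
        ENNReal.ofReal (S / 8) + ∑' j, W j y := by
      have h8 : ∑' j : ℕ, ENNReal.ofReal ((C1 * (V * K ^ n) * ν * S) * q ^ j) ≤ ENNReal.ofReal (S / 8) := by
        rw [tsum_geo (by positivity) hq0.le hq1]
        apply ENNReal.ofReal_le_ofReal
        rw [div_le_iff₀ hq1', hν]
        have e : C1 * (V * K ^ n) * ((1 - q) / (8 * C1 * (V * K ^ n + 1))) * S = S / 8 * (1 - q) * ((V * K ^ n) / (V * K ^ n + 1)) := by
          field_simp
        rw [e]
        exact mul_le_of_le_one_right (by positivity) (by rw [div_le_one (by positivity)]; linarith)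
      refine le_trans ?_ (add_le_add_left h8 _)
      rw [← ENNReal.tsum_add, ← ENNReal.tsum_mul_left]
      apply ENNReal.tsum_le_tsum
      intro j
      have hj := (hτj j).1
      have := amgm_gm u (Ω ∩ ball y (K * (m * t / 2 ^ j))) hj (show 0 < ν * S * q ^ j by positivity)
      calc _ ≤ _ := mul_le_mul' le_rfl this
        _ ≤ ENNReal.ofReal C1 * (ENNReal.ofReal (ν * S * q ^ j / (m * t / 2 ^ j) ^ n) * (ENNReal.ofReal ((K * (m * t / 2 ^ j)) ^ n) * ENNReal.ofReal V) +
            ENNReal.ofReal ((m * t / 2 ^ j) ^ 2 / (m * t / 2 ^ j) ^ n / (ν * S * q ^ j)) *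
              ∫⁻ X in Ω ∩ ball y (K * (m * t / 2 ^ j)), ‖fderiv ℝ u X‖ₑ ^ 2) := by
            rw [← hVe, ← vol_ball y (show 0 < K * (m * t / 2 ^ j) by positivity)]
            gcongr
            exact inter_subset_right
        _ = _ := by
            rw [mul_add, hW]
            simp only
            rw [← mul_assoc, ← mul_assoc, ← mul_assoc, ← ENNReal.ofReal_mul (by positivity), ← ENNReal.ofReal_mul (by positivity),
              ← ENNReal.ofReal_mul (by positivity), ← ENNReal.ofReal_mul (by positivity)]
            congr 2
            rw [mul_pow K]
            field_simp
    have h1 : ENNReal.ofReal (3 / 4 * S) ≤ ENNReal.ofReal (u y) + (ENNReal.ofReal (S / 8) + ∑' j, W j y) := by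
      refine le_trans ?_ (add_le_add_right (hAp.trans hsum) _)
      rw [← ENNReal.ofReal_add huy (abs_nonneg _)]
      apply ENNReal.ofReal_le_ofReal
      have := neg_abs_le (u y - avg u A (κ * (m * t)))
      linarith
    have h2 : ENNReal.ofReal (u y) ≤ ENNReal.ofReal (1 / S) * ENNReal.ofReal (u y ^ 2) + ENNReal.ofReal (S / 4) := by
      rw [← ENNReal.ofReal_mul (by positivity), ← ENNReal.ofReal_add (by positivity) (by positivity)]
      apply ENNReal.ofReal_le_ofReal
      have : 1 / S * u y ^ 2 + S / 4 - u y = (u y - S / 2) ^ 2 / S := by field_simp; ring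
      have h3 : 0 ≤ (u y - S / 2) ^ 2 / S := by positivity
      linarith
    have h3 := h1.trans (add_le_add_left h2 _)
    rw [show 3 / 4 * S = 3 / 8 * S + (S / 4 + S / 8) by ring, ENNReal.ofReal_add (by positivity) (by positivity),
      ENNReal.ofReal_add (by positivity) (by positivity)] at h3
    refine ENNReal.le_of_add_le_add_right (a := ENNReal.ofReal (S / 4) + ENNReal.ofReal (S / 8)) (by finiteness) (h3.trans (le_of_eq ?_))
    ring
  have henergy := hen M Cσ d cd Ω σ hΩ hFr a Q R u ha hs z t S ht hR huS
  have hE1 := (le_add_right le_rfl).trans henergy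
  have hE2 := (le_add_left le_rfl).trans henergy
  have hWint : ∀ j, ∫⁻ y in T, W j y ∂σ ≤ ENNReal.ofReal ((G * m ^ (d + 2 - n) * S * B) * q ^ j) := by
    intro j
    have hj := (hτj j).1
    have hj2 := hρj j
    have hton := tonelli_ball σ T (Ω ∩ ball z (t / 2)) Ω hTm hΩo.measurableSet (hΩo.measurableSet.inter measurableSet_ball)
      (K * (m * t / 2 ^ j)) _ hfm (ENNReal.ofReal (cd⁻¹ * (8 * (K * (m * t / 2 ^ j)) / t) ^ d * B)) (by
        intro y hy X hX
        rw [hT] at hy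
        have h1 := mem_ball.1 hy.2
        have h2 := mem_ball.1 hX.2
        exact ⟨hX.1, mem_ball.2 (by linarith [dist_triangle X y z])⟩) (by
        intro X hX
        rw [hT, hB]
        exact sig_small hΩ ht htd (by positivity) (by linarith) X)
    rw [hW]
    simp only
    rw [lintegral_const_mul' _ _ ENNReal.ofReal_ne_top]
    calc _ ≤ _ := mul_le_mul' le_rfl (hton.trans (mul_le_mul' le_rfl hE1))
      _ = _ := by
        rw [← mul_assoc, ← ENNReal.ofReal_mul (by positivity), ← ENNReal.ofReal_mul (by positivity),
          tr_term n j hK0 hS hq0 hm0 ht hp hq2, hG]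
  have hWsum : ∑' j, ∫⁻ y in T, W j y ∂σ ≤ ENNReal.ofReal (S * s / 8) := by
    refine (ENNReal.tsum_le_tsum hWint).trans ?_
    rw [tsum_geo (by positivity) hq0.le hq1]
    apply ENNReal.ofReal_le_ofReal
    rw [div_le_iff₀ hq1']
    have h3 : G * m ^ (d + 2 - n) * S * B ≤ G * ((1 - q) / (8 * G * Cσ ^ 2)) * S * (Cσ ^ 2 * s) := by gcongr
    refine h3.trans (le_of_eq ?_)
    field_simp
  have hI := setLIntegral_mono' (μ := σ) hTm hpt
  rw [setLIntegral_const, lintegral_add_right _ (Measurable.tsum hWm), lintegral_const_mul' _ _ ENNReal.ofReal_ne_top,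
    lintegral_tsum fun j => (hWm j).aemeasurable] at hI
  have hI2 : ENNReal.ofReal a * ∫⁻ y in T, ENNReal.ofReal (u y ^ 2) ∂σ ≤ ENNReal.ofReal (Cc * (t ^ n / t ^ 2) * S ^ 2) := by
    refine le_trans (mul_le_mul' le_rfl (lintegral_mono_set ?_)) hE2
    rw [hT]
    exact inter_subset_inter_right _ (ball_subset_ball (by linarith))
  have hfin : ENNReal.ofReal (a * (3 / 8 * S * s)) ≤ ENNReal.ofReal (1 / S * (Cc * (t ^ n / t ^ 2) * S ^ 2) + a * (S * s / 8)) := by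
    rw [ENNReal.ofReal_mul ha, ENNReal.ofReal_mul (p := 3 / 8 * S) (by positivity), ← hσT, ENNReal.ofReal_add (by positivity) (by positivity),
      ENNReal.ofReal_mul (p := 1 / S) (by positivity), ENNReal.ofReal_mul (q := S * s / 8) ha]
    calc _ ≤ _ := mul_le_mul' (le_refl (ENNReal.ofReal a)) hI
      _ = ENNReal.ofReal (1 / S) * (ENNReal.ofReal a * ∫⁻ y in T, ENNReal.ofReal (u y ^ 2) ∂σ) + ENNReal.ofReal a * ∑' j, ∫⁻ y in T, W j y ∂σ := by
        ring
      _ ≤ _ := by gcongr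
  rw [ENNReal.ofReal_le_ofReal_iff (by positivity)] at hfin
  have h5 : 1 / S * (Cc * (t ^ n / t ^ 2) * S ^ 2) = Cc * (t ^ n / t ^ 2) * S := by field_simp
  rw [h5] at hfin
  have h6 : (a * s) * S ≤ (4 * (Cc * (t ^ n / t ^ 2))) * S := by linarith
  have h7 := le_of_mul_le_mul_right h6 hS
  calc a * B ≤ a * (Cσ ^ 2 * s) := by gcongr
    _ = Cσ ^ 2 * (a * s) := by ring
    _ ≤ Cσ ^ 2 * (4 * (Cc * (t ^ n / t ^ 2))) := by gcongr
    _ = _ := by ring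

end

open MeasureTheory Metric Set
open scoped RealInnerProductSpace ENNReal NNReal Topology

noncomputable section

lemma harm_affine {n : ℕ} {u : Eu n → ℝ} {U : Set (Eu n)} (hu : IsHarmonicOn u U) (S : ℝ) : IsHarmonicOn (fun X => S - u X) U := by
  intro x hx
  refine ⟨contDiffAt_const.sub (hu x hx).1, ?_⟩
  have h1 : lap (fun X => S - u X) x = lap (fun X => - u X) x := by
    rw [lap_eq, lap_eq]
    have : fderiv ℝ (fun X => S - u X) = fderiv ℝ (fun X => - u X) := by
      ext1 y
      rw [fderiv_const_sub, fderiv_fun_neg]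
    rw [this]
  have h2 : lap u x = 0 := (hu x hx).2
  change lap (fun X => S - u X) x = 0
  rw [h1, lap_neg, h2, neg_zero]

lemma bstep (n : ℕ) (hn : 1 ≤ n) (M Cσ d cd : ℝ) (hM : 1 < M) (hCσ : 0 < Cσ) (hd : (n:ℝ) - 2 < d) (hcd : 0 < cd) (hn2 : 2 ≤ n) :
    ∃ θ K M1 : ℝ, 0 < θ ∧ θ < 1 ∧ 1 ≤ K ∧ 0 < M1 ∧ ∀ (Ω : Set (Eu n)) (σ : Measure (Eu n)),
    IsMixedPair M Cσ d cd Ω σ → (frontier Ω).Nonempty → ∀ (a : ℝ) (Q : Eu n) (R : ℝ) (u : Eu n → ℝ), 0 ≤ a →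
    IsRobinLocalSolution Ω σ a Q R u → ∀ z ∈ frontier Ω, ∀ (t S : ℝ), 0 < t → t < Metric.diam Ω → dist z Q + t ≤ R → 0 < S →
    (∀ X ∈ closure Ω ∩ ball z t, u X ≤ S) → M1 * (t ^ n / t ^ 2) < a * (σ (ball z t)).toReal →
    ∀ X ∈ closure Ω ∩ ball z (t / K), u X ≤ θ * S := by
  obtain ⟨μ, M1, hμ, hμ1, hM1, htr⟩ := trace n hn M Cσ d cd hM hCσ hd hcd
  obtain ⟨C, K, γ, hC, hK, hγ, hlad⟩ := ladder n M hM
  obtain ⟨ε, hε, hε4, hdg⟩ := dg n hn M hM (1 / 2) (by positivity) (by norm_num)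
  obtain ⟨k, hk⟩ := pow_unbounded_of_one_lt (4 * K + 4) (one_lt_two (α := ℝ))
  obtain ⟨N, hN⟩ : ∃ N : ℝ, N = 2 ^ k := ⟨_, rfl⟩
  rw [← hN] at hk
  have hN0 : 0 < N := by linarith
  obtain ⟨s1, hs1⟩ : ∃ s1, s1 = min (2 * μ / N) (ε / N) := ⟨_, rfl⟩
  have hs10 : 0 < s1 := by rw [hs1]; positivity
  have hs1μ : s1 ≤ 2 * μ / N := hs1 ▸ min_le_left _ _
  have hs1ε : s1 ≤ ε / N := hs1 ▸ min_le_right _ _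
  obtain ⟨c, hc⟩ : ∃ c, c = 1 / (4 * (C * (2 / N / s1) ^ γ)) := ⟨_, rfl⟩
  have hC0 : 0 < C := by linarith
  have hc0 : 0 < c := by rw [hc]; positivity
  have hc1 : c ≤ 1 / 4 := by
    rw [hc]
    have : 1 ≤ (2 / N / s1) ^ γ := by
      apply one_le_pow₀
      rw [one_le_div hs10]
      refine hs1ε.trans ?_
      gcongr; linarith
    have := one_le_mul_of_one_le_of_one_le hC this
    gcongr; linarith
  refine ⟨1 - c / 2, 2 * N, Cσ ^ k * M1, by linarith, by linarith, by linarith, by positivity, ?_⟩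
  intro Ω σ hΩ hFr a Q R u ha hs z hz t S ht htd hR hS huS hI
  have hbs : ball z t ⊆ ball Q R := by
    intro Y hY
    rw [mem_ball] at *
    linarith [dist_triangle Y z Q]
  have hN1 : 1 < N := by linarith
  have htN : t / N < t := div_lt_self ht hN1
  by_cases hcase : ∃ A ∈ Ω ∩ ball z (t / N), s1 * t ≤ dl Ω A ∧ (1 - c) * S < u A
  · exfalso
    obtain ⟨A, hA, hAd, hAu⟩ := hcase
    have hAz := mem_ball.1 hA.2
    have hsub : ball A (K * (2 / N * t)) ⊆ ball z t := by
      intro Y hY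
      rw [mem_ball] at *
      have : (2 * K + 1) * (t / N) ≤ t := by
        rw [← mul_div_assoc, div_le_iff₀ hN0]
        have := mul_lt_mul_of_pos_right hk ht
        have := mul_pos (show 0 < K by linarith) ht
        linarith
      have e : K * (2 / N * t) = 2 * K * (t / N) := by ring
      rw [e] at hY
      linarith [dist_triangle Y A z]
    have hdeep : ∀ X ∈ Ω ∩ ball z (t / N), s1 * t ≤ dl Ω X → 3 / 4 * S ≤ u X := by
      intro X hX hXd
      have hXz := mem_ball.1 hX.2
      have := hlad Ω hΩ.nta hFr X hX.1 A hA.1 (2 / N * t) (s1 * t) (by positivity) (by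
          gcongr
          refine hs1ε.trans ?_
          gcongr; linarith) hXd hAd (by
          rw [div_mul_eq_mul_div, mul_div_assoc]
          linarith [dist_triangle X z A, dist_comm z A]) (by
          have : K * (2 / N * t) ≤ t := by
            rw [div_mul_eq_mul_div, ← mul_div_assoc, div_le_iff₀ hN0]
            have := mul_lt_mul_of_pos_right hk ht
            have := mul_pos (show 0 < K by linarith) ht
            linarith
          linarith) (fun X => S - u X)
        (harm_affine (hs.harmonic.mono fun Y hY => ⟨hY.1, hbs (hsub hY.2)⟩) S)
        (fun Y hY => by
          have := huS Y ⟨subset_closure hY.1, hsub hY.2⟩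
          linarith)
      have e : 2 / N * t / (s1 * t) = 2 / N / s1 := by field_simp
      rw [e] at this
      have h2 : C * (2 / N / s1) ^ γ * (S - u A) ≤ C * (2 / N / s1) ^ γ * (c * S) := by
        gcongr; linarith
      have h3 : C * (2 / N / s1) ^ γ * (c * S) = S / 4 := by rw [hc]; field_simp
      linarith
    have e2 : 2 * t / N / 2 = t / N := by ring
    have h2N : 2 * t / N ≤ t := by rw [div_le_iff₀ hN0]; have := mul_lt_mul_of_pos_right hk ht; have := mul_pos (show 0 < K by linarith) ht; linarith
    have h2N0 : 0 < 2 * t / N := by positivity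
    have hfin := htr Ω σ hΩ hFr a Q R u ha hs z hz (2 * t / N) S h2N0 (by linarith) (by linarith) hS
      (fun X hX => huS X ⟨subset_closure hX.1, ball_subset_ball h2N hX.2⟩)
      (by
        rw [e2]
        intro X hX hXd
        refine hdeep X hX (le_trans ?_ hXd)
        calc s1 * t ≤ 2 * μ / N * t := by gcongr
          _ = _ := by ring)
    have hd := dbl2 hΩ hz ht htd k
    rw [← hN] at hd
    haveI := fin_sig hΩ
    have hmono : (σ (ball z (t / N))).toReal ≤ (σ (ball z (2 * t / N))).toReal :=
      ENNReal.toReal_mono (measure_ne_top _ _) (measure_mono (ball_subset_ball (by rw [← e2]; linarith)))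
    have hpow : (2 * t / N) ^ n / (2 * t / N) ^ 2 ≤ t ^ n / t ^ 2 := by
      rw [← pow_sub₀ _ h2N0.ne' hn2 |>.trans (div_eq_mul_inv _ _).symm, ← pow_sub₀ _ ht.ne' hn2 |>.trans (div_eq_mul_inv _ _).symm]
      gcongr
    have : a * (σ (ball z t)).toReal ≤ Cσ ^ k * M1 * (t ^ n / t ^ 2) := by
      calc _ ≤ a * (Cσ ^ k * (σ (ball z (2 * t / N))).toReal) := by gcongr; exact hd.trans (by gcongr)
        _ = Cσ ^ k * (a * (σ (ball z (2 * t / N))).toReal) := by ring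
        _ ≤ Cσ ^ k * (M1 * (t ^ n / t ^ 2)) := by
            refine mul_le_mul_of_nonneg_left ?_ (by positivity)
            exact hfin.trans (mul_le_mul_of_nonneg_left hpow hM1.le)
        _ = _ := by ring
    linarith
  · push Not at hcase
    intro X hX
    have := hdg Cσ d cd Ω σ hΩ hFr a Q R u ha hs z (t / N) (by positivity) (by linarith) (by linarith) ((1 - c) * S) (c * S) (by positivity)
      (fun Y hY => by
        have := huS Y ⟨subset_closure hY.1, ball_subset_ball htN.le hY.2⟩
        linarith)
      (fun Y hY hYd => hcase Y hY (le_trans (by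
        calc s1 * t ≤ ε / N * t := by gcongr
          _ = _ := by ring) hYd)) X ⟨hX.1, by convert hX.2 using 2; field_simp⟩
    linarith

end

open MeasureTheory Metric Set
open scoped RealInnerProductSpace ENNReal NNReal Topology

noncomputable section

lemma bdecay (n : ℕ) (hn2 : 2 ≤ n) (M Cσ d cd : ℝ) (hM : 1 < M) (hCσ : 0 < Cσ) (hd : (n:ℝ) - 2 < d) (hcd : 0 < cd) :
    ∃ C β : ℝ, 0 < C ∧ 0 < β ∧ ∀ (Ω : Set (Eu n)) (σ : Measure (Eu n)),
    IsMixedPair M Cσ d cd Ω σ → (frontier Ω).Nonempty → ∀ (a : ℝ) (Q : Eu n) (R : ℝ) (u : Eu n → ℝ), 0 ≤ a →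
    IsRobinLocalSolution Ω σ a Q R u → ∀ z ∈ frontier Ω, ∀ (t S I : ℝ), 0 < t → t < Metric.diam Ω → dist z Q + t ≤ R → 0 < S →
    (∀ X ∈ closure Ω ∩ ball z t, u X ≤ S) → 0 < I → I * (t ^ n / t ^ 2) = a * (σ (ball z t)).toReal →
    u z ≤ C * I ^ (-β) * S := by
  obtain ⟨θ, K, M1, hθ, hθ1, hK, hM1, hb⟩ := bstep n (by omega) M Cσ d cd hM hCσ hd hcd hn2
  obtain ⟨m, hm⟩ := pow_unbounded_of_one_lt K (one_lt_two (α := ℝ))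
  have hm0 : m ≠ 0 := by rintro rfl; simp at hm; linarith
  obtain ⟨N, hN⟩ : ∃ N : ℝ, N = 2 ^ m := ⟨_, rfl⟩
  rw [← hN] at hm
  have hN1 : 1 < N := by linarith
  have hN0 : 0 < N := by linarith
  obtain ⟨C3, hC3⟩ : ∃ C3 : ℝ, C3 = (max Cσ 2) ^ m := ⟨_, rfl⟩
  have hC31 : 1 < C3 := by
    rw [hC3]; exact one_lt_pow₀ (lt_of_lt_of_le one_lt_two (le_max_right _ _)) hm0
  have hC30 : 0 < C3 := by linarith
  obtain ⟨β, hβ⟩ : ∃ β : ℝ, β = - Real.log θ / Real.log C3 := ⟨_, rfl⟩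
  have hlC : 0 < Real.log C3 := Real.log_pos hC31
  have hβ0 : 0 < β := by
    rw [hβ]; exact div_pos (by linarith [Real.log_neg hθ hθ1]) hlC
  have hθβ : θ = C3 ^ (-β) := by
    rw [Real.rpow_def_of_pos hC30, hβ]
    have : Real.log C3 * -(-Real.log θ / Real.log C3) = Real.log θ := by field_simp
    rw [this, Real.exp_log hθ]
  refine ⟨M1 ^ β, β, by positivity, hβ0, ?_⟩
  intro Ω σ hΩ hFr a Q R u ha hs z hz t S I ht htd hR hS huS hI hIe
  have key : ∀ k : ℕ, (∀ i < k, M1 * C3 ^ i < I) → ∀ X ∈ closure Ω ∩ ball z (t / N ^ k), u X ≤ θ ^ k * S := by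
    intro k
    induction k with
    | zero => intro _ X hX; simpa using huS X (by simpa using hX)
    | succ k ih =>
      intro h X hX
      have ih' := ih (fun i hi => h i (by omega))
      have hNk : 0 < N ^ k := by positivity
      have hle : t / N ^ k ≤ t := div_le_self ht.le (one_le_pow₀ hN1.le)
      have ht' : 0 < t / N ^ k := by positivity
      have hd := dbl2 hΩ hz ht htd (m * k)
      rw [pow_mul 2, ← hN] at hd
      have hC : Cσ ^ (m * k) ≤ C3 ^ k := by
        rw [hC3, ← pow_mul]
        exact pow_le_pow_left₀ hCσ.le (le_max_left _ _) _
      have hd2 : (σ (ball z t)).toReal ≤ C3 ^ k * (σ (ball z (t / N ^ k))).toReal :=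
        hd.trans (by gcongr)
      have hpow : (t / N ^ k) ^ n / (t / N ^ k) ^ 2 ≤ t ^ n / t ^ 2 := by
        rw [← pow_sub₀ _ ht'.ne' hn2 |>.trans (div_eq_mul_inv _ _).symm, ← pow_sub₀ _ ht.ne' hn2 |>.trans (div_eq_mul_inv _ _).symm]
        gcongr
      have hpos : 0 < t ^ n / t ^ 2 := by positivity
      have hx : M1 * ((t / N ^ k) ^ n / (t / N ^ k) ^ 2) < a * (σ (ball z (t / N ^ k))).toReal := by
        refine lt_of_le_of_lt (mul_le_mul_of_nonneg_left hpow hM1.le) ?_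
        have h1 := mul_lt_mul_of_pos_right (h k (by omega)) hpos
        rw [hIe] at h1
        have h2 := mul_le_mul_of_nonneg_left hd2 ha
        have h3 : C3 ^ k * (M1 * (t ^ n / t ^ 2)) < C3 ^ k * (a * (σ (ball z (t / N ^ k))).toReal) := by
          calc _ = M1 * C3 ^ k * (t ^ n / t ^ 2) := by ring
            _ < _ := h1
            _ ≤ _ := h2
            _ = _ := by ring
        exact lt_of_mul_lt_mul_left h3 (by positivity)
      have := hb Ω σ hΩ hFr a Q R u ha hs z hz (t / N ^ k) (θ ^ k * S) ht' (by linarith) (by linarith) (by positivity) ih' hx X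
        ⟨hX.1, ball_subset_ball (by
          rw [pow_succ, ← div_div]
          gcongr) hX.2⟩
      rw [pow_succ]
      linarith
  have hex : ∃ k : ℕ, I ≤ M1 * C3 ^ k := by
    obtain ⟨k, hk⟩ := pow_unbounded_of_one_lt (I / M1) hC31
    refine ⟨k, ?_⟩
    rw [div_lt_iff₀ hM1] at hk
    linarith
  classical
  have hk1 := Nat.find_spec hex
  obtain ⟨k, hk⟩ : ∃ k, k = Nat.find hex := ⟨_, rfl⟩
  rw [← hk] at hk1
  have h1 := key k (fun i hi => by
    have := Nat.find_min hex (hk ▸ hi)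
    exact not_le.1 this) z ⟨frontier_subset_closure hz, mem_ball_self (by positivity)⟩
  refine h1.trans ?_
  gcongr
  calc θ ^ k = (C3 ^ k) ^ (-β) := by
        rw [hθβ, ← Real.rpow_natCast, ← Real.rpow_natCast, ← Real.rpow_mul hC30.le, ← Real.rpow_mul hC30.le, mul_comm]
    _ ≤ (I / M1) ^ (-β) := by
        apply Real.rpow_le_rpow_of_nonpos (by positivity) _ (by linarith)
        rw [div_le_iff₀ hM1]; linarith
    _ = M1 ^ β * I ^ (-β) := by
        rw [Real.div_rpow hI.le hM1.le, Real.rpow_neg hM1.le, div_inv_eq_mul, mul_comm]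

end

open MeasureTheory Metric Set
open scoped RealInnerProductSpace ENNReal NNReal Topology

noncomputable section

lemma harm_lin {n : ℕ} {u w : Eu n → ℝ} {U : Set (Eu n)} (hu : IsHarmonicOn u U) (hw : IsHarmonicOn w U) (l : ℝ) :
    IsHarmonicOn (fun X => u X - l * w X) U := by
  intro x hx
  have h1 := (hu x hx).1
  have h2 := (hw x hx).1
  have h3 : ContDiffAt ℝ 2 (l • w) x := h2.const_smul l
  refine ⟨h1.sub h3, ?_⟩
  have e : (fun X => u X - l * w X) = u - l • w := by ext X; simp
  rw [e]
  have e1 := iteratedFDeriv_sub_apply h1 h3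
  have e2 := iteratedFDeriv_const_smul_apply (a := l) h2
  have a1 := (hu x hx).2
  have a2 := (hw x hx).2
  rw [e1, e2]
  simp only [ContinuousMultilinearMap.sub_apply, ContinuousMultilinearMap.smul_apply, Finset.sum_sub_distrib, ← Finset.smul_sum, a1, a2]
  simp

lemma vstep (n : ℕ) (M : ℝ) (hM : 1 < M) : ∃ θ K : ℝ, 0 < θ ∧ θ < 1 ∧ 1 ≤ K ∧ ∀ (Ω : Set (Eu n)),
    IsOneSidedNTA M Ω → (frontier Ω).Nonempty → ∀ X ∈ Ω, ∀ r : ℝ, 0 < r → K * r < Metric.diam Ω → ∀ v : Eu n → ℝ,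
    ContinuousOn v (closure Ω ∩ ball X (K * r)) → IsHarmonicOn v (Ω ∩ ball X (K * r)) → ∀ m B : ℝ, 0 ≤ m → 0 < B →
    (∀ Y ∈ Ω ∩ ball X (K * r), v Y ≤ B) → (∀ Y ∈ frontier Ω ∩ ball X (K * r), v Y ≤ m) →
    (∀ Y ∈ Ω ∩ ball X (K * r), r ≤ dl Ω Y → v Y ≤ 0) → v X ≤ m + θ * B := by
  obtain ⟨q, hq⟩ : ∃ q : ℝ, q = 1 / (16 * M) := ⟨_, rfl⟩
  have hq0 : 0 < q := by rw [hq]; positivity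
  have hq1 : q ≤ 1 / 2 := by rw [hq]; gcongr; linarith
  obtain ⟨c, hc, hav⟩ := avg_one_lower n q hq0 hq1
  have hF1 : 0 < Fn 1 := by rw [Fn_eq one_pos]; positivity
  obtain ⟨θ, hθ0, hθ1, hθ⟩ : ∃ θ : ℝ, 0 < θ ∧ θ < 1 ∧ (1 - c) * Fn 1 < Fn θ := by
    have h1 : ∀ᶠ s in 𝓝[<] (1:ℝ), (1 - c) * Fn 1 < Fn s :=
      (Fn_contDiff.continuous.continuousAt (x := 1)).continuousWithinAt.eventually (lt_mem_nhds (by nlinarith))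
    have h2 : ∀ᶠ s in 𝓝[<] (1:ℝ), s ∈ Ioo (0:ℝ) 1 := Ioo_mem_nhdsLT (by norm_num)
    obtain ⟨s, hs1, hs2⟩ := (h1.and h2).exists
    exact ⟨s, hs2.1, hs2.2, hs1⟩
  refine ⟨θ, 20 * M, hθ0, hθ1, by linarith, ?_⟩
  intro Ω hΩ hFr X hX r hr hdiam v hvc hvh m B hm hB hvB hvm hv0
  have ho := hΩ.isOpen
  have hMr : r < M * r := by nlinarith
  by_contra! hcon
  obtain ⟨ε, hε⟩ : ∃ ε : ℝ, ε = v X - (m + θ * B) := ⟨_, rfl⟩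
  have hε0 : 0 < ε := by linarith
  classical
  set W : Eu n → ℝ := fun Y => if Y ∈ Ω then Fn ((v Y - (m + ε)) / B) else 0 with hW
  have hWin : ∀ Y ∈ Ω, W =ᶠ[𝓝 Y] fun Y => Fn ((v Y - (m + ε)) / B) := by
    intro Y hY
    filter_upwards [ho.mem_nhds hY] with Z hZ
    simp [hW, hZ]
  have hWout : ∀ Y ∈ ball X (20 * M * r), Y ∉ Ω → W =ᶠ[𝓝 Y] fun _ => (0:ℝ) := by
    intro Y hY hYΩ
    by_cases hYc : Y ∈ closure Ω
    · have hfr : Y ∈ frontier Ω := ⟨hYc, by rwa [ho.interior_eq]⟩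
      have h1 := (hvc Y ⟨hYc, hY⟩).eventually (gt_mem_nhds (show v Y < m + ε by linarith [hvm Y ⟨hfr, hY⟩]))
      rw [eventually_nhdsWithin_iff] at h1
      filter_upwards [h1, isOpen_ball.mem_nhds hY] with Z hZ hZb
      by_cases hZΩ : Z ∈ Ω
      · simp only [hW, hZΩ, if_true]
        apply Fn_zero
        have := hZ ⟨subset_closure hZΩ, hZb⟩
        exact div_nonpos_of_nonpos_of_nonneg (by linarith) hB.le
      · simp [hW, hZΩ]
    · filter_upwards [isClosed_closure.isOpen_compl.mem_nhds hYc] with Z hZ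
      have : Z ∉ Ω := fun h => hZ (subset_closure h)
      simp [hW, this]
  have hWC : ∀ Y ∈ ball X (20 * M * r), ContDiffAt ℝ 2 W Y ∧ 0 ≤ lap W Y := by
    intro Y hY
    by_cases hYΩ : Y ∈ Ω
    · obtain ⟨h1, h2⟩ := Fn_sub (P := m + ε) hB (hvh Y ⟨hYΩ, hY⟩).1 (hvh Y ⟨hYΩ, hY⟩).2
      exact ⟨h1.congr_of_eventuallyEq (hWin Y hYΩ), by rwa [lap_congr (hWin Y hYΩ)]⟩
    · refine ⟨contDiffAt_const.congr_of_eventuallyEq (hWout Y hY hYΩ), ?_⟩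
      rw [lap_congr (hWout Y hY hYΩ), lap_eq]
      simp
  have hWle : ∀ Y ∈ ball X (20 * M * r), W Y ≤ Fn 1 := by
    intro Y hY
    by_cases hYΩ : Y ∈ Ω
    · simp only [hW, hYΩ, if_true]
      apply Fn_mono
      rw [div_le_one hB]
      linarith [hvB Y ⟨hYΩ, hY⟩]
    · simp [hW, hYΩ, hF1.le]
  obtain ⟨A, hA, hAd, hAX⟩ := cork hΩ hFr (subset_closure hX) (τ := 2 * r) (by positivity) (by linarith)
  have hsm := submvp (W := W) (x := X) (ρ := 20 * M * r) (t := 16 * M * r) (by positivity) (by linarith [mul_pos (show 0 < M by linarith) hr])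
    (fun Y hY => (hWC Y hY).1) (fun Y hY => (hWC Y hY).2)
  have hlow := hav (ball A r) measurableSet_ball X A (16 * M * r) (by positivity) (by linarith) (by
    apply ball_subset_ball
    rw [hq]; apply le_of_eq; field_simp)
  have hcont : ContinuousOn W (ball X (20 * M * r)) := fun Y hY => (hWC Y hY).1.continuousAt.continuousWithinAt
  have hlt : 16 * M * r < 20 * M * r := by linarith [mul_pos (show 0 < M by linarith) hr]
  have hpt : avg W X (16 * M * r) + Fn 1 * avg ((ball A r).indicator fun _ => (1:ℝ)) X (16 * M * r) ≤ Fn 1 := by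
    have hi1 := avg_integrable (by positivity) hlt hcont
    have hi2 : Integrable (fun y => kern n y * ((ball A r).indicator (fun _ => (1:ℝ)) (X + (16 * M * r) • y))) := by
      refine (kern_integrable n).mul_bdd (c := 1) ?_ (Filter.Eventually.of_forall fun y => ?_)
      · apply Measurable.aestronglyMeasurable
        exact (measurable_const.indicator measurableSet_ball).comp (by fun_prop)
      · by_cases h : (X + (16 * M * r) • y) ∈ ball A r
        · simp [indicator_of_mem h]
        · simp [indicator_of_notMem h]
    have e : Fn 1 = ∫ y, kern n y * Fn 1 := by rw [integral_mul_const, kern_int, one_mul]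
    unfold avg
    rw [← integral_const_mul, ← integral_add hi1 (hi2.const_mul _)]
    conv_rhs => rw [e]
    apply integral_mono (hi1.add (hi2.const_mul _)) ((kern_integrable n).mul_const _)
    intro y
    simp only [Pi.add_apply]
    rcases le_or_gt 1 ‖y‖ with hy | hy
    · simp [kern_zero n y hy]
    · have hmem := mem_ball_smul (A := X) (by positivity) hlt hy.le
      have hk := kern_nonneg n y
      by_cases h : (X + (16 * M * r) • y) ∈ ball A r
      · have hd := ball_dl (Ω := Ω) h
        have hΩY : X + (16 * M * r) • y ∈ Ω := ballSub ho hA (ball_subset_ball (by linarith) h)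
        have hv := hv0 _ ⟨hΩY, hmem⟩ (by linarith)
        have hz : W (X + (16 * M * r) • y) = 0 := by
          simp only [hW, hΩY, if_true]
          apply Fn_zero
          exact div_nonpos_of_nonpos_of_nonneg (by linarith) hB.le
        rw [hz, indicator_of_mem h]
        apply le_of_eq; ring
      · rw [indicator_of_notMem h]
        have := mul_le_mul_of_nonneg_left (hWle _ hmem) hk
        linarith
  have hWX : W X = Fn θ := by
    simp only [hW, hX, if_true]
    congr 1
    rw [hε]; field_simp; ring
  have := mul_le_mul_of_nonneg_left hlow hF1.le
  rw [hWX] at hsm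
  linarith

end

open MeasureTheory Metric Set
open scoped RealInnerProductSpace ENNReal NNReal Topology

noncomputable section

lemma geo_sum (θ : ℝ) (γ : ℕ) (h0 : 0 < θ) (h1 : θ < 1) : ∃ T : ℝ, 0 < T ∧ (∀ N : ℕ, ∑ i ∈ Finset.range N, θ ^ i * ((i:ℝ) + 2) ^ γ ≤ T) ∧
    ∀ N : ℕ, θ ^ N * ((N:ℝ) + 2) ^ γ ≤ T := by
  have hs : Summable fun i : ℕ => θ ^ i * ((i:ℝ) + 2) ^ γ := by
    have h := summable_pow_mul_geometric_of_norm_lt_one γ (r := θ) (by rwa [Real.norm_of_nonneg h0.le])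
    have h2 := ((summable_nat_add_iff 2).2 h).mul_left (θ ^ 2)⁻¹
    refine h2.congr fun i => ?_
    push_cast
    rw [pow_add]
    field_simp
  have hle := fun N : ℕ => hs.sum_le_tsum (Finset.range N) (fun i _ => by positivity)
  have ht : ∀ N : ℕ, θ ^ N * ((N:ℝ) + 2) ^ γ ≤ ∑' i : ℕ, θ ^ i * ((i:ℝ) + 2) ^ γ := fun N =>
    hs.le_tsum N (fun i _ => by positivity)
  exact ⟨_, lt_of_lt_of_le (by positivity) (ht 0), hle, ht⟩

lemma iter_abs (P : ℕ → ℝ → Prop) (m S : ℕ → ℝ) (θ : ℝ) (hθ : 0 < θ) (hm : ∀ j, 0 ≤ m j) (hS : ∀ j, 0 < S j) (J : ℕ)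
    (h0 : ∀ j ≤ J, P j (S j)) (h1 : ∀ j < J, ∀ B, 0 < B → P (j + 1) B → P j (m j + θ * B)) :
    P 0 (∑ i ∈ Finset.range J, θ ^ i * m i + θ ^ J * S J) := by
  have key : ∀ N j : ℕ, j + N ≤ J → P j (∑ i ∈ Finset.range N, θ ^ i * m (j + i) + θ ^ N * S (j + N)) := by
    intro N
    induction N with
    | zero => intro j hj; simpa using h0 j (by omega)
    | succ N ih =>
      intro j hj
      have hS' := hS (j + 1 + N)
      have hsum : 0 ≤ ∑ i ∈ Finset.range N, θ ^ i * m (j + 1 + i) :=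
        Finset.sum_nonneg fun i _ => mul_nonneg (by positivity) (hm _)
      have h := h1 j (by omega) _ (by positivity) (ih (j + 1) (by omega))
      convert h using 1
      rw [Finset.sum_range_succ', mul_add, Finset.mul_sum]
      have e : ∑ i ∈ Finset.range N, θ ^ (i + 1) * m (j + (i + 1)) = ∑ i ∈ Finset.range N, θ * (θ ^ i * m (j + 1 + i)) := by
        apply Finset.sum_congr rfl
        intro i _
        rw [show j + (i + 1) = j + 1 + i by omega]; ring
      have e2 : j + (N + 1) = j + 1 + N := by omega
      rw [e, e2, pow_succ, pow_zero, one_mul, add_zero]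
      ring
  simpa using key J 0 (by omega)

lemma core (n : ℕ) (hn2 : 2 ≤ n) (M Cσ d cd : ℝ) (hM : 1 < M) (hCσ : 0 < Cσ) (hd : (n:ℝ) - 2 < d) (hcd : 0 < cd) :
    ∃ M₀ C βb β1 : ℝ, 1 < M₀ ∧ 0 < C ∧ 0 < βb ∧ 0 < β1 ∧ ∀ (Ω : Set (Eu n)) (σ : Measure (Eu n)),
    IsMixedPair M Cσ d cd Ω σ → (frontier Ω).Nonempty → ∀ (a : ℝ) (Q : Eu n) (R : ℝ) (uR uD : Eu n → ℝ), 0 ≤ a → 0 < R →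
    R ≤ Metric.diam Ω →
    IsRobinLocalSolution Ω σ a Q R uR → (∀ X ∈ closure Ω ∩ ball Q R, 0 ≤ uD X) → ContinuousOn uD (closure Ω ∩ ball Q R) →
    IsHarmonicOn uD (Ω ∩ ball Q R) → (∀ P ∈ frontier Ω ∩ ball Q R, uD P = 0) →
    ∀ δ r : ℝ, 0 < δ → r = δ * R → δ ≤ 1 / M₀ → ∀ lam : ℝ, 1 ≤ lam →
    (∀ X ∈ Ω ∩ ball Q R, r ≤ dl Ω X → uR X ≤ lam * uD X) → ∀ Ib : ℝ, 0 ≤ Ib →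
    (∀ z ∈ frontier Ω ∩ ball Q (9 * R / 10), ∃ I : ℝ, 0 < I ∧ I * (r ^ n / r ^ 2) = a * (σ (ball z r)).toReal ∧ I ^ (-βb) ≤ Ib) →
    ∀ ξ ∈ Ω ∩ ball Q (4 * R / 5), r / 2 ≤ dl Ω ξ → ∀ Λ : ℝ, lam * uD ξ < Λ →
    uR ξ ≤ lam * uD ξ + C * (Ib + Real.exp (-β1 / δ)) * Λ := by
  obtain ⟨Cb, βb, hCb, hβb, hbd⟩ := bdecay n hn2 M Cσ d cd hM hCσ hd hcd
  obtain ⟨Cl, Kl, γl, hCl, hKl, hγl, hlad⟩ := ladder n M hM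
  obtain ⟨Cc, Kc, γ, hCc, hKc, hcar⟩ := carleson n (by omega) M hM
  obtain ⟨θ, Kv, hθ, hθ1, hKv, hvs⟩ := vstep n M hM
  obtain ⟨θ', hθ'⟩ : ∃ θ' : ℝ, θ' = √θ := ⟨_, rfl⟩
  have hθ'0 : 0 < θ' := by rw [hθ']; exact Real.sqrt_pos.2 hθ
  have hθ'1 : θ' < 1 := by rw [hθ', Real.sqrt_lt' one_pos]; simpa using hθ1
  have hθ'2 : θ = θ' * θ' := by rw [hθ']; exact (Real.mul_self_sqrt hθ.le).symm
  obtain ⟨T, hT, hTs, -⟩ := geo_sum θ γ hθ hθ1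
  obtain ⟨T', hT', -, hTt⟩ := geo_sum θ' γ hθ'0 hθ'1
  obtain ⟨Ks, hKs⟩ : ∃ Ks : ℝ, Ks = 20 * (Kc * (Kv + 2 * M)) := ⟨_, rfl⟩
  have hKc0 : 0 < Kc := by linarith
  have hKl0 : 0 < Kl := by linarith
  have hM0 : 0 < M := by linarith
  have hKs0 : 0 < Ks := by rw [hKs]; positivity
  obtain ⟨C2, hC2⟩ : ∃ C2 : ℝ, C2 = Cc * (Kv + 2 * M) ^ γ * (Cl * (4 * M) ^ γl) := ⟨_, rfl⟩
  have hCc0 : 0 < Cc := by linarith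
  have hCl0 : 0 < Cl := by linarith
  have hC20 : 0 < C2 := by rw [hC2]; positivity
  obtain ⟨b, hb⟩ : ∃ b : ℝ, b = - Real.log θ' := ⟨_, rfl⟩
  have hb0 : 0 < b := by rw [hb]; linarith [Real.log_neg hθ'0 hθ'1]
  obtain ⟨M₀, hM₀⟩ : ∃ M₀ : ℝ, M₀ = 2 + 3 * Ks + 20 * (M * Kl) + 20 * M := ⟨_, rfl⟩
  have hM₀1 : 1 < M₀ := by rw [hM₀]; linarith [mul_pos hM0 hKl0]
  refine ⟨M₀, Cb * C2 * T + C2 * T' * Real.exp (3 * b), βb, b / Ks, hM₀1, by positivity, hβb, by positivity, ?_⟩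
  intro Ω σ hΩ hFr a Q R uR uD ha hR hRd hs hD0 hDc hDh hDz δ r hδ hr hδM lam hlam hdeep Ib hIb hI ξ hξ hξr Λ hΛ
  have hr0 : 0 < r := by rw [hr]; positivity
  have hδ1 : δ * M₀ ≤ 1 := by rwa [le_div_iff₀ (by linarith)] at hδM
  have hMr : 2 * r + 3 * (Ks * r) + 20 * (M * Kl * r) + 20 * (M * r) ≤ R := by
    have := mul_le_mul_of_nonneg_right hδ1 hR.le
    rw [hM₀] at this
    calc _ = δ * (2 + 3 * Ks + 20 * (M * Kl) + 20 * M) * R := by rw [hr]; ring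
      _ ≤ _ := this
      _ = R := one_mul R
  have p1 : 0 < Ks * r := by positivity
  have p2 : 0 < M * Kl * r := by positivity
  have p3 : 0 < M * r := by positivity
  have hξQ := mem_ball.1 hξ.2
  have hξR : ξ ∈ ball Q R := by rw [mem_ball]; linarith
  have hDξ := hD0 ξ ⟨subset_closure hξ.1, hξR⟩
  have hΛ0 : 0 < Λ := lt_of_le_of_lt (by positivity) hΛ
  obtain ⟨A, hA, hAd, hAξ⟩ := cork hΩ.nta hFr (subset_closure hξ.1) hr0 (by linarith)
  have hAQ : dist A Q < 9 * R / 10 := by linarith [dist_triangle A ξ Q]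
  have hAR : A ∈ ball Q R := by rw [mem_ball]; linarith
  have hsub : ball ξ (Kl * (2 * M * r)) ⊆ ball Q R := by
    intro Y hY
    rw [mem_ball] at *
    linarith [dist_triangle Y ξ Q]
  have hM1r : r ≤ M * r := le_mul_of_one_le_left hr0.le hM.le
  have hl := hlad Ω hΩ.nta hFr A hA ξ hξ.1 (2 * M * r) (r / 2) (by positivity) (by linarith) (by linarith) hξr hAξ
    (by linarith) uD (hDh.mono fun Y hY => ⟨hY.1, hsub hY.2⟩) (fun Y hY => hD0 Y ⟨subset_closure hY.1, hsub hY.2⟩)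
  have e4 : 2 * M * r / (r / 2) = 4 * M := by field_simp; ring
  rw [e4] at hl
  have hRA : uR A ≤ Cl * (4 * M) ^ γl * Λ := by
    calc uR A ≤ lam * uD A := hdeep A ⟨hA, hAR⟩ hAd
      _ ≤ lam * (Cl * (4 * M) ^ γl * uD ξ) := by gcongr
      _ = Cl * (4 * M) ^ γl * (lam * uD ξ) := by ring
      _ ≤ _ := by gcongr
  obtain ⟨J, hJ1, hJ2⟩ : ∃ J : ℕ, ((J:ℝ) + 2) * (Ks * r) ≤ R ∧ 1 / δ / Ks - 3 ≤ J := by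
    have h3 : 3 ≤ 1 / δ / Ks := by
      rw [div_div, le_div_iff₀ (by positivity)]
      rw [hM₀] at hδ1
      have q1 : 0 < δ * (M * Kl) := by positivity
      have q2 : 0 < δ * M := by positivity
      linarith
    have hf := Nat.floor_le (show 0 ≤ 1 / δ / Ks by linarith)
    have hf2 := Nat.lt_floor_add_one (1 / δ / Ks)
    have h3' : 3 ≤ ⌊1 / δ / Ks⌋₊ := Nat.le_floor (by exact_mod_cast h3)
    refine ⟨⌊1 / δ / Ks⌋₊ - 2, ?_, ?_⟩
    · rw [Nat.cast_sub (by omega)]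
      push_cast
      calc _ = (⌊1 / δ / Ks⌋₊ : ℝ) * (Ks * r) := by ring
        _ ≤ 1 / δ / Ks * (Ks * r) := by gcongr
        _ = R := by rw [hr]; field_simp
    · rw [Nat.cast_sub (by omega)]
      push_cast
      linarith
  have hjle : ∀ j : ℕ, j ≤ J → ((j:ℝ) + 2) * (Kc * (Kv + 2 * M)) * r ≤ R / 20 := by
    intro j hj
    have : ((j:ℝ) + 2) * (Ks * r) ≤ ((J:ℝ) + 2) * (Ks * r) := by gcongr
    rw [hKs] at this hJ1
    linarith
  have hjKv : ∀ j : ℕ, j ≤ J → ((j:ℝ) + 2) * (Kv * r) ≤ R / 20 := by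
    intro j hj
    refine le_trans ?_ (hjle j hj)
    calc ((j:ℝ) + 2) * (Kv * r) = ((j:ℝ) + 2) * (1 * (Kv + 0)) * r := by ring
      _ ≤ _ := by gcongr; positivity
  have hKvr : r ≤ Kv * r := le_mul_of_one_le_left hr0.le hKv
  have hSb : ∀ j : ℕ, j ≤ J → ∀ X ∈ closure Ω ∩ closedBall ξ (((j:ℝ) + 2) * (Kv * r)), uR X ≤ C2 * ((j:ℝ) + 2) ^ γ * Λ := by
    intro j hj X hX
    have hXξ := mem_closedBall.1 hX.2
    have hj0 : (0:ℝ) ≤ j := Nat.cast_nonneg j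
    have hq := hjle j hj
    have hLe : r ≤ ((j:ℝ) + 2) * (Kv + 2 * M) * r := by
      have := mul_le_mul (show (1:ℝ) ≤ j + 2 by linarith) (show 1 ≤ Kv + 2 * M by linarith) (by norm_num) (by linarith)
      exact le_mul_of_one_le_left hr0.le (by linarith)
    have hKL : Kc * (((j:ℝ) + 2) * (Kv + 2 * M) * r) ≤ R / 20 := by linarith
    have := hcar Cσ d cd Ω σ hΩ hFr a Q R uR ha hs X A (((j:ℝ) + 2) * (Kv + 2 * M) * r) r hX.1 hA hr0 hLe
      (by
        have := dist_triangle X ξ A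
        rw [dist_comm ξ A] at this
        have h5 : 1 * (2 * M * r) ≤ ((j:ℝ) + 2) * (2 * M * r) := by gcongr; linarith
        linarith) (by linarith) (by linarith) (by linarith)
    have e5 : ((j:ℝ) + 2) * (Kv + 2 * M) * r / r = ((j:ℝ) + 2) * (Kv + 2 * M) := by field_simp
    rw [e5] at this
    calc uR X ≤ _ := this
      _ ≤ Cc * (((j:ℝ) + 2) * (Kv + 2 * M)) ^ γ * (Cl * (4 * M) ^ γl * Λ) := by gcongr
      _ = _ := by rw [hC2, mul_pow]; ring
  set v : Eu n → ℝ := fun X => uR X - lam * uD X with hv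
  have hvc : ContinuousOn v (closure Ω ∩ ball Q R) := hs.contOn.sub (hDc.const_smul lam)
  have hvh : IsHarmonicOn v (Ω ∩ ball Q R) := harm_lin hs.harmonic hDh lam
  have hin : ∀ j : ℕ, j ≤ J → closedBall ξ (((j:ℝ) + 2) * (Kv * r)) ⊆ ball Q (9 * R / 10) := by
    intro j hj Y hY
    rw [mem_closedBall] at hY
    rw [mem_ball]
    linarith [dist_triangle Y ξ Q, hjKv j hj]
  have h9 : ball Q (9 * R / 10) ⊆ ball Q R := ball_subset_ball (by linarith)
  have hvle : ∀ X ∈ closure Ω ∩ ball Q R, v X ≤ uR X := by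
    intro X hX
    have := mul_nonneg (show 0 ≤ lam by linarith) (hD0 X hX)
    simp only [hv]; linarith
  have hit := iter_abs (fun j B => ∀ X ∈ Ω ∩ closedBall ξ ((j:ℝ) * (Kv * r)), v X ≤ B)
    (fun j => Cb * Ib * (C2 * ((j:ℝ) + 2) ^ γ * Λ)) (fun j => C2 * ((j:ℝ) + 2) ^ γ * Λ) θ hθ (fun j => by positivity) (fun j => by positivity) J
    (by
      intro j hj X hX
      have hX2 : X ∈ closedBall ξ (((j:ℝ) + 2) * (Kv * r)) := closedBall_subset_closedBall (by gcongr; linarith) hX.2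
      have hcl := subset_closure hX.1
      exact (hvle X ⟨hcl, h9 (hin j hj hX2)⟩).trans (hSb j hj X ⟨hcl, hX2⟩))
    (by
      intro j hj B hB hPB X hX
      have hXd := mem_closedBall.1 hX.2
      have hb1 : ball X (Kv * r) ⊆ closedBall ξ (((j + 1 : ℕ) : ℝ) * (Kv * r)) := by
        intro Y hY
        rw [mem_ball] at hY
        rw [mem_closedBall]
        push_cast
        linarith [dist_triangle Y X ξ]
      have hb2 : ball X (Kv * r) ⊆ ball Q R := fun Y hY =>
        h9 (hin j hj.le (closedBall_subset_closedBall (by push_cast; gcongr; linarith) (hb1 hY)))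
      refine hvs Ω hΩ.nta hFr X hX.1 r hr0 ?_ v (hvc.mono fun Y hY => ⟨hY.1, hb2 hY.2⟩) (hvh.mono fun Y hY => ⟨hY.1, hb2 hY.2⟩)
        _ B (by positivity) hB (fun Y hY => hPB Y ⟨hY.1, hb1 hY.2⟩) ?_ ?_
      · have := hjKv 0 (by omega)
        simp at this
        linarith
      · intro z hz
        have hz1 := mem_closedBall.1 (hb1 hz.2)
        push_cast at hz1
        have hz2 : z ∈ closedBall ξ (((j:ℝ) + 2) * (Kv * r)) := by rw [mem_closedBall]; linarith
        have hz9 := hin j hj.le hz2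
        obtain ⟨I, hI0, hIe, hIle⟩ := hI z ⟨hz.1, hz9⟩
        have hzQ := mem_ball.1 hz9
        have := hbd Ω σ hΩ hFr a Q R uR ha hs z hz.1 r (C2 * ((j:ℝ) + 2) ^ γ * Λ) I hr0 (by linarith) (by linarith) (by positivity)
          (by
            intro Y hY
            refine hSb j hj.le Y ⟨hY.1, ?_⟩
            have := mem_ball.1 hY.2
            rw [mem_closedBall]
            linarith [dist_triangle Y z ξ]) hI0 hIe
        refine (hvle z ⟨frontier_subset_closure hz.1, h9 hz9⟩).trans (this.trans ?_)
        gcongr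
      · intro Y hY hYd
        have := hdeep Y ⟨hY.1, hb2 hY.2⟩ hYd
        simp only [hv]; linarith)
  have hfin := hit ξ ⟨hξ.1, by simp⟩
  have hs1 : ∑ i ∈ Finset.range J, θ ^ i * (Cb * Ib * (C2 * ((i:ℝ) + 2) ^ γ * Λ)) ≤ Cb * C2 * T * Ib * Λ := by
    calc _ = Cb * C2 * Ib * Λ * ∑ i ∈ Finset.range J, θ ^ i * ((i:ℝ) + 2) ^ γ := by
          rw [Finset.mul_sum]; apply Finset.sum_congr rfl; intro i _; ring
      _ ≤ Cb * C2 * Ib * Λ * T := by gcongr; exact hTs J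
      _ = _ := by ring
  have hexp : θ' ^ J ≤ Real.exp (3 * b) * Real.exp (-(b / Ks) / δ) := by
    rw [← Real.exp_add]
    calc θ' ^ J = Real.exp (-(b * J)) := by
          rw [hb, ← Real.rpow_natCast, Real.rpow_def_of_pos hθ'0]; congr 1; ring
      _ ≤ _ := by
          apply Real.exp_le_exp.2
          have := mul_le_mul_of_nonneg_left hJ2 hb0.le
          have e6 : b * (1 / δ / Ks - 3) = -(-(b / Ks) / δ) - 3 * b := by field_simp
          linarith
  have hs2 : θ ^ J * (C2 * ((J:ℝ) + 2) ^ γ * Λ) ≤ C2 * T' * Real.exp (3 * b) * Real.exp (-(b / Ks) / δ) * Λ := by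
    calc _ = C2 * (θ' ^ J * (θ' ^ J * ((J:ℝ) + 2) ^ γ)) * Λ := by rw [hθ'2, mul_pow]; ring
      _ ≤ C2 * ((Real.exp (3 * b) * Real.exp (-(b / Ks) / δ)) * T') * Λ := by
          gcongr; exact hTt J
      _ = _ := by ring
  simp only [hv] at hfin
  have hE := Real.exp_pos (-(b / Ks) / δ)
  have hE3 := Real.exp_pos (3 * b)
  have x1 : 0 ≤ Cb * C2 * T * Real.exp (-(b / Ks) / δ) * Λ := by positivity
  have x2 : 0 ≤ C2 * T' * Real.exp (3 * b) * Ib * Λ := by positivity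
  have e7 : (Cb * C2 * T + C2 * T' * Real.exp (3 * b)) * (Ib + Real.exp (-(b / Ks) / δ)) * Λ =
    Cb * C2 * T * Ib * Λ + C2 * T' * Real.exp (3 * b) * Real.exp (-(b / Ks) / δ) * Λ + Cb * C2 * T * Real.exp (-(b / Ks) / δ) * Λ
      + C2 * T' * Real.exp (3 * b) * Ib * Λ := by ring
  rw [e7]
  linarith

end


/-- The key iteration lemma: a control `u_R ≤ λ u_D` at depth `δ₀R` in `B(Q,R)`
improves to a control `u_R ≤ (1+η) λ u_D` at depth `δ₀R/2` in `B(Q,4R/5)`, with the explicit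
gain `η`. -/
theorem stmt_4 (n : ℕ) (hn : 3 ≤ n) (M Cσ d cd : ℝ) :
    ∃ M₀ C β : ℝ, 1 < M₀ ∧ 1 ≤ C ∧ 0 < β ∧
      ∀ (Ω : Set (EuclideanSpace ℝ (Fin n))) (σ : MeasureTheory.Measure (EuclideanSpace ℝ (Fin n))),
        IsMixedPair M Cσ d cd Ω σ →
        ∀ Q ∈ frontier Ω, ∀ R : ℝ, 0 < R → R ≤ Metric.diam Ω →
        ∀ a : ℝ, 0 < a →
        ∀ uR uD : EuclideanSpace ℝ (Fin n) → ℝ,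
          IsRobinLocalSolution Ω σ a Q R uR →
          (∀ X ∈ closure Ω ∩ Metric.ball Q R, 0 ≤ uD X) →
          ContinuousOn uD (closure Ω ∩ Metric.ball Q R) →
          IsHarmonicOn uD (Ω ∩ Metric.ball Q R) →
          (∀ P ∈ frontier Ω ∩ Metric.ball Q R, uD P = 0) →
          ∀ δ₀ : ℝ, 0 < δ₀ → δ₀ ≤ 1 / M₀ →
            (∀ z ∈ frontier Ω ∩ Metric.ball Q (9 * R / 10),
              M₀ < a * (δ₀ * R) ^ ((2 : ℝ) - n) * (σ (Metric.ball z (δ₀ * R))).toReal) →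
            (∀ X ∈ Ω ∩ Metric.ball Q R, uD X ≤ uR X) →
            ∀ lam : ℝ, 1 ≤ lam →
              (∀ X ∈ Ω ∩ Metric.ball Q R,
                δ₀ * R ≤ Metric.infDist X (frontier Ω) → uR X ≤ lam * uD X) →
              ∀ ξ ∈ Ω ∩ Metric.ball Q (4 * R / 5),
                δ₀ * R / 2 ≤ Metric.infDist ξ (frontier Ω) →
                uR ξ ≤
                  (1 + C * min (M₀ ^ (-β))
                      (Real.exp (-β / δ₀) +
                        sSup ((fun z =>
                            (a * (δ₀ * R) ^ ((2 : ℝ) - n) *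
                              (σ (Metric.ball z (δ₀ * R))).toReal) ^ (-β)) ''
                          (frontier Ω ∩ Metric.ball Q (9 * R / 10))))) * lam * uD ξ := by
  by_cases hgood : 1 < M ∧ 0 < Cσ ∧ (n:ℝ) - 2 < d ∧ 0 < cd
  swap
  · refine ⟨2, 1, 1, by norm_num, le_refl _, one_pos, ?_⟩
    intro Ω σ hΩ
    exact absurd ⟨hΩ.nta.M_gt_one, hΩ.Cσ_pos, hΩ.d_gt, hΩ.cd_pos⟩ hgood
  obtain ⟨hM, hCσ, hd, hcd⟩ := hgood
  obtain ⟨M₀, C, βb, β1, hM₀, hC, hβb, hβ1, hcore⟩ := core n (by omega) M Cσ d cd hM hCσ hd hcd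
  obtain ⟨β, hβ⟩ : ∃ β : ℝ, β = min βb β1 := ⟨_, rfl⟩
  have hβ0 : 0 < β := by rw [hβ]; exact lt_min hβb hβ1
  have hβle : β ≤ βb := hβ ▸ min_le_left _ _
  have hβle1 : β ≤ β1 := hβ ▸ min_le_right _ _
  refine ⟨M₀, 2 * C + 1, β, hM₀, by linarith, hβ0, ?_⟩
  intro Ω σ hΩ Q hQ R hR hRd a ha uR uD hs hD0 hDc hDh hDz δ₀ hδ hδM hI _ lam hlam hdeep ξ hξ hξr
  have hM₀0 : 0 < M₀ := by linarith
  have hr0 : 0 < δ₀ * R := by positivity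
  obtain ⟨Ib, hIb⟩ : ∃ Ib : ℝ, Ib = sSup ((fun z => (a * (δ₀ * R) ^ ((2 : ℝ) - n) *
      (σ (Metric.ball z (δ₀ * R))).toReal) ^ (-β)) '' (frontier Ω ∩ Metric.ball Q (9 * R / 10))) := ⟨_, rfl⟩
  have hle : ∀ z ∈ frontier Ω ∩ Metric.ball Q (9 * R / 10), (a * (δ₀ * R) ^ ((2 : ℝ) - n) *
      (σ (Metric.ball z (δ₀ * R))).toReal) ^ (-β) ≤ M₀ ^ (-β) := fun z hz =>
    Real.rpow_le_rpow_of_nonpos hM₀0 (hI z hz).le (by linarith)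
  have hbdd : BddAbove ((fun z => (a * (δ₀ * R) ^ ((2 : ℝ) - n) *
      (σ (Metric.ball z (δ₀ * R))).toReal) ^ (-β)) '' (frontier Ω ∩ Metric.ball Q (9 * R / 10))) := by
    refine ⟨M₀ ^ (-β), ?_⟩
    rintro _ ⟨z, hz, rfl⟩
    exact hle z hz
  have hIb0 : 0 ≤ Ib := by
    rw [hIb]
    apply Real.sSup_nonneg
    rintro _ ⟨z, hz, rfl⟩
    have := hI z hz
    exact Real.rpow_nonneg (by linarith) _
  have hIbM : Ib ≤ M₀ ^ (-β) := by
    rw [hIb]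
    apply csSup_le
    · exact ⟨_, Q, ⟨hQ, Metric.mem_ball_self (by positivity)⟩, rfl⟩
    · rintro _ ⟨z, hz, rfl⟩
      exact hle z hz
  have hE : Real.exp (-β / δ₀) ≤ M₀ ^ (-β) := by
    have h1 : M₀ ≤ 1 / δ₀ := by
      rw [le_div_iff₀ hδ, mul_comm]
      rwa [le_div_iff₀ hM₀0] at hδM
    calc Real.exp (-β / δ₀) = Real.exp (1 / δ₀) ^ (-β) := by
          rw [← Real.exp_mul]; congr 1; ring
      _ ≤ M₀ ^ (-β) := by
          apply Real.rpow_le_rpow_of_nonpos hM₀0 _ (by linarith)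
          linarith [Real.add_one_le_exp (1 / δ₀)]
  have hE1 : Real.exp (-β1 / δ₀) ≤ Real.exp (-β / δ₀) := by
    apply Real.exp_le_exp.2
    gcongr
  have hrn : (δ₀ * R) ^ ((2 : ℝ) - n) * ((δ₀ * R) ^ n / (δ₀ * R) ^ 2) = 1 := by
    rw [Real.rpow_sub hr0, Real.rpow_natCast, show (2:ℝ) = ((2:ℕ):ℝ) by norm_num, Real.rpow_natCast]
    field_simp
  have hmain := hcore Ω σ hΩ ⟨Q, hQ⟩ a Q R uR uD ha.le hR hRd hs hD0 hDc hDh hDz δ₀ (δ₀ * R) hδ rfl hδM lam hlam hdeep Ib hIb0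
    (fun z hz => by
      have hIz := hI z hz
      refine ⟨_, hM₀0.trans hIz, ?_, ?_⟩
      · calc _ = a * (σ (Metric.ball z (δ₀ * R))).toReal * ((δ₀ * R) ^ ((2 : ℝ) - n) * ((δ₀ * R) ^ n / (δ₀ * R) ^ 2)) := by ring
          _ = _ := by rw [hrn, mul_one]
      · refine (Real.rpow_le_rpow_of_exponent_le (by linarith) (show -βb ≤ -β by linarith)).trans ?_
        rw [hIb]
        exact le_csSup hbdd ⟨z, hz, rfl⟩) ξ hξ hξr
  rw [← hIb]
  have hDξ := hD0 ξ ⟨subset_closure hξ.1, Metric.ball_subset_ball (by linarith) hξ.2⟩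
  obtain ⟨κ, hκ⟩ : ∃ κ : ℝ, κ = C * (Ib + Real.exp (-β1 / δ₀)) := ⟨_, rfl⟩
  rw [← hκ] at hmain
  have hκ0 : 0 < κ := by rw [hκ]; positivity
  have h1 : uR ξ ≤ lam * uD ξ + κ * (lam * uD ξ) := by
    apply le_of_forall_pos_le_add
    intro ε hε
    have := hmain (lam * uD ξ + ε / κ) (by linarith [div_pos hε hκ0])
    have e : κ * (lam * uD ξ + ε / κ) = κ * (lam * uD ξ) + ε := by field_simp
    linarith
  have hmin : κ ≤ (2 * C + 1) * min (M₀ ^ (-β)) (Real.exp (-β / δ₀) + Ib) := by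
    have hp := Real.exp_pos (-β / δ₀)
    have hs1 : Ib + Real.exp (-β1 / δ₀) ≤ 2 * min (M₀ ^ (-β)) (Real.exp (-β / δ₀) + Ib) := by
      rcases min_choice (M₀ ^ (-β)) (Real.exp (-β / δ₀) + Ib) with h | h <;> rw [h] <;> linarith
    have hm0 : 0 ≤ min (M₀ ^ (-β)) (Real.exp (-β / δ₀) + Ib) := le_min (by positivity) (by positivity)
    rw [hκ]
    have := mul_le_mul_of_nonneg_left hs1 hC.le
    linarith
  have h2 := mul_le_mul_of_nonneg_right hmin (show 0 ≤ lam * uD ξ by positivity)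
  linarith
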